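/- Let r ≥ 1, d ≥ 4 and ε > 0. There exists a constant C = C(d,r,ε) with the following property. Let F ∈ ℤ[z_1,…,z_{r+2}] be a homogeneous polynomial of degree d which is absolutely irreducible over ℚ, defining the hypersurface X = {F = 0} ⊂ P^{r+1} over ℚ. Suppose the singular locus of X has codimension at least three in X; i.e. the Krull dimension of the ring ℚ̄[z_1,…,z_{r+2}]/(F, ∂F/∂z_1, …, ∂F/∂z_{r+2}) is at most r−2. Then for every real B ≥ 1 one has N(X;B) ≤ C·B^{r+ε}. -/

import Mathlib

open MvPolynomial

noncomputable def ev (n : ℕ) (i : Fin (n + 1)) :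
    MvPolynomial (Fin (n + 1)) ℤ ≃ₐ[ℤ] Polynomial (MvPolynomial (Fin n) ℤ) :=
  (renameEquiv ℤ (finSuccEquiv' i)).trans (optionEquivLeft ℤ (Fin n))

lemma ev_X_self (n : ℕ) (i : Fin (n + 1)) : ev n i (X i) = Polynomial.X := by
  simp [ev]

lemma ev_X_ne (n : ℕ) (i : Fin (n + 1)) (j : Fin n) :
    ev n i (X (i.succAbove j)) = Polynomial.C (X j) := by
  simp [ev]

lemma ev_aeval {A : Type*} [CommRing A] (n : ℕ) (i : Fin (n + 1)) (x : Fin (n + 1) → A)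
    (f : MvPolynomial (Fin (n + 1)) ℤ) :
    aeval x f = Polynomial.eval₂ (aeval (fun j => x (i.succAbove j)) :
      MvPolynomial (Fin n) ℤ →ₐ[ℤ] A).toRingHom (x i) (ev n i f) := by
  have : (aeval x : MvPolynomial (Fin (n + 1)) ℤ →ₐ[ℤ] A).toRingHom =
      (Polynomial.eval₂RingHom (aeval (fun j => x (i.succAbove j)) :
      MvPolynomial (Fin n) ℤ →ₐ[ℤ] A).toRingHom (x i)).comp (ev n i).toRingEquiv.toRingHom := by
    apply MvPolynomial.ringHom_ext
    · intro r; simp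
    · intro j
      refine Fin.succAboveCases i ?_ ?_ j
      · simp [ev_X_self]
      · intro j; simp [ev_X_ne]
  exact congrArg (fun g => g f) this

lemma ev_coeff_deg (n : ℕ) (i : Fin (n + 1)) (f : MvPolynomial (Fin (n + 1)) ℤ) (k : ℕ) :
    ((ev n i f).coeff k).totalDegree ≤ f.totalDegree := by
  refine (totalDegree_coeff_optionEquivLeft_le _ _ _ _).trans ?_
  exact totalDegree_rename_le _ _

lemma ev_natDegree (n : ℕ) (i : Fin (n + 1)) (f : MvPolynomial (Fin (n + 1)) ℤ) :
    (ev n i f).natDegree = f.degreeOf i := by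
  simp only [ev, AlgEquiv.trans_apply, natDegree_optionEquivLeft, renameEquiv_apply]
  have := degreeOf_rename_of_injective (p := f) (finSuccEquiv' i).injective i
  simpa using this

lemma totalDegree_det_le {n D : ℕ} {σ : Type*} (M : Matrix (Fin n) (Fin n) (MvPolynomial σ ℤ))
    (h : ∀ i j, (M i j).totalDegree ≤ D) : M.det.totalDegree ≤ n * D := by
  rw [Matrix.det_apply]
  apply totalDegree_finsetSum_le
  intro σ' _
  refine (totalDegree_smul_le _ _).trans ?_
  refine (totalDegree_finsetProd _ _).trans ?_
  refine (Finset.sum_le_sum (fun i _ => h _ _)).trans ?_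
  simp

/-- elimination -/
lemma elim (n : ℕ) (i : Fin (n + 1)) (D : ℕ) (f g : MvPolynomial (Fin (n + 1)) ℤ)
    (hf : Irreducible f) (hfg : ¬ f ∣ g) (hfD : f.totalDegree ≤ D) (hgD : g.totalDegree ≤ D) :
    ∃ R : MvPolynomial (Fin n) ℤ, R ≠ 0 ∧ R.totalDegree ≤ (2 * D + 1) * D ∧
      ∀ x : Fin (n + 1) → ℚ, aeval x f = 0 → aeval x g = 0 →
        aeval (fun j => x (i.succAbove j)) R = 0 := by
  set f' := ev n i f with hf'
  set g' := ev n i g with hg'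
  have hirr : Irreducible f' := (MulEquiv.irreducible_iff (ev n i).toMulEquiv).2 hf
  have hnd : ¬ f' ∣ g' := fun h => hfg ((map_dvd_iff (ev n i)).1 h)
  have hdf : f'.natDegree ≤ D := by
    rw [hf', ev_natDegree]; exact (degreeOf_le_totalDegree f i).trans hfD
  have hdg : g'.natDegree ≤ D := by
    rw [hg', ev_natDegree]; exact (degreeOf_le_totalDegree g i).trans hgD
  by_cases h0 : f'.natDegree = 0
  · refine ⟨f'.coeff 0, ?_, ?_, ?_⟩
    · intro h
      rw [Polynomial.eq_C_of_natDegree_eq_zero h0, h] at hirr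
      simp at hirr
    · refine (ev_coeff_deg n i f 0).trans (hfD.trans ?_); nlinarith
    · intro x hx _
      rw [ev_aeval n i, ← hf', Polynomial.eq_C_of_natDegree_eq_zero h0] at hx
      simpa using hx
  · refine ⟨f'.resultant g', ?_, ?_, ?_⟩
    · let K := FractionRing (MvPolynomial (Fin n) ℤ)
      have hinj : Function.Injective (algebraMap (MvPolynomial (Fin n) ℤ) K) :=
        IsFractionRing.injective _ _
      have hprim := hirr.isPrimitive h0
      have h1 : Irreducible (f'.map (algebraMap _ K)) :=
        (hprim.irreducible_iff_irreducible_map_fraction_map).1 hirr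
      have h2 : IsCoprime (f'.map (algebraMap _ K)) (g'.map (algebraMap _ K)) := by
        refine (h1.coprime_iff_not_dvd).2 ?_
        intro hd
        exact hnd (Polynomial.IsPrimitive.dvd_of_fraction_map_dvd_fraction_map (K := K) hprim hd)
      intro hres
      have h3 := congrArg (algebraMap (MvPolynomial (Fin n) ℤ) K) hres
      rw [← Polynomial.resultant_map_map, map_zero] at h3
      have h4 := (Polynomial.resultant_eq_zero_iff (f := f'.map (algebraMap _ K))
        (g := g'.map (algebraMap _ K))).1 (by
          rw [Polynomial.natDegree_map_eq_of_injective hinj, Polynomial.natDegree_map_eq_of_injective hinj]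
          exact h3)
      exact h4.2 h2
    · unfold Polynomial.resultant
      refine (totalDegree_det_le (D := D) _ ?_).trans ?_
      · intro a b
        rw [Polynomial.sylvester]
        simp only [Matrix.of_apply]
        refine Fin.addCases ?_ ?_ b
        · intro j; simp only [Fin.addCases_left]; split_ifs
          · exact (ev_coeff_deg _ _ _ _).trans ‹_›
          · simp
        · intro j; simp only [Fin.addCases_right]; split_ifs
          · exact (ev_coeff_deg _ _ _ _).trans ‹_›
          · simp
      · exact Nat.mul_le_mul_right _ (by omega)
    · intro x hx hy
      obtain ⟨p, q, -, -, h⟩ := Polynomial.exists_mul_add_mul_eq_C_resultant f' g' le_rfl le_rfl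
        (Or.inl h0)
      rw [ev_aeval n i, ← hf'] at hx
      rw [ev_aeval n i, ← hg'] at hy
      have := congrArg (Polynomial.eval₂ (aeval (fun j => x (i.succAbove j)) :
        MvPolynomial (Fin n) ℤ →ₐ[ℤ] ℚ).toRingHom (x i)) h
      rw [Polynomial.eval₂_add, Polynomial.eval₂_mul, Polynomial.eval₂_mul, hx, hy] at this
      simpa using this.symm


lemma aeval_cast {n : ℕ} (A : Type*) [CommRing A] (x : Fin n → ℤ) (f : MvPolynomial (Fin n) ℤ) :
    aeval (fun i => (x i : A)) f = ((eval x f : ℤ) : A) := by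
  have := MvPolynomial.aeval_algebraMap_apply A x f
  simpa [MvPolynomial.aeval_eq_eval, Function.comp_def] using this

lemma aeval_cast_zero {n : ℕ} (x : Fin n → ℤ) (f : MvPolynomial (Fin n) ℤ) :
    aeval (fun i => (x i : ℚ)) f = 0 ↔ eval x f = 0 := by
  rw [aeval_cast]; simp

lemma zeros1 (R : MvPolynomial (Fin 1) ℤ) (hR : R ≠ 0) (D : ℕ) (hD : R.totalDegree ≤ D) :
    ∃ Z : Finset ℚ, Z.card ≤ D ∧ ∀ x : Fin 1 → ℚ, aeval x R = 0 → x 0 ∈ Z := by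
  classical
  let φ : MvPolynomial (Fin 0) ℤ →+* ℚ := (aeval (fun j : Fin 0 => (0 : ℚ)) :
      MvPolynomial (Fin 0) ℤ →ₐ[ℤ] ℚ).toRingHom
  have hφ : Function.Injective φ := by
    intro a b hab
    obtain ⟨a, rfl⟩ := C_surjective (Fin 0) a
    obtain ⟨b, rfl⟩ := C_surjective (Fin 0) b
    simpa [φ] using hab
  set p := (ev 0 0 R).map φ with hp
  have hp0 : p ≠ 0 := by
    rw [hp, Ne, Polynomial.map_eq_zero_iff hφ]
    simpa using hR
  refine ⟨p.roots.toFinset, ?_, ?_⟩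
  · refine (Multiset.toFinset_card_le _).trans ((Polynomial.card_roots' p).trans ?_)
    rw [hp, Polynomial.natDegree_map_eq_of_injective hφ, ev_natDegree]
    exact (degreeOf_le_totalDegree R 0).trans hD
  · intro x hx
    rw [Multiset.mem_toFinset, Polynomial.mem_roots hp0, Polynomial.IsRoot, hp, Polynomial.eval_map]
    rw [ev_aeval 0 0] at hx
    convert hx using 2
    simp only [φ]; congr 2; funext j; exact j.elim0

/-- finitely many common zeros of two plane curves -/
lemma bezout2 (D : ℕ) (f g : MvPolynomial (Fin 2) ℤ)
    (hf : Irreducible f) (hfg : ¬ f ∣ g) (hfD : f.totalDegree ≤ D) (hgD : g.totalDegree ≤ D) :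
    ∃ Z : Finset (Fin 2 → ℚ), Z.card ≤ ((2 * D + 1) * D) ^ 2 ∧
      ∀ x : Fin 2 → ℚ, aeval x f = 0 → aeval x g = 0 → x ∈ Z := by
  classical
  obtain ⟨R0, h0, hd0, hz0⟩ := elim 1 0 D f g hf hfg hfD hgD
  obtain ⟨R1, h1, hd1, hz1⟩ := elim 1 1 D f g hf hfg hfD hgD
  obtain ⟨Z0, hc0, hZ0⟩ := zeros1 R0 h0 _ hd0
  obtain ⟨Z1, hc1, hZ1⟩ := zeros1 R1 h1 _ hd1
  refine ⟨Fintype.piFinset ![Z1, Z0], ?_, ?_⟩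
  · rw [Fintype.card_piFinset]; simp [Fin.prod_univ_two, sq]; gcongr
  · intro x hx hy
    rw [Fintype.mem_piFinset]
    have a := hZ0 _ (hz0 x hx hy)
    have b := hZ1 _ (hz1 x hx hy)
    rw [Fin.forall_fin_two]
    exact ⟨by simpa using b, by simpa using a⟩

lemma bezout2_card (D : ℕ) (f g : MvPolynomial (Fin 2) ℤ)
    (hf : Irreducible f) (hfg : ¬ f ∣ g) (hfD : f.totalDegree ≤ D) (hgD : g.totalDegree ≤ D)
    (A : Finset (Fin 2 → ℤ)) (hA : ∀ x ∈ A, eval x f = 0 ∧ eval x g = 0) :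
    A.card ≤ ((2 * D + 1) * D) ^ 2 := by
  obtain ⟨Z, hc, hZ⟩ := bezout2 D f g hf hfg hfD hgD
  refine le_trans (Finset.card_le_card_of_injOn (fun x i => (x i : ℚ)) ?_ ?_) hc
  · intro x hx
    exact hZ _ ((aeval_cast_zero x f).2 (hA x hx).1) ((aeval_cast_zero x g).2 (hA x hx).2)
  · intro x _ y _ h
    funext i
    have h2 := congrFun h i
    simpa using h2

lemma ev_coeff_top (n d : ℕ) (i : Fin (n + 1)) (f : MvPolynomial (Fin (n + 1)) ℤ)
    (hf : f.totalDegree ≤ d) : (ev n i f).coeff d = C (coeff (Finsupp.single i d) f) := by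
  have hc : coeff 0 ((ev n i f).coeff d) = coeff (Finsupp.single i d) f := by
    simp only [ev, AlgEquiv.trans_apply, renameEquiv_apply]
    rw [optionEquivLeft_coeff_coeff]
    have := coeff_rename_mapDomain (finSuccEquiv' i) (finSuccEquiv' i).injective f
      (Finsupp.single i d)
    rw [Finsupp.mapDomain_single] at this
    rw [← this]
    congr 1
    ext a
    cases a <;> simp [Finsupp.single_apply]
  rw [← hc]
  by_cases h0 : (ev n i f).coeff d = 0
  · rw [h0]; simp
  have h1 : ((ev n i f).coeff d).totalDegree + d ≤ f.totalDegree := by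
    refine (totalDegree_coeff_optionEquivLeft_add_le _ _ _ _ ?_).trans (totalDegree_rename_le _ _)
    have h2 := Polynomial.le_natDegree_of_ne_zero h0
    rw [ev_natDegree] at h2
    refine (h2.trans (degreeOf_le_totalDegree f i)).trans ?_
    exact (totalDegree_renameEquiv (finSuccEquiv' i) f).ge
  exact totalDegree_eq_zero_iff_eq_C.1 (by omega)

lemma fibre {A : Type*} [CommRing A] [IsDomain A] (n d : ℕ) (i : Fin (n + 1))
    (f : MvPolynomial (Fin (n + 1)) ℤ)
    (hf : f.totalDegree ≤ d) (hlc : ((coeff (Finsupp.single i d) f : ℤ) : A) ≠ 0) (y : Fin n → A) :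
    ∃ Z : Finset A, Z.card ≤ d ∧ ∀ x : Fin (n + 1) → A, (∀ j, x (i.succAbove j) = y j) →
      aeval x f = 0 → x i ∈ Z := by
  classical
  set p := (ev n i f).map (aeval y : MvPolynomial (Fin n) ℤ →ₐ[ℤ] A).toRingHom with hp
  have hp0 : p ≠ 0 := by
    intro h
    have := congrArg (fun q => Polynomial.coeff q d) h
    simp [hp, Polynomial.coeff_map, ev_coeff_top n d i f hf] at this
    exact hlc this
  refine ⟨p.roots.toFinset, ?_, ?_⟩
  · refine (Multiset.toFinset_card_le _).trans ((Polynomial.card_roots' p).trans ?_)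
    refine Polynomial.natDegree_map_le.trans ?_
    rw [ev_natDegree]
    exact (degreeOf_le_totalDegree f i).trans hf
  · intro x hxy hx
    rw [Multiset.mem_toFinset, Polynomial.mem_roots hp0, Polynomial.IsRoot, hp, Polynomial.eval_map]
    rw [ev_aeval n i] at hx
    have : (fun j => x (i.succAbove j)) = y := funext hxy
    rw [this] at hx
    exact hx

lemma card_le_fibre {α β : Type*} [DecidableEq β] (A : Finset α) (g : α → β) (c : ℕ)
    (h : ∀ b, ∀ A' ⊆ A, (∀ a ∈ A', g a = b) → A'.card ≤ c) (B : Finset β)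
    (hB : ∀ a ∈ A, g a ∈ B) :
    A.card ≤ c * B.card := by
  classical
  refine Finset.card_le_mul_card_image_of_maps_to hB c ?_
  intro b _
  exact h b _ (Finset.filter_subset _ _) (fun a ha => (Finset.mem_filter.1 ha).2)

lemma drop_card (n d : ℕ) (i : Fin (n + 1)) (f : MvPolynomial (Fin (n + 1)) ℤ)
    (hf : f.totalDegree ≤ d) (hlc : coeff (Finsupp.single i d) f ≠ 0)
    (A : Finset (Fin (n + 1) → ℤ)) (hA : ∀ x ∈ A, eval x f = 0) (B : Finset (Fin n → ℤ))
    (hB : ∀ x ∈ A, (fun j => x (i.succAbove j)) ∈ B) : A.card ≤ d * B.card := by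
  classical
  refine card_le_fibre A (fun x j => x (i.succAbove j)) d ?_ B hB
  intro y A' hA' hy
  obtain ⟨Z, hc, hZ⟩ := fibre (A := ℤ) n d i f hf (by simpa using hlc) y
  refine le_trans (Finset.card_le_card_of_injOn (fun x => x i) ?_ ?_) hc
  · intro x hx
    refine hZ x (fun j => congrFun (hy x hx) j) ?_
    rw [MvPolynomial.aeval_eq_eval]; exact hA x (hA' hx)
  · intro x hx z hz h
    funext j
    refine Fin.succAboveCases i h ?_ j
    intro j
    exact (congrFun (hy x hx) j).trans (congrFun (hy z hz) j).symm

lemma box_zeros (n N D : ℕ) (R : MvPolynomial (Fin (n + 1)) ℤ) (hR : R ≠ 0)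
    (hD : R.totalDegree ≤ D)
    (A : Finset (Fin (n + 1) → ℤ)) (hA : ∀ x ∈ A, eval x R = 0 ∧ ∀ i, |x i| ≤ N) :
    A.card ≤ D * (2 * N + 1) ^ n := by
  classical
  have h := schwartz_zippel_totalDegree hR (Finset.Icc (-(N : ℤ)) N)
  have hcard : (Finset.Icc (-(N : ℤ)) N).card = 2 * N + 1 := by
    rw [Int.card_Icc]; omega
  rw [hcard] at h
  have hA' : A ⊆ {f ∈ Fintype.piFinset (fun _ : Fin (n + 1) ↦ Finset.Icc (-(N : ℤ)) N) | eval f R = 0} := by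
    intro x hx
    rw [Finset.mem_filter, Fintype.mem_piFinset]
    exact ⟨fun i => Finset.mem_Icc.2 (abs_le.1 ((hA x hx).2 i)), (hA x hx).1⟩
  have h1 := Finset.card_le_card hA'
  rw [div_le_div_iff₀ (by positivity) (by positivity)] at h
  have h2 : Finset.card {f ∈ Fintype.piFinset (fun _ : Fin (n + 1) ↦ Finset.Icc (-(N : ℤ)) N) | eval f R = 0}
      * (2 * N + 1) ≤ R.totalDegree * (2 * N + 1) ^ (n + 1) := by exact_mod_cast h
  rw [pow_succ, ← mul_assoc] at h2
  have h3 := Nat.le_of_mul_le_mul_right h2 (by omega)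
  exact h1.trans (h3.trans (Nat.mul_le_mul_right _ hD))

/-- surface meets another surface in O(N) points -/
lemma surf_card (N d D : ℕ) (f g : MvPolynomial (Fin 3) ℤ)
    (hf : Irreducible f) (hfg : ¬ f ∣ g) (hfD : f.totalDegree ≤ D) (hgD : g.totalDegree ≤ D)
    (hfd : f.totalDegree ≤ d) (hlc : coeff (Finsupp.single 2 d) f ≠ 0)
    (A : Finset (Fin 3 → ℤ)) (hA : ∀ x ∈ A, eval x f = 0 ∧ eval x g = 0 ∧ ∀ i, |x i| ≤ N) :
    A.card ≤ d * ((2 * D + 1) * D * (2 * N + 1)) := by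
  classical
  obtain ⟨R, h0, hd, hz⟩ := elim 2 2 D f g hf hfg hfD hgD
  refine (drop_card 2 d 2 f hfd hlc A (fun x hx => (hA x hx).1)
    (A.image fun x j => x ((2 : Fin 3).succAbove j))
    (fun x hx => Finset.mem_image_of_mem _ hx)).trans ?_
  refine Nat.mul_le_mul_left _ ?_
  refine (box_zeros 1 N _ R h0 hd _ ?_).trans (by simp)
  intro y hy
  obtain ⟨x, hx, rfl⟩ := Finset.mem_image.1 hy
  refine ⟨?_, fun i => (hA x hx).2.2 _⟩
  rw [← aeval_cast_zero]
  exact hz (fun i => (x i : ℚ)) ((aeval_cast_zero x f).2 (hA x hx).1)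
    ((aeval_cast_zero x g).2 (hA x hx).2.1)


lemma clear_den {ι : Type*} [Fintype ι] (q : ι → ℚ) :
    ∃ m : ℤ, m ≠ 0 ∧ ∃ c : ι → ℤ, ∀ j, (c j : ℚ) = m * q j := by
  obtain ⟨b, hb⟩ := IsLocalization.exist_integer_multiples_of_finite (nonZeroDivisors ℤ) q
  refine ⟨b, nonZeroDivisors.ne_zero b.2, fun j => (hb j).choose, fun j => ?_⟩
  have := (hb j).choose_spec
  simpa [Algebra.smul_def] using this

lemma kill_of_span {ι : Type*} [Fintype ι] (c : ι → ℚ) (S T : Set (ι → ℚ))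
    (h : Submodule.span ℚ T = Submodule.span ℚ S) (hT : ∀ r ∈ T, ∑ j, c j * r j = 0) :
    ∀ r ∈ S, ∑ j, c j * r j = 0 := by
  let φ : (ι → ℚ) →ₗ[ℚ] ℚ := ∑ j, c j • LinearMap.proj j
  have hφ : ∀ r, φ r = ∑ j, c j * r j := fun r => by simp [φ]
  have h1 : Submodule.span ℚ T ≤ LinearMap.ker φ := by
    rw [Submodule.span_le]
    intro r hr
    simp only [SetLike.mem_coe, LinearMap.mem_ker, hφ]
    exact hT r hr
  intro r hr
  rw [← hφ]
  exact h1 (h ▸ Submodule.subset_span hr)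

lemma lin_dep {ι : Type*} [Fintype ι] [DecidableEq ι] (S : Set (ι → ℤ))
    (h : ∀ r : ι → ι → ℤ, (∀ a, r a ∈ S) → Matrix.det (Matrix.of r) = 0) :
    ∃ c : ι → ℤ, c ≠ 0 ∧ ∀ r ∈ S, ∑ j, c j * r j = 0 := by
  let v : S → (ι → ℚ) := fun r j => ((r : ι → ℤ) j : ℚ)
  obtain ⟨κ, a, -, hspan, hli⟩ := exists_linearIndependent' ℚ v
  have hfin : Finite κ := hli.finite
  have := Fintype.ofFinite κ
  have hne : Submodule.span ℚ (Set.range v) ≠ ⊤ := by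
    intro htop
    rw [← hspan] at htop
    have hcard := linearIndependent_iff_card_eq_finrank_span.1 hli
    rw [Set.finrank, htop, finrank_top, Module.finrank_fintype_fun_eq_card] at hcard
    let e : ι ≃ κ := (Fintype.equivOfCardEq hcard).symm
    have hd := h (fun i => (a (e i) : ι → ℤ)) (fun i => (a (e i)).2)
    have hli2 : LinearIndependent ℚ (fun i => v (a (e i))) := hli.comp e e.injective
    have hu := Matrix.linearIndependent_rows_iff_isUnit (A := Matrix.of (fun i => v (a (e i)))).1 hli2
    rw [Matrix.isUnit_iff_isUnit_det] at hu
    have h2 : (Matrix.of (fun i => v (a (e i)))).det =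
        ((Matrix.of (fun i => (a (e i) : ι → ℤ))).det : ℚ) := by
      rw [Int.cast_det]; rfl
    rw [h2, hd] at hu
    simp at hu
  obtain ⟨f, hf, hV⟩ := Submodule.exists_le_ker_of_lt_top _ (lt_top_iff_ne_top.2 hne)
  obtain ⟨m, hm, c, hc⟩ := clear_den (fun j => f (Pi.single j 1))
  have hfr : ∀ r : ι → ℚ, f r = ∑ j, f (Pi.single j 1) * r j := by
    intro r
    conv_lhs => rw [pi_eq_sum_univ' r]
    rw [map_sum]
    refine Finset.sum_congr rfl fun j _ => ?_
    rw [map_smul, smul_eq_mul, mul_comm]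
  refine ⟨c, ?_, ?_⟩
  · rintro rfl
    apply hf
    refine LinearMap.ext fun r => ?_
    rw [hfr]
    refine Finset.sum_eq_zero fun j _ => ?_
    have := hc j
    simp [hm] at this
    simp [this]
  · intro r hr
    have h0 : f (v ⟨r, hr⟩) = 0 := hV (Submodule.subset_span ⟨_, rfl⟩)
    rw [hfr] at h0
    have : (∑ j, (c j : ℚ) * r j) = 0 := by
      have h3 : (∑ j, (c j : ℚ) * r j) = m * ∑ j, f (Pi.single j 1) * v ⟨r, hr⟩ j := by
        rw [Finset.mul_sum]
        exact Finset.sum_congr rfl fun j _ => by rw [hc]; simp [v]; ring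
      rw [h3, h0, mul_zero]
    exact_mod_cast this

attribute [local instance] Matrix.seminormedAddCommGroup in
lemma small_sol {ι : Type*} [Fintype ι] [DecidableEq ι] (S : Set (ι → ℤ)) (A : ℕ) (hA : 1 ≤ A)
    (hS : ∀ r ∈ S, ∀ j, |r j| ≤ A) (c0 : ι → ℤ) (hc0 : c0 ≠ 0)
    (hk : ∀ r ∈ S, ∑ j, c0 j * r j = 0) :
    ∃ c : ι → ℤ, c ≠ 0 ∧ (∀ r ∈ S, ∑ j, c j * r j = 0) ∧
      ∀ j, |c j| ≤ ((Fintype.card ι * A) ^ Fintype.card ι : ℕ) := by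
  let v : S → (ι → ℚ) := fun r j => ((r : ι → ℤ) j : ℚ)
  obtain ⟨κ, a, -, hspan, hli⟩ := exists_linearIndependent' ℚ v
  have hfin : Finite κ := hli.finite
  have := Fintype.ofFinite κ
  classical
  obtain ⟨j0, hj0⟩ : ∃ j, c0 j ≠ 0 := by by_contra hh; push Not at hh; exact hc0 (funext hh)
  have hpos : 0 < Fintype.card ι := Fintype.card_pos_iff.2 ⟨j0⟩
  have hlt : Fintype.card κ < Fintype.card ι := by
    by_contra hle
    have hcard := linearIndependent_iff_card_eq_finrank_span.1 hli
    have htop : Submodule.span ℚ (Set.range (v ∘ a)) = ⊤ := by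
      apply Submodule.eq_top_of_finrank_eq
      apply le_antisymm (Submodule.finrank_le _)
      rw [Module.finrank_fintype_fun_eq_card]
      rw [Set.finrank] at hcard
      omega
    have := kill_of_span (fun j => (c0 j : ℚ)) Set.univ (Set.range (v ∘ a))
      (by rw [htop]; simp) (by
        rintro _ ⟨k, rfl⟩
        have := hk _ (a k).2
        simp only [v, Function.comp]
        exact_mod_cast this) (Pi.single j0 1) trivial
    simp [Pi.single_apply] at this
    exact hj0 this
  obtain ⟨c, hc, hck, hcb⟩ : ∃ c : ι → ℤ, c ≠ 0 ∧ (∀ k, ∑ j, c j * (a k : ι → ℤ) j = 0) ∧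
      ∀ j, |c j| ≤ ((Fintype.card ι * A) ^ Fintype.card ι : ℕ) := by
    rcases Nat.eq_zero_or_pos (Fintype.card κ) with h0 | h0
    · have : IsEmpty κ := Fintype.card_eq_zero_iff.1 h0
      refine ⟨Pi.single j0 1, ?_, fun k => isEmptyElim k, fun j => ?_⟩
      · intro h; simpa using congrFun h j0
      · have h1 : (1 : ℤ) ≤ ((Fintype.card ι * A) ^ Fintype.card ι : ℕ) := by
          exact_mod_cast Nat.one_le_pow _ _ (by positivity)
        rw [Pi.single_apply]; split_ifs
        · simpa using h1
        · simpa using (zero_le_one.trans h1)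
    · let M : Matrix κ ι ℤ := Matrix.of fun k => (a k : ι → ℤ)
      obtain ⟨t, ht, htk, htb⟩ := Int.Matrix.exists_ne_zero_int_vec_norm_le M hlt h0
      refine ⟨t, ht, fun k => ?_, fun j => ?_⟩
      · have := congrFun htk k
        simpa [Matrix.mulVec, dotProduct, M, mul_comm] using this
      · have hM : ‖M‖ ≤ A := by
          rw [Matrix.norm_le_iff (by positivity)]
          intro k j
          have := hS _ (a k).2 j
          rw [Int.norm_eq_abs]
          have h5 : ((|(a k : ι → ℤ) j| : ℤ) : ℝ) ≤ A := by exact_mod_cast this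
          simpa [M] using h5
        have h1 : (1 : ℝ) ≤ (Fintype.card ι : ℝ) * max 1 ‖M‖ := by
          have : (1 : ℝ) ≤ Fintype.card ι := by exact_mod_cast hpos
          nlinarith [le_max_left 1 ‖M‖]
        have h2 : ‖t‖ ≤ ((Fintype.card ι : ℝ) * A) ^ (Fintype.card ι : ℝ) := by
          refine htb.trans ?_
          refine (Real.rpow_le_rpow_of_exponent_le h1 (y := 
            (Fintype.card κ : ℝ) / (Fintype.card ι - Fintype.card κ))
            (z := Fintype.card ι) ?_).trans ?_
          · have h6 : (Fintype.card κ : ℝ) + 1 ≤ Fintype.card ι := by exact_mod_cast hlt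
            rw [div_le_iff₀ (by linarith)]
            nlinarith [(Nat.cast_nonneg (Fintype.card κ) : (0:ℝ) ≤ _)]
          · apply Real.rpow_le_rpow (by linarith) _ (by positivity)
            gcongr
            exact max_le (by exact_mod_cast hA) hM
        have h3 : ‖t j‖ ≤ ‖t‖ := norm_le_pi_norm t j
        have h4 := h3.trans h2
        rw [Real.rpow_natCast, Int.norm_eq_abs] at h4
        exact_mod_cast h4
  refine ⟨c, hc, ?_, hcb⟩
  intro r hr
  have := kill_of_span (fun j => (c j : ℚ)) (Set.range v) (Set.range (v ∘ a)) hspan (by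
        rintro _ ⟨k, rfl⟩
        have := hck k
        simp only [v, Function.comp]
        exact_mod_cast this) (v ⟨r, hr⟩) ⟨_, rfl⟩
  simp only [v] at this
  exact_mod_cast this


noncomputable def fam {ι : Type*} [Fintype ι] {n : ℕ} (μ : ι → (Fin n →₀ ℕ)) (c : ι → ℤ) :
    MvPolynomial (Fin n) ℤ := ∑ b, monomial (μ b) (c b)

def mev {n : ℕ} (x : Fin n → ℤ) (α : Fin n →₀ ℕ) : ℤ := ∏ i, x i ^ α i

lemma eval_monomial' {n : ℕ} (x : Fin n → ℤ) (α : Fin n →₀ ℕ) (c : ℤ) :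
    eval x (monomial α c) = c * mev x α := by
  rw [eval_monomial, mev, Finsupp.prod_fintype _ _ (fun i => pow_zero _)]

lemma eval_fam {ι : Type*} [Fintype ι] {n : ℕ} (μ : ι → (Fin n →₀ ℕ)) (c : ι → ℤ)
    (x : Fin n → ℤ) : eval x (fam μ c) = ∑ b, c b * mev x (μ b) := by
  rw [fam, map_sum]
  exact Finset.sum_congr rfl fun b _ => eval_monomial' _ _ _

lemma coeff_fam {ι : Type*} [Fintype ι] {n : ℕ} (μ : ι → (Fin n →₀ ℕ)) (hμ : Function.Injective μ)
    (c : ι → ℤ) (b : ι) : coeff (μ b) (fam μ c) = c b := by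
  classical
  rw [fam, coeff_sum]
  rw [Finset.sum_eq_single b]
  · simp
  · intro b' _ hb'
    rw [coeff_monomial, if_neg]
    exact fun h => hb' (hμ h)
  · simp

lemma fam_support {ι : Type*} [Fintype ι] {n : ℕ} (μ : ι → (Fin n →₀ ℕ)) 
    (c : ι → ℤ) (α : Fin n →₀ ℕ) (h : coeff α (fam μ c) ≠ 0) : ∃ b, μ b = α := by
  classical
  by_contra hh
  push Not at hh
  apply h
  rw [fam, coeff_sum]
  refine Finset.sum_eq_zero fun b _ => ?_
  rw [coeff_monomial, if_neg (hh b)]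

lemma fam_ne_zero {ι : Type*} [Fintype ι] {n : ℕ} (μ : ι → (Fin n →₀ ℕ))
    (hμ : Function.Injective μ) (c : ι → ℤ) (hc : c ≠ 0) : fam μ c ≠ 0 := by
  intro h
  apply hc
  funext b
  rw [← coeff_fam μ hμ c b, h]; simp

lemma fam_totalDegree {ι : Type*} [Fintype ι] {n : ℕ} (μ : ι → (Fin n →₀ ℕ)) 
    (c : ι → ℤ) (D : ℕ) (h : ∀ b, (μ b).degree ≤ D) : (fam μ c).totalDegree ≤ D := by
  rw [fam]
  apply totalDegree_finsetSum_le
  intro b _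
  refine (totalDegree_monomial_le _ _).trans ?_
  simpa [Finsupp.degree_apply, Finsupp.sum] using h b

lemma mev_le {n : ℕ} (x : Fin n → ℤ) (α : Fin n →₀ ℕ) (N : ℕ) (hx : ∀ i, |x i| ≤ N) :
    |mev x α| ≤ (N ^ α.degree : ℕ) := by
  rw [mev, Finset.abs_prod, Finsupp.degree_eq_sum]
  push_cast
  rw [← Finset.prod_pow_eq_pow_sum]
  refine Finset.prod_le_prod (fun i _ => abs_nonneg _) fun i _ => ?_
  rw [abs_pow]
  exact pow_le_pow_left₀ (abs_nonneg _) (hx i) _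

/-- index set of monomials of degree at most D -/
abbrev MI (n D : ℕ) := {α : Fin n → Fin (D + 1) // ∑ i, (α i : ℕ) ≤ D}

noncomputable def miμ (n D : ℕ) (α : MI n D) : Fin n →₀ ℕ :=
  Finsupp.equivFunOnFinite.symm (fun i => (α.1 i : ℕ))

lemma miμ_inj (n D : ℕ) : Function.Injective (miμ n D) := by
  intro a b h
  have := Finsupp.equivFunOnFinite.symm.injective h
  ext i
  exact congrFun this i

lemma miμ_deg (n D : ℕ) (α : MI n D) : (miμ n D α).degree ≤ D := by
  rw [Finsupp.degree_eq_sum]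
  exact α.2

lemma mi_card (n D : ℕ) : Fintype.card (MI n D) ≤ (D + 1) ^ n := by
  refine (Fintype.card_subtype_le _).trans ?_
  simp

lemma deg_le_of_coeff {n : ℕ} (f : MvPolynomial (Fin n) ℤ) (α : Fin n →₀ ℕ)
    (h : coeff α f ≠ 0) : α.degree ≤ f.totalDegree := by
  have := le_totalDegree (mem_support_iff.2 h)
  simpa [Finsupp.degree_apply, Finsupp.sum] using this

lemma miμ_surj (n D : ℕ) (α : Fin n →₀ ℕ) (h : α.degree ≤ D) : ∃ b, miμ n D b = α := by
  rw [Finsupp.degree_eq_sum] at h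
  refine ⟨⟨fun i => ⟨α i, ?_⟩, h⟩, ?_⟩
  · have := Finset.single_le_sum (f := fun i => α i) (fun i _ => Nat.zero_le _) (Finset.mem_univ i)
    omega
  · ext i; rfl

lemma fam_of_poly (n D : ℕ) (f : MvPolynomial (Fin n) ℤ) (hf : f.totalDegree ≤ D) :
    fam (miμ n D) (fun b => coeff (miμ n D b) f) = f := by
  ext α
  by_cases h : ∃ b, miμ n D b = α
  · obtain ⟨b, rfl⟩ := h
    rw [coeff_fam _ (miμ_inj n D)]
  · have h1 : coeff α (fam (miμ n D) (fun b => coeff (miμ n D b) f)) = 0 := by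
      by_contra h2; exact h (fam_support _ _ _ h2)
    rw [h1]
    by_contra h2
    exact h (miμ_surj n D α ((deg_le_of_coeff f α (Ne.symm h2)).trans hf))

/-- size bound for values of polynomials -/
lemma eval_le (n D K N : ℕ) (hN : 1 ≤ N) (f : MvPolynomial (Fin n) ℤ) (hf : f.totalDegree ≤ D)
    (hK : ∀ α, |coeff α f| ≤ K) (x : Fin n → ℤ) (hx : ∀ i, |x i| ≤ N) :
    |eval x f| ≤ ((D + 1) ^ n * (K * N ^ D) : ℕ) := by
  conv_lhs => rw [← fam_of_poly n D f hf]
  rw [eval_fam]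
  refine (Finset.abs_sum_le_sum_abs _ _).trans ?_
  have : ∀ b ∈ (Finset.univ : Finset (MI n D)), |coeff (miμ n D b) f * mev x (miμ n D b)| ≤
      ((K * N ^ D : ℕ) : ℤ) := by
    intro b _
    rw [abs_mul]
    push_cast
    refine mul_le_mul (hK _) ?_ (abs_nonneg _) (by positivity)
    refine (mev_le x _ N hx).trans ?_
    exact_mod_cast Nat.pow_le_pow_right hN (miμ_deg n D b)
  refine (Finset.sum_le_card_nsmul _ _ _ this).trans ?_
  rw [nsmul_eq_mul, Finset.card_univ]
  have := mi_card n D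
  push_cast
  gcongr
  exact_mod_cast this

def SB (n D N : ℕ) : ℕ := ((D + 1) ^ n * N ^ D) ^ ((D + 1) ^ n)

/-- either there is an auxiliary polynomial, or the coefficients are small -/
lemma small_or (n D N : ℕ) (hN : 1 ≤ N) (f : MvPolynomial (Fin n) ℤ) (hf : Irreducible f)
    (hD : f.totalDegree ≤ D) :
    (∃ g : MvPolynomial (Fin n) ℤ, g.totalDegree ≤ D ∧ ¬ f ∣ g ∧
      ∀ x : Fin n → ℤ, (∀ i, |x i| ≤ N) → eval x f = 0 → eval x g = 0) ∨
    ∀ α, |coeff α f| ≤ (SB n D N : ℤ) := by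
  set E := f.totalDegree with hE
  classical
  let μ := miμ n E
  let S : Set (MI n E → ℤ) := {r | ∃ x : Fin n → ℤ, (∀ i, |x i| ≤ N) ∧ eval x f = 0 ∧
    r = fun b => mev x (μ b)}
  have hk : ∀ r ∈ S, ∑ b, (fun b => coeff (μ b) f) b * r b = 0 := by
    rintro r ⟨x, -, h0, rfl⟩
    rw [← eval_fam μ, fam_of_poly n E f le_rfl, h0]
  have hne : (fun b => coeff (μ b) f) ≠ 0 := by
    intro h
    apply hf.ne_zero
    rw [← fam_of_poly n E f le_rfl]
    change fam _ (fun b => coeff (μ b) f) = 0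
    rw [h]; simp [fam]
  obtain ⟨c, hc, hck, hcb⟩ := small_sol S (N ^ E) (Nat.one_le_pow _ _ hN) (by
    rintro r ⟨x, hx, -, rfl⟩ b
    refine (mev_le x _ N hx).trans ?_
    exact_mod_cast Nat.pow_le_pow_right hN (miμ_deg n E b)) _ hne hk
  have hgd : (fam μ c).totalDegree ≤ E := fam_totalDegree μ c E (miμ_deg n E)
  by_cases hdiv : f ∣ fam μ c
  · right
    obtain ⟨q, hq⟩ := hdiv
    have hg0 := fam_ne_zero μ (miμ_inj n E) c hc
    have hq0 : q ≠ 0 := by rintro rfl; simp at hq; exact hg0 hq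
    have hqd : q.totalDegree = 0 := by
      have := totalDegree_mul_of_isDomain hf.ne_zero hq0
      rw [← hq] at this
      omega
    rw [totalDegree_eq_zero_iff_eq_C] at hqd
    intro α
    by_cases h0 : coeff α f = 0
    · rw [h0]; simp
    obtain ⟨b, rfl⟩ := miμ_surj n E α (deg_le_of_coeff f α h0)
    have h1 := coeff_fam μ (miμ_inj n E) c b
    rw [hq, hqd, mul_comm, coeff_C_mul] at h1
    have h2 : coeff 0 q ≠ 0 := by
      intro h; rw [h] at hqd; simp at hqd; exact hq0 hqd
    have h3 : |coeff (miμ n E b) f| ≤ |c b| := by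
      rw [← h1, abs_mul]
      have := Int.one_le_abs h2
      nlinarith [abs_nonneg (coeff (miμ n E b) f)]
    refine h3.trans ((hcb b).trans ?_)
    have hEcard : Fintype.card (MI n E) ≤ (D + 1) ^ n :=
      (mi_card n E).trans (Nat.pow_le_pow_left (by omega) _)
    unfold SB
    norm_cast
    have hNN : N ^ E ≤ N ^ D := Nat.pow_le_pow_right hN hD
    have h1 : 1 ≤ (D + 1) ^ n * N ^ D := Nat.mul_pos (by positivity) (by positivity)
    exact (Nat.pow_le_pow_left (Nat.mul_le_mul hEcard hNN) _).trans (Nat.pow_le_pow_right h1 hEcard)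
  · left
    refine ⟨fam μ c, hgd.trans hD, hdiv, ?_⟩
    intro x hx h0
    rw [eval_fam]
    exact hck _ ⟨x, hx, h0, rfl⟩


lemma taylor1 {n : ℕ} (f : MvPolynomial (Fin n) ℤ) (x v : Fin n → ℤ) (t : ℤ) :
    ∃ k : ℤ, eval (fun i => x i + t * v i) f =
      eval x f + t * ∑ j, v j * eval x (pderiv j f) + t ^ 2 * k := by
  induction f using MvPolynomial.induction_on with
  | C a => exact ⟨0, by simp⟩
  | add p q hp hq =>
    obtain ⟨k, hk⟩ := hp
    obtain ⟨l, hl⟩ := hq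
    refine ⟨k + l, ?_⟩
    simp only [map_add, hk, hl, mul_add, Finset.sum_add_distrib]
    ring
  | mul_X p i hp =>
    obtain ⟨k, hk⟩ := hp
    have hs : ∑ j, v j * eval x (pderiv j (p * X i)) =
        x i * (∑ j, v j * eval x (pderiv j p)) + eval x p * v i := by
      rw [Finset.mul_sum]
      have h1 : ∀ j, v j * eval x (pderiv j (p * X i)) =
          x i * (v j * eval x (pderiv j p)) + eval x p * (v j * (Pi.single i 1 : Fin n → ℤ) j) := by
        intro j
        rw [Derivation.leibniz, pderiv_X]
        by_cases h : i = j
        · subst h; simp; ring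
        · simp [Pi.single_apply, h, Ne.symm h]; ring
      rw [Finset.sum_congr rfl fun j _ => h1 j, Finset.sum_add_distrib, ← Finset.mul_sum]
      congr 1
      simp [Pi.single_apply]
    refine ⟨k * (x i + t * v i) + v i * ∑ j, v j * eval x (pderiv j p), ?_⟩
    rw [hs, eval_mul, eval_mul, hk]
    simp only [eval_X]
    ring

lemma taylor_one {n : ℕ} (f : MvPolynomial (Fin n) ℤ) (x y : Fin n → ℤ) (j : Fin n) 
    (hy : ∀ i, i ≠ j → y i = x i) :
    ∃ k : ℤ, eval y f =
      eval x f + (y j - x j) * eval x (pderiv j f) + (y j - x j) ^ 2 * k := by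
  obtain ⟨k, hk⟩ := taylor1 f x (Pi.single j 1) (y j - x j)
  refine ⟨k, ?_⟩
  have h1 : (fun i => x i + (y j - x j) * (Pi.single j 1 : Fin n → ℤ) i) = y := by
    funext i
    by_cases h : i = j
    · subst h; simp
    · simp [h, hy i h]
  rw [h1] at hk
  rw [hk]
  simp [Pi.single_apply]

lemma eval_congr_dvd {n : ℕ} (f : MvPolynomial (Fin n) ℤ) (x y : Fin n → ℤ) (p : ℤ)
    (h : ∀ i, p ∣ x i - y i) : p ∣ eval x f - eval y f := by
  induction f using MvPolynomial.induction_on with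
  | C a => simp
  | add f g hf hg =>
    have := dvd_add hf hg
    rw [eval_add, eval_add]
    have e : eval x f + eval x g - (eval y f + eval y g) =
      eval x f - eval y f + (eval x g - eval y g) := by ring
    rwa [e]
  | mul_X f i hf =>
    have := dvd_add (hf.mul_right (x i)) ((h i).mul_left (eval y f))
    rw [eval_mul, eval_mul, eval_X, eval_X]
    have e : eval x f * x i - eval y f * y i =
      (eval x f - eval y f) * x i + eval y f * (x i - y i) := by ring
    rwa [e]

lemma eval_aeval_sub {R : Type*} [CommRing R] {σ τ : Type*} (t : τ → R) (s : σ → MvPolynomial τ R) (f : MvPolynomial σ R) :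
    eval t (aeval s f) = eval (fun i => eval t (s i)) f := by
  induction f using MvPolynomial.induction_on with
  | C a => simp
  | add f g hf hg => simp only [map_add, hf, hg]
  | mul_X f i hf => simp only [map_mul, hf, aeval_X, eval_X]

lemma newton {m : ℕ} (f : MvPolynomial (Fin (m + 1)) ℤ) (j : Fin (m + 1)) (p : ℤ)
    (x0 : Fin (m + 1) → ℤ) (hj : IsCoprime (eval x0 (pderiv j f)) p) (E : ℕ) :
    ∃ ψ : MvPolynomial (Fin m) ℤ, ∀ y : Fin (m + 1) → ℤ, (∀ i, p ∣ y i - x0 i) →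
      p ^ E ∣ eval y f →
      p ^ E ∣ eval (fun i => y (j.succAbove i) - x0 (j.succAbove i)) ψ - y j := by
  obtain ⟨c, c', hc⟩ := hj
  induction E with
  | zero => exact ⟨0, fun y _ _ => by simp⟩
  | succ E ih =>
    rcases Nat.eq_zero_or_pos E with rfl | hE
    · refine ⟨C (x0 j), fun y hy _ => ?_⟩
      have := hy j
      rw [dvd_sub_comm] at this
      simpa using this
    obtain ⟨ψ, hψ⟩ := ih
    let s : Fin (m + 1) → MvPolynomial (Fin m) ℤ :=
      j.insertNth ψ (fun i => X i + C (x0 (j.succAbove i)))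
    refine ⟨ψ - C c * aeval s f, fun y hy hf => ?_⟩
    have h1 := hψ y hy ((pow_dvd_pow p (Nat.le_succ E)).trans hf)
    set t : Fin m → ℤ := fun i => y (j.succAbove i) - x0 (j.succAbove i) with ht
    have h2 := eval_aeval_sub t s f
    obtain ⟨k, hk⟩ := taylor_one f y (fun i => eval t (s i)) j (by
      intro i hi
      obtain ⟨i, rfl⟩ := Fin.exists_succAbove_eq hi
      simp [s, ht])
    have h3 : eval t (s j) = eval t ψ := by simp [s]
    rw [h3] at hk
    have h4 := eval_congr_dvd (pderiv j f) y x0 p hy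
    rw [eval_sub, eval_mul, eval_C, h2, hk]
    obtain ⟨a, ha⟩ := h1
    obtain ⟨b, hb⟩ := h4
    obtain ⟨e, he⟩ := hf
    have hb' : eval y (pderiv j f) = eval x0 (pderiv j f) + p * b := by linarith
    have ha2 : (eval t ψ - y j) ^ 2 = p ^ (E + 1) * (p ^ (E - 1) * a ^ 2) := by
      rw [ha, mul_pow, ← pow_mul, ← mul_assoc, ← pow_add]
      congr 2; omega
    rw [ha2, he, hb']
    refine ⟨a * (c' - c * b) - c * e - c * (p ^ (E - 1) * a ^ 2) * k, ?_⟩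
    have e1 : p ^ (E + 1) = p ^ E * p := pow_succ _ _
    have e2 : eval t ψ = y j + p ^ E * a := by linarith
    rw [e2, e1]
    linear_combination (-p ^ E * a) * hc

lemma eval_eq_sum_mev {n : ℕ} (f : MvPolynomial (Fin n) ℤ) (x : Fin n → ℤ)
    (A : Finset (Fin n →₀ ℕ)) (hA : f.support ⊆ A) :
    eval x f = ∑ α ∈ A, coeff α f * mev x α := by
  rw [eval_eq']
  refine Finset.sum_subset hA fun α _ hα => ?_
  rw [notMem_support_iff.1 hα, zero_mul]

lemma mev_smul {n : ℕ} (p : ℤ) (u : Fin n → ℤ) (α : Fin n →₀ ℕ) :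
    mev (fun i => p * u i) α = p ^ α.degree * mev u α := by
  rw [mev, mev, Finsupp.degree_eq_sum, ← Finset.prod_pow_eq_pow_sum, ← Finset.prod_mul_distrib]
  exact Finset.prod_congr rfl fun i _ => mul_pow _ _ _

lemma det_dvd_aux {ι : Type*} [Fintype ι] [DecidableEq ι] {m : ℕ} (Ψ : ι → MvPolynomial (Fin m) ℤ)
    (u : ι → Fin m → ℤ) (p : ℤ) (E : ℕ)
    (hE : ∀ σ : ι → (Fin m →₀ ℕ), Function.Injective σ → E ≤ ∑ b, (σ b).degree) :
    p ^ E ∣ Matrix.det (Matrix.of fun b a => eval (fun i => p * u a i) (Ψ b)) := by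
  classical
  set A : Finset (Fin m →₀ ℕ) := Finset.univ.biUnion fun b => (Ψ b).support with hA
  have hrow : (Matrix.of fun b a => eval (fun i => p * u a i) (Ψ b)) =
      Matrix.of fun b => ∑ α ∈ A, (coeff α (Ψ b) * p ^ α.degree) • (fun a => mev (u a) α) := by
    ext b a
    simp only [Matrix.of_apply, Finset.sum_apply, Pi.smul_apply, smul_eq_mul]
    rw [eval_eq_sum_mev (Ψ b) _ A (by
      rw [hA]; exact Finset.subset_biUnion_of_mem (fun b => (Ψ b).support) (Finset.mem_univ b))]
    refine Finset.sum_congr rfl fun α _ => ?_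
    rw [mev_smul]; ring
  rw [hrow]
  change p ^ E ∣ (Matrix.detRowAlternating : (ι → ℤ) [⋀^ι]→ₗ[ℤ] ℤ).toMultilinearMap
    (fun b => ∑ α ∈ A, (coeff α (Ψ b) * p ^ α.degree) • (fun a => mev (u a) α))
  rw [MultilinearMap.map_sum_finset]
  refine Finset.dvd_sum fun σ _ => ?_
  rw [MultilinearMap.map_smul_univ]
  by_cases hσ : Function.Injective σ
  · rw [Finset.prod_mul_distrib, Finset.prod_pow_eq_pow_sum]
    exact ((pow_dvd_pow p (hE σ hσ)).mul_left _).mul_right _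
  · have : (Matrix.detRowAlternating : (ι → ℤ) [⋀^ι]→ₗ[ℤ] ℤ).toMultilinearMap
        (fun b a => mev (u a) (σ b)) = 0 := by
      rw [Function.Injective] at hσ
      push Not at hσ
      obtain ⟨b, b', h1, h2⟩ := hσ
      exact (Matrix.detRowAlternating : (ι → ℤ) [⋀^ι]→ₗ[ℤ] ℤ).map_eq_zero_of_eq _
        (by funext a; simp only [h1]) h2
    rw [this]; simp

lemma det_congr {ι : Type*} [Fintype ι] [DecidableEq ι] (M M' : Matrix ι ι ℤ) (q : ℤ)
    (h : ∀ a b, q ∣ M a b - M' a b) : q ∣ M.det - M'.det := by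
  rw [← Ideal.mem_span_singleton, ← Ideal.Quotient.eq, RingHom.map_det, RingHom.map_det]
  congr 1
  ext a b
  simp only [RingHom.mapMatrix_apply, Matrix.map_apply]
  rw [Ideal.Quotient.eq, Ideal.mem_span_singleton]
  exact h a b

/-- the determinant lemma -/
lemma det_dvd {ι : Type*} [Fintype ι] [DecidableEq ι] {m : ℕ} (f : MvPolynomial (Fin (m + 1)) ℤ)
    (j : Fin (m + 1)) (p : ℤ) (E : ℕ) (x0 : Fin (m + 1) → ℤ)
    (hj : IsCoprime (eval x0 (pderiv j f)) p)
    (hE : ∀ σ : ι → (Fin m →₀ ℕ), Function.Injective σ → E ≤ ∑ b, (σ b).degree)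
    (G : ι → MvPolynomial (Fin (m + 1)) ℤ) (x : ι → Fin (m + 1) → ℤ)
    (hx : ∀ a i, p ∣ x a i - x0 i) (hf : ∀ a, p ^ E ∣ eval (x a) f) :
    p ^ E ∣ Matrix.det (Matrix.of fun a b => eval (x a) (G b)) := by
  obtain ⟨ψ, hψ⟩ := newton f j p x0 hj E
  choose w hw using hx
  let s : Fin (m + 1) → MvPolynomial (Fin m) ℤ :=
      j.insertNth ψ (fun i => X i + C (x0 (j.succAbove i)))
  let u : ι → Fin m → ℤ := fun a i => w a (j.succAbove i)
  have h1 := det_dvd_aux (fun b => aeval s (G b)) u p E hE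
  rw [← Matrix.det_transpose] at h1
  have h2 := det_congr (Matrix.of fun a b => eval (x a) (G b))
    (Matrix.transpose (Matrix.of fun b a => eval (fun i => p * u a i) (aeval s (G b)))) (p ^ E) (by
      intro a b
      simp only [Matrix.transpose_apply, Matrix.of_apply]
      set t : Fin m → ℤ := fun i => p * u a i with ht
      have ht' : t = fun i => x a (j.succAbove i) - x0 (j.succAbove i) := by
        funext i; rw [ht, hw]
      have h2 := eval_aeval_sub t s (G b)
      rw [h2]
      apply eval_congr_dvd
      intro i
      refine Fin.succAboveCases j ?_ ?_ i
      · have := hψ (x a) (fun i => ⟨_, hw a i⟩) (hf a)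
        rw [← ht', dvd_sub_comm] at this
        simpa [s] using this
      · intro i
        simp only [s, Fin.insertNth_apply_succAbove, eval_add, eval_X, eval_C]
        rw [ht']; simp)
  have := dvd_add h2 h1
  simpa using this


lemma det_bound {ι : Type*} [Fintype ι] [DecidableEq ι] {n : ℕ} (μ : ι → (Fin n →₀ ℕ)) (N : ℕ)
    (x : ι → Fin n → ℤ) (hx : ∀ a i, |x a i| ≤ N) :
    |Matrix.det (Matrix.of fun a b => mev (x a) (μ b))| ≤
      ((Fintype.card ι).factorial * N ^ (∑ b, (μ b).degree) : ℕ) := by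
  rw [Matrix.det_apply]
  refine (Finset.abs_sum_le_sum_abs _ _).trans ?_
  have h : ∀ σ ∈ (Finset.univ : Finset (Equiv.Perm ι)),
      |Equiv.Perm.sign σ • ∏ i, (Matrix.of fun a b => mev (x a) (μ b)) (σ i) i| ≤
      ((N ^ (∑ b, (μ b).degree) : ℕ) : ℤ) := by
    intro σ _
    rw [Units.smul_def, smul_eq_mul, abs_mul, Finset.abs_prod]
    rw [show |((Equiv.Perm.sign σ : ℤˣ) : ℤ)| = 1 from by
      rcases Int.units_eq_one_or (Equiv.Perm.sign σ) with h | h <;> simp [h], one_mul]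
    push_cast
    rw [← Finset.prod_pow_eq_pow_sum]
    refine Finset.prod_le_prod (fun i _ => abs_nonneg _) fun i _ => ?_
    exact_mod_cast mev_le (x (σ i)) (μ i) N (hx _)
  refine (Finset.sum_le_card_nsmul _ _ _ h).trans ?_
  rw [nsmul_eq_mul, Finset.card_univ, Fintype.card_perm]
  push_cast; rfl

lemma class_poly {ι : Type*} [Fintype ι] [DecidableEq ι] {m : ℕ} (f : MvPolynomial (Fin (m + 1)) ℤ)
    (j : Fin (m + 1)) (μ : ι → (Fin (m + 1) →₀ ℕ)) (E n N Y : ℕ)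
    (hE : ∀ σ : ι → (Fin m →₀ ℕ), Function.Injective σ → E ≤ ∑ b, (σ b).degree)
    (I : Finset ℕ) (hI : ∀ p ∈ I, p.Prime ∧ Y ≤ p) (hIc : I.card = n + 1)
    (hN : N ≤ Y ^ (2 * n)) (hY : (Fintype.card ι).factorial < Y)
    (hnum : 2 * n * (∑ b, (μ b).degree) + 1 ≤ (n + 1) * E)
    (S : Set (Fin (m + 1) → ℤ)) (hbox : ∀ x ∈ S, ∀ i, |x i| ≤ N) (hz : ∀ x ∈ S, eval x f = 0)
    (hcong : ∀ x ∈ S, ∀ y ∈ S, ∀ p ∈ I, ∀ i, (p : ℤ) ∣ x i - y i)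
    (hsm : ∀ x ∈ S, ∀ p ∈ I, ¬ (p : ℤ) ∣ eval x (pderiv j f)) :
    ∃ c : ι → ℤ, c ≠ 0 ∧ ∀ x ∈ S, eval x (fam μ c) = 0 := by
  obtain ⟨c, hc, hk⟩ := lin_dep {r : ι → ℤ | ∃ x ∈ S, r = fun b => mev x (μ b)} (by
    intro r hr
    choose x hxS hx using hr
    have hr' : Matrix.of r = Matrix.of fun a b => mev (x a) (μ b) := by
      ext a b; rw [Matrix.of_apply, hx]; rfl
    rw [hr']
    have hb := det_bound μ N x (fun a => hbox _ (hxS a))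
    apply Int.eq_zero_of_abs_lt_dvd (m := ((∏ p ∈ I, p ^ E : ℕ) : ℤ))
    · push_cast
      refine Finset.prod_dvd_of_coprime ?_ ?_
      · intro p hp q hq hpq
        simp only [Function.onFun]
        apply IsCoprime.pow
        rw [Nat.isCoprime_iff_coprime]
        exact (Nat.coprime_primes (hI p hp).1 (hI q hq).1).2 hpq
      · intro p hp
        by_cases hemp : Nonempty ι
        · obtain ⟨a0⟩ := hemp
          have hpp := (hI p hp).1
          have := det_dvd (ι := ι) f j (p : ℤ) E (x a0) (by
            rw [isCoprime_comm]
            exact (Nat.prime_iff_prime_int.1 hpp).coprime_iff_not_dvd.2 (hsm _ (hxS a0) p hp))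
            hE (fun b => monomial (μ b) 1) x (fun a i => hcong _ (hxS a) _ (hxS a0) p hp i)
            (fun a => by rw [hz _ (hxS a)]; exact dvd_zero _)
          simpa [eval_monomial'] using this
        · rw [not_nonempty_iff] at hemp
          have h0 := hE (fun b => isEmptyElim b) (fun b => isEmptyElim b)
          simp at h0
          simp [h0]
    · refine lt_of_le_of_lt hb ?_
      norm_cast
      have hYpos : 0 < Y := by omega
      calc (Fintype.card ι).factorial * N ^ (∑ b, (μ b).degree)
          ≤ (Fintype.card ι).factorial * (Y ^ (2 * n)) ^ (∑ b, (μ b).degree) := by gcongr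
        _ < Y * (Y ^ (2 * n)) ^ (∑ b, (μ b).degree) := by
            apply Nat.mul_lt_mul_of_pos_right hY; positivity
        _ = Y ^ (2 * n * (∑ b, (μ b).degree) + 1) := by rw [← pow_mul, pow_succ, mul_comm]
        _ ≤ Y ^ ((n + 1) * E) := Nat.pow_le_pow_right hYpos hnum
        _ = ∏ p ∈ I, Y ^ E := by rw [Finset.prod_const, hIc, ← pow_mul, mul_comm]
        _ ≤ ∏ p ∈ I, p ^ E := Finset.prod_le_prod' fun p hp => Nat.pow_le_pow_left (hI p hp).2 _)
  refine ⟨c, hc, fun x hx => ?_⟩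
  rw [eval_fam]
  exact hk _ ⟨x, hx, rfl⟩

lemma inj_sum {ι κ : Type*} [Fintype ι] [DecidableEq κ] (deg : κ → ℕ) (M : ℕ) (A : Finset κ)
    (hA : ∀ k, deg k < M → k ∈ A) (σ : ι → κ) (hσ : Function.Injective σ) :
    M * Fintype.card ι ≤ ∑ b, deg (σ b) + ∑ k ∈ A, (M - deg k) := by
  classical
  have h1 : M * Fintype.card ι ≤ ∑ b, deg (σ b) + ∑ b, (M - deg (σ b)) := by
    rw [← Finset.sum_add_distrib]
    have : ∑ b : ι, M ≤ ∑ b, (deg (σ b) + (M - deg (σ b))) :=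
      Finset.sum_le_sum fun b _ => by omega
    simpa [mul_comm] using this
  refine h1.trans (Nat.add_le_add_left ?_ _)
  have h2 : ∑ b, (M - deg (σ b)) = ∑ b ∈ Finset.univ.filter (fun b => deg (σ b) < M), (M - deg (σ b)) := by
    symm
    refine Finset.sum_subset (Finset.filter_subset _ _) fun b _ hb => ?_
    simp at hb; omega
  rw [h2, ← Finset.sum_image (s := Finset.univ.filter (fun b => deg (σ b) < M)) (g := σ)
    (f := fun k => M - deg k) (fun a _ b _ h => hσ h)]
  refine Finset.sum_le_sum_of_subset ?_
  intro k hk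
  obtain ⟨b, hb, rfl⟩ := Finset.mem_image.1 hk
  exact hA _ (Finset.mem_filter.1 hb).2

lemma inj_bound1 {ι : Type*} [Fintype ι] (σ : ι → (Fin 1 →₀ ℕ)) (hσ : Function.Injective σ) :
    Fintype.card ι * (Fintype.card ι - 1) / 2 ≤ ∑ b, (σ b).degree := by
  classical
  set s := Fintype.card ι
  have h := inj_sum (fun k : Fin 1 →₀ ℕ => k.degree) s
    ((Finset.range s).image fun n => Finsupp.single 0 n) (by
      intro k hk
      refine Finset.mem_image.2 ⟨k 0, ?_, ?_⟩
      · rw [Finsupp.degree_eq_sum] at hk; simpa using hk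
      · refine Finsupp.ext fun i => ?_; rw [Subsingleton.elim i 0]; simp) σ hσ
  rw [Finset.sum_image (by
    intro a _ b _ h
    simpa using h)] at h
  simp only [Finsupp.degree_single] at h
  have h2 : ∀ s : ℕ, (∑ x ∈ Finset.range s, (s - x)) * 2 = s * (s + 1) := by
    intro s
    have h3 : ∑ x ∈ Finset.range s, (s - x) = ∑ x ∈ Finset.range s, (x + 1) := by
      rw [← Finset.sum_range_reflect]
      refine Finset.sum_congr rfl fun x hx => ?_
      have := Finset.mem_range.1 hx
      omega
    rw [h3, Finset.sum_add_distrib, add_mul, Finset.sum_range_id_mul_two]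
    cases s <;> simp; ring
  have h4 := h2 s
  change s * s ≤ _ at h
  have h5 : s * (s - 1) ≤ 2 * ∑ b, (σ b).degree := by
    rcases Nat.eq_zero_or_pos s with h0 | h0
    · rw [h0]; simp
    · obtain ⟨s', hs'⟩ : ∃ s', s = s' + 1 := ⟨s - 1, by omega⟩
      rw [hs'] at h4 h ⊢
      simp only [Nat.add_sub_cancel]
      nlinarith
  omega

lemma inj_bound2 {ι : Type*} [Fintype ι] (M : ℕ) (σ : ι → (Fin 2 →₀ ℕ))
    (hσ : Function.Injective σ) :
    M * Fintype.card ι - M * (M + 1) * (M + 2) / 6 ≤ ∑ b, (σ b).degree := by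
  classical
  let mk : ℕ × ℕ → (Fin 2 →₀ ℕ) := fun q => Finsupp.single 0 q.1 + Finsupp.single 1 q.2
  have mkdeg : ∀ q, (mk q).degree = q.1 + q.2 := fun q => by simp [mk]
  have h := inj_sum (fun k : Fin 2 →₀ ℕ => k.degree) M
    (((Finset.range M).sigma fun n => Finset.HasAntidiagonal.antidiagonal n).image fun q => mk q.2) (by
      intro k hk
      rw [Finsupp.degree_eq_sum] at hk
      simp only [Fin.sum_univ_two] at hk
      refine Finset.mem_image.2 ⟨⟨k 0 + k 1, (k 0, k 1)⟩, ?_, ?_⟩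
      · simp [hk]
      · ext i; fin_cases i <;> simp [mk]) σ hσ
  have h1 : ∑ k ∈ (((Finset.range M).sigma fun n => Finset.HasAntidiagonal.antidiagonal n).image fun q => mk q.2),
      (M - k.degree) ≤ ∑ n ∈ Finset.range M, (n + 1) * (M - n) := by
    refine (Finset.sum_image_le_of_nonneg (fun _ _ => Nat.zero_le _)).trans ?_
    rw [Finset.sum_sigma]
    refine Finset.sum_le_sum fun n _ => ?_
    have : ∀ q ∈ Finset.HasAntidiagonal.antidiagonal n, (M - (mk q).degree) = M - n := by
      intro q hq
      rw [mkdeg, Finset.HasAntidiagonal.mem_antidiagonal.1 hq]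
    rw [Finset.sum_congr rfl this]
    simp
  have h2 : ∀ M : ℕ, (∑ n ∈ Finset.range M, (n + 1) * (M - n)) * 6 = M * (M + 1) * (M + 2) := by
    intro M
    induction M with
    | zero => simp
    | succ M ih =>
      have e : ∑ n ∈ Finset.range (M + 1), (n + 1) * (M + 1 - n) =
          ∑ n ∈ Finset.range M, (n + 1) * (M - n) + ∑ n ∈ Finset.range (M + 1), (n + 1) := by
        rw [Finset.sum_range_succ, Finset.sum_range_succ (fun n => n + 1), ← add_assoc,
          ← Finset.sum_add_distrib]
        congr 1
        · refine Finset.sum_congr rfl fun n hn => ?_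
          have := Finset.mem_range.1 hn
          rw [show M + 1 - n = (M - n) + 1 by omega]; ring
        · simp
      have e2 : (∑ n ∈ Finset.range (M + 1), (n + 1)) * 2 = (M + 1) * (M + 2) := by
        have := Finset.sum_range_id_mul_two (M + 2)
        rw [Finset.sum_range_succ'] at this
        simp at this
        rw [this]; ring
      rw [e, add_mul, ih]
      nlinarith
  have h3 := h2 M
  change M * Fintype.card ι ≤ _ at h
  omega


lemma surf_class (n d N Y : ℕ) (hd : 4 ≤ d) (f : MvPolynomial (Fin 3) ℤ)
    (hlc : coeff (Finsupp.single 2 d) f ≠ 0)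
    (I : Finset ℕ) (hI : ∀ p ∈ I, p.Prime ∧ Y ≤ p) (hIc : I.card = n + 1)
    (hN : N ≤ Y ^ (2 * n)) (hY : (2 * (2 * n + 1) * (2 * n + 2)).factorial < Y)
    (S : Set (Fin 3 → ℤ)) (hbox : ∀ x ∈ S, ∀ i, |x i| ≤ N) (hz : ∀ x ∈ S, eval x f = 0)
    (hcong : ∀ x ∈ S, ∀ y ∈ S, ∀ p ∈ I, ∀ i, (p : ℤ) ∣ x i - y i)
    (hsm : ∀ x ∈ S, ∀ p ∈ I, ¬ (p : ℤ) ∣ eval x (pderiv 2 f)) :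
    ∃ G : MvPolynomial (Fin 3) ℤ, G.totalDegree ≤ 2 * n + 3 ∧ ¬ f ∣ G ∧ ∀ x ∈ S, eval x G = 0 := by
  let ι := Σ m : Fin (2 * n + 1), Fin (m + 1) × Fin 4
  let μ : ι → (Fin 3 →₀ ℕ) := fun b =>
    Finsupp.single 0 (b.2.1 : ℕ) + Finsupp.single 1 ((b.1 : ℕ) - (b.2.1 : ℕ)) + Finsupp.single 2 (b.2.2 : ℕ)
  have hμ0 : ∀ b, μ b 0 = b.2.1 := fun b => by simp [μ]
  have hμ1 : ∀ b, μ b 1 = b.1 - b.2.1 := fun b => by simp [μ]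
  have hμ2 : ∀ b, μ b 2 = b.2.2 := fun b => by simp [μ]
  have hμd : ∀ b, (μ b).degree = b.1 + b.2.2 := fun b => by
    have := b.2.1.2
    simp only [μ, map_add, Finsupp.degree_single]; omega
  have hinj : Function.Injective μ := by
    rintro ⟨m, i, c⟩ ⟨m', i', c'⟩ h
    have h0 := DFunLike.congr_fun h 0
    have h1 := DFunLike.congr_fun h 1
    have h2 := DFunLike.congr_fun h 2
    rw [hμ0, hμ0] at h0
    rw [hμ1, hμ1] at h1
    rw [hμ2, hμ2] at h2
    simp only at h0 h1 h2
    have hi := i.2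
    have hi' := i'.2
    have : m = m' := by ext; omega
    subst this
    have : i = i' := by ext; omega
    subst this
    have : c = c' := by ext; omega
    subst this
    rfl
  have hs : Fintype.card ι = 2 * (2 * n + 1) * (2 * n + 2) := by
    simp only [ι, Fintype.card_sigma, Fintype.card_prod, Fintype.card_fin]
    rw [Fin.sum_univ_eq_sum_range (fun m => (m + 1) * 4)]
    have : ∀ k, ∑ i ∈ Finset.range (k + 1), (i + 1) * 4 = 2 * (k + 1) * (k + 2) := by
      intro k
      induction k with
      | zero => simp
      | succ k ih => rw [Finset.sum_range_succ, ih]; ring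
    exact this _
  have hW : 3 * ∑ b, (μ b).degree = (2 * n + 1) * (2 * n + 2) * (8 * n + 9) := by
    simp only [hμd, ι]
    rw [Fintype.sum_sigma]
    have e1 : ∀ m : Fin (2 * n + 1), ∑ x : Fin (m + 1) × Fin 4, ((m : ℕ) + (x.2 : ℕ)) =
        (m + 1) * (4 * m + 6) := by
      intro m
      rw [Fintype.sum_prod_type]
      simp [Fin.sum_univ_succ]; ring
    rw [Finset.sum_congr rfl (fun m _ => e1 m),
      Fin.sum_univ_eq_sum_range (fun m => (m + 1) * (4 * m + 6))]
    have : ∀ k, 3 * ∑ m ∈ Finset.range (k + 1), (m + 1) * (4 * m + 6) =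
        (k + 1) * (k + 2) * (4 * k + 9) := by
      intro k
      induction k with
      | zero => simp
      | succ k ih => rw [Finset.sum_range_succ, mul_add, ih]; ring
    rw [this]; ring
  obtain ⟨c, hc, hk⟩ := class_poly f 2 μ ((4 * n + 2) * Fintype.card ι -
      (4 * n + 2) * ((4 * n + 2) + 1) * ((4 * n + 2) + 2) / 6) n N Y
    (fun σ hσ => inj_bound2 _ σ hσ) I hI hIc hN (by rw [hs]; exact hY) (by
      rw [hs]
      set W := ∑ b, (μ b).degree
      have h1 := Nat.div_mul_le_self ((4 * n + 2) * ((4 * n + 2) + 1) * ((4 * n + 2) + 2)) 6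
      set t := (4 * n + 2) * ((4 * n + 2) + 1) * ((4 * n + 2) + 2) / 6
      set E := (4 * n + 2) * (2 * (2 * n + 1) * (2 * n + 2)) - t with hE
      have h2 : (4 * n + 2) * (2 * (2 * n + 1) * (2 * n + 2)) ≤ E + t := by omega
      have h3 : (2 * n + 1) * (2 * n + 2) * (16 * n + 6) ≤ 3 * E := by nlinarith
      have h4 : (n + 1) * ((2 * n + 1) * (2 * n + 2) * (16 * n + 6)) ≤ (n + 1) * (3 * E) :=
        Nat.mul_le_mul_left _ h3
      have h5 : 2 * n * (3 * W) + 3 ≤ (n + 1) * ((2 * n + 1) * (2 * n + 2) * (16 * n + 6)) := by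
        rw [hW]; ring_nf; omega
      have h6 : 3 * (2 * n * W + 1) ≤ 3 * ((n + 1) * E) := by
        calc 3 * (2 * n * W + 1) = 2 * n * (3 * W) + 3 := by ring
          _ ≤ _ := h5.trans h4
          _ = _ := by ring
      omega) S hbox hz hcong hsm
  refine ⟨fam μ c, fam_totalDegree μ c _ fun b => ?_, ?_, hk⟩
  · rw [hμd]; have := b.1.2; have := b.2.2.2; omega
  · rintro ⟨q, hq⟩
    have hne := fam_ne_zero μ hinj c hc
    have hf0 : f ≠ 0 := by rintro rfl; simp at hlc
    have hq0 : q ≠ 0 := by rintro rfl; simp at hq; exact hne hq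
    have h1 : degreeOf 2 (fam μ c) ≤ 3 := by
      rw [degreeOf_le_iff]
      intro α hα
      obtain ⟨b, rfl⟩ := fam_support μ c α (mem_support_iff.1 hα)
      rw [hμ2]; have := b.2.2.2; omega
    rw [hq, degreeOf_mul_eq hf0 hq0] at h1
    have h2 : d ≤ degreeOf 2 f := by
      have := monomial_le_degreeOf 2 (mem_support_iff.2 hlc)
      simpa using this
    omega

lemma curve_class (n N Y : ℕ) (hn : 1 ≤ n) (h : MvPolynomial (Fin 2) ℤ) (j : Fin 2)
    (hh : 2 ≤ h.totalDegree)
    (I : Finset ℕ) (hI : ∀ p ∈ I, p.Prime ∧ Y ≤ p) (hIc : I.card = n + 1)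
    (hN : N ≤ Y ^ (2 * n)) (hY : (2 * (2 * n + 1) * (2 * n + 2)).factorial < Y)
    (S : Set (Fin 2 → ℤ)) (hbox : ∀ x ∈ S, ∀ i, |x i| ≤ N) (hz : ∀ x ∈ S, eval x h = 0)
    (hcong : ∀ x ∈ S, ∀ y ∈ S, ∀ p ∈ I, ∀ i, (p : ℤ) ∣ x i - y i)
    (hsm : ∀ x ∈ S, ∀ p ∈ I, ¬ (p : ℤ) ∣ eval x (pderiv j h)) :
    ∃ G : MvPolynomial (Fin 2) ℤ, G.totalDegree ≤ n + 1 ∧ ¬ h ∣ G ∧ ∀ x ∈ S, eval x G = 0 := by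
  have hf0 : h ≠ 0 := by rintro rfl; simp at hh
  by_cases hi : ∃ i, 2 ≤ degreeOf i h
  · obtain ⟨i, hi⟩ := hi
    let μ : Fin (n + 1) × Fin 2 → (Fin 2 →₀ ℕ) := fun b =>
      Finsupp.single i (b.2 : ℕ) + Finsupp.single (i + 1) (b.1 : ℕ)
    have hne : i + 1 ≠ i := by fin_cases i <;> decide
    have hμ0 : ∀ b, μ b i = b.2 := fun b => by simp [μ, hne]
    have hμ1 : ∀ b, μ b (i + 1) = b.1 := fun b => by simp [μ, hne.symm]
    have hμd : ∀ b, (μ b).degree = b.1 + b.2 := fun b => by simp [μ]; omega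
    have hinj : Function.Injective μ := by
      rintro ⟨a, c⟩ ⟨a', c'⟩ h
      have h0 := DFunLike.congr_fun h i
      have h1 := DFunLike.congr_fun h (i + 1)
      rw [hμ0, hμ0] at h0
      rw [hμ1, hμ1] at h1
      simp only at h0 h1
      ext <;> simp <;> omega
    have hs : Fintype.card (Fin (n + 1) × Fin 2) = 2 * n + 2 := by simp; ring
    have hW : ∑ b, (μ b).degree = (n + 1) ^ 2 := by
      simp only [hμd]
      rw [Fintype.sum_prod_type]
      simp only [Fin.sum_univ_two, Fin.val_zero, Fin.val_one]
      rw [Fin.sum_univ_eq_sum_range (fun m => m + 0 + (m + 1))]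
      have : ∀ k, ∑ m ∈ Finset.range k, (m + 0 + (m + 1)) = k ^ 2 := by
        intro k
        induction k with
        | zero => simp
        | succ k ih => rw [Finset.sum_range_succ, ih]; ring
      exact this _
    obtain ⟨c, hc, hk⟩ := class_poly h j μ _ n N Y
      (fun σ hσ => inj_bound1 σ hσ) I hI hIc hN
      (lt_of_le_of_lt (Nat.factorial_le (by rw [hs]; nlinarith)) hY) (by
        rw [hs, hW, show 2 * n + 2 - 1 = 2 * n + 1 by omega,
          show (2 * n + 2) * (2 * n + 1) = ((n + 1) * (2 * n + 1)) * 2 by ring,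
          Nat.mul_div_cancel _ (by norm_num)]
        nlinarith) S hbox hz hcong hsm
    refine ⟨fam μ c, fam_totalDegree μ c _ fun b => ?_, ?_, hk⟩
    · rw [hμd]; have := b.1.2; have := b.2.2; omega
    · rintro ⟨q, hq⟩
      have hne := fam_ne_zero μ hinj c hc
      have hq0 : q ≠ 0 := by rintro rfl; simp at hq; exact hne hq
      have h1 : degreeOf i (fam μ c) ≤ 1 := by
        rw [degreeOf_le_iff]
        intro α hα
        obtain ⟨b, rfl⟩ := fam_support μ c α (mem_support_iff.1 hα)
        rw [hμ0]; have := b.2.2; omega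
      rw [hq, degreeOf_mul_eq hf0 hq0] at h1
      omega
  · push Not at hi
    let μ : Fin (n + 1) ⊕ Fin n → (Fin 2 →₀ ℕ) := fun b =>
      Sum.elim (fun a : Fin (n + 1) => Finsupp.single 0 (a : ℕ)) (fun b : Fin n => Finsupp.single 1 ((b : ℕ) + 1)) b
    have hμp : ∀ b, μ b 0 = 0 ∨ μ b 1 = 0 := by
      rintro (b | b) <;> simp [μ]
    have hinj : Function.Injective μ := by
      rintro (a | a) (b | b) h
      · have h0 := DFunLike.congr_fun h 0
        simp [μ] at h0; congr 1; ext; exact h0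
      · have h0 := DFunLike.congr_fun h 1
        simp [μ] at h0
      · have h0 := DFunLike.congr_fun h 1
        simp [μ] at h0
      · have h0 := DFunLike.congr_fun h 1
        simp [μ] at h0; congr 1; ext; exact h0
    have hs : Fintype.card (Fin (n + 1) ⊕ Fin n) = 2 * n + 1 := by simp; ring
    have hW : ∑ b, (μ b).degree = n * (n + 1) := by
      rw [Fintype.sum_sum_type]
      simp only [μ, Sum.elim_inl, Sum.elim_inr, Finsupp.degree_single]
      rw [Fin.sum_univ_eq_sum_range (fun m => m), Fin.sum_univ_eq_sum_range (fun m => m + 1)]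
      have : ∀ k, ∑ m ∈ Finset.range (k + 1), m + ∑ m ∈ Finset.range k, (m + 1) = k * (k + 1) := by
        intro k
        induction k with
        | zero => simp
        | succ k ih =>
          rw [Finset.sum_range_succ, Finset.sum_range_succ (fun m => m + 1)]
          nlinarith
      exact this _
    obtain ⟨c, hc, hk⟩ := class_poly h j μ _ n N Y
      (fun σ hσ => inj_bound1 σ hσ) I hI hIc hN
      (lt_of_le_of_lt (Nat.factorial_le (by rw [hs]; nlinarith)) hY) (by
        rw [hs, hW, show 2 * n + 1 - 1 = 2 * n by omega,
          show (2 * n + 1) * (2 * n) = (n * (2 * n + 1)) * 2 by ring,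
          Nat.mul_div_cancel _ (by norm_num)]
        nlinarith) S hbox hz hcong hsm
    refine ⟨fam μ c, fam_totalDegree μ c _ fun b => ?_, ?_, hk⟩
    · rcases b with b | b
      · have := b.2; simp [μ] <;> omega
      · have := b.2; simp [μ] <;> omega
    · rintro ⟨q, hq⟩
      have hne := fam_ne_zero μ hinj c hc
      have hq0 : q ≠ 0 := by rintro rfl; simp at hq; exact hne hq
      let m : MonomialOrder (Fin 2) := MonomialOrder.lex
      have hd : m.degree h 0 = 1 ∧ m.degree h 1 = 1 := by
        let β : Fin 2 →₀ ℕ := Finsupp.single 0 1 + Finsupp.single 1 1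
        have hβ : ∀ α ∈ h.support, α ≤ β := by
          intro α hα i
          have h1 := monomial_le_degreeOf i hα
          have h2 := hi i
          have h3 : β i = 1 := by fin_cases i <;> simp [β]
          omega
        have hβs : β ∈ h.support := by
          obtain ⟨α, hα, hαd⟩ := Finset.exists_mem_eq_sup h.support (support_nonempty.2 hf0)
            (fun s => s.sum fun _ e => e)
          have hα2 : 2 ≤ α.degree := by
            have : h.totalDegree = α.degree := hαd
            omega
          have : α = β := by
            have h1 := hβ α hα
            have h10 := h1 0
            have h11 := h1 1
            rw [Finsupp.degree_eq_sum, Fin.sum_univ_two] at hα2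
            simp [β] at h10 h11
            ext i; fin_cases i <;> simp [β] <;> omega
          rwa [← this]
        have e : m.degree h = β := by
          apply m.toSyn.injective
          apply le_antisymm
          · exact m.toSyn_monotone (hβ _ (m.degree_mem_support hf0))
          · exact m.le_degree hβs
        rw [e]; simp [β]
      have h1 := m.degree_mem_support hne
      obtain ⟨b, hb⟩ := fam_support μ c _ (mem_support_iff.1 h1)
      rw [hq, MonomialOrder.degree_mul hf0 hq0] at hb
      rcases hμp b with h2 | h2 <;> rw [hb] at h2 <;> simp at h2 <;> omega


lemma factors_set {n : ℕ} (R : MvPolynomial (Fin n) ℤ) (hR : R ≠ 0) :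
    ∃ H : Finset (MvPolynomial (Fin n) ℤ), H.card ≤ R.totalDegree ∧
      (∀ h ∈ H, Irreducible h ∧ 1 ≤ h.totalDegree ∧ h.totalDegree ≤ R.totalDegree) ∧
      ∀ x, eval x R = 0 → ∃ h ∈ H, eval x h = 0 := by
  classical
  induction R using WfDvdMonoid.induction_on_irreducible with
  | zero => exact absurd rfl hR
  | unit u hu =>
    refine ⟨∅, by simp, by simp, fun x hx => ?_⟩
    have := hu.map (eval x)
    rw [hx] at this
    exact absurd this not_isUnit_zero
  | mul a i ha hi ih =>
    obtain ⟨H, hc, hH, hz⟩ := ih ha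
    have hdeg := totalDegree_mul_of_isDomain hi.ne_zero ha
    by_cases h1 : i.totalDegree = 0
    · refine ⟨H, by omega, fun h hh => ⟨(hH h hh).1, (hH h hh).2.1, by have := (hH h hh).2.2; omega⟩, ?_⟩
      intro x hx
      rw [map_mul, mul_eq_zero] at hx
      rcases hx with hx | hx
      · rw [totalDegree_eq_zero_iff_eq_C] at h1
        have hi0 := hi.ne_zero
        rw [h1] at hx hi0
        simp at hx
        rw [hx] at hi0; simp at hi0
      · exact hz x hx
    · refine ⟨insert i H, ?_, ?_, ?_⟩
      · have := Finset.card_insert_le i H; omega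
      · intro h hh
        rcases Finset.mem_insert.1 hh with rfl | hh
        · exact ⟨hi, by omega, by omega⟩
        · exact ⟨(hH h hh).1, (hH h hh).2.1, by have := (hH h hh).2.2; omega⟩
      · intro x hx
        rw [map_mul, mul_eq_zero] at hx
        rcases hx with hx | hx
        · exact ⟨i, by simp, hx⟩
        · obtain ⟨h, hh, hx⟩ := hz x hx
          exact ⟨h, by simp [hh], hx⟩

def pr (π : Fin 3) (x : Fin 3 → ℤ) : Fin 2 → ℤ := fun j => x (π.succAbove j)

def DD (d n : ℕ) : ℕ := (2 * (d + 2 * n + 3) + 1) * (d + 2 * n + 3)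

lemma class_data (n d N Y : ℕ) (hd : 4 ≤ d) (f : MvPolynomial (Fin 3) ℤ) (hf : Irreducible f)
    (hfd : f.totalDegree ≤ d) (hlc : coeff (Finsupp.single 2 d) f ≠ 0)
    (I : Finset ℕ) (hI : ∀ p ∈ I, p.Prime ∧ Y ≤ p) (hIc : I.card = n + 1)
    (hN : N ≤ Y ^ (2 * n)) (hY : (2 * (2 * n + 1) * (2 * n + 2)).factorial < Y)
    (S : Set (Fin 3 → ℤ)) (hbox : ∀ x ∈ S, ∀ i, |x i| ≤ N) (hz : ∀ x ∈ S, eval x f = 0)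
    (hcong : ∀ x ∈ S, ∀ y ∈ S, ∀ p ∈ I, ∀ i, (p : ℤ) ∣ x i - y i)
    (hsm : ∀ x ∈ S, ∀ p ∈ I, ¬ (p : ℤ) ∣ eval x (pderiv 2 f)) :
    ∃ H : Fin 3 → Finset (MvPolynomial (Fin 2) ℤ), ∀ π, (H π).card ≤ DD d n ∧
      (∀ h ∈ H π, Irreducible h ∧ 1 ≤ h.totalDegree ∧ h.totalDegree ≤ DD d n) ∧
      ∀ x ∈ S, ∃ h ∈ H π, eval (pr π x) h = 0 := by
  obtain ⟨G, hGd, hG, hGz⟩ := surf_class n d N Y hd f hlc I hI hIc hN hY S hbox hz hcong hsm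
  have : ∀ π : Fin 3, ∃ H : Finset (MvPolynomial (Fin 2) ℤ), H.card ≤ DD d n ∧
      (∀ h ∈ H, Irreducible h ∧ 1 ≤ h.totalDegree ∧ h.totalDegree ≤ DD d n) ∧
      ∀ x ∈ S, ∃ h ∈ H, eval (pr π x) h = 0 := by
    intro π
    obtain ⟨R, hR, hRd, hRz⟩ := elim 2 π (d + 2 * n + 3) f G hf hG (by omega) (by omega)
    obtain ⟨H, hc, hH, hHz⟩ := factors_set R hR
    refine ⟨H, hc.trans hRd, fun h hh => ⟨(hH h hh).1, (hH h hh).2.1, (hH h hh).2.2.trans hRd⟩, ?_⟩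
    intro x hx
    apply hHz
    have := hRz (fun i => (x i : ℚ)) ((aeval_cast_zero x f).2 (hz x hx))
      ((aeval_cast_zero x G).2 (hGz x hx))
    exact (aeval_cast_zero (pr π x) R).1 this
  choose H hH using this
  exact ⟨H, hH⟩

lemma modp_count (d p : ℕ) [Fact p.Prime] (f : MvPolynomial (Fin 3) ℤ)
    (hfd : f.totalDegree ≤ d) (hlc : ¬ (p : ℤ) ∣ coeff (Finsupp.single 2 d) f) :
    ∃ B : Finset (Fin 3 → ZMod p), B.card ≤ d * p ^ 2 ∧
      ∀ x : Fin 3 → ZMod p, aeval x f = 0 → x ∈ B := by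
  classical
  refine ⟨Finset.univ.filter fun x => aeval x f = 0, ?_, fun x hx => by simpa using hx⟩
  have := card_le_fibre (Finset.univ.filter fun x : Fin 3 → ZMod p => aeval x f = 0)
    (fun x j => x ((2 : Fin 3).succAbove j)) d ?_ Finset.univ (fun _ _ => Finset.mem_univ _)
  · refine this.trans ?_
    rw [Finset.card_univ, Fintype.card_fun, ZMod.card, Fintype.card_fin]
  · intro y A' hA' hy
    obtain ⟨Z, hc, hZ⟩ := fibre (A := ZMod p) 2 d 2 f hfd (by
      rwa [Ne, ZMod.intCast_zmod_eq_zero_iff_dvd]) y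
    refine le_trans (Finset.card_le_card_of_injOn (fun x => x 2) ?_ ?_) hc
    · intro x hx
      exact hZ x (fun j => congrFun (hy x hx) j) (Finset.mem_filter.1 (hA' hx)).2
    · intro x hx x' hx' h
      funext i
      rcases Fin.eq_self_or_eq_succAbove 2 i with rfl | ⟨j, rfl⟩
      · exact h
      · exact (congrFun (hy x hx) j).trans (congrFun (hy x' hx') j).symm

lemma countK (d Z c : ℕ) (f : MvPolynomial (Fin 3) ℤ)
    (hfd : f.totalDegree ≤ d) (K : Finset ℕ) :
    ∀ (A : Finset (Fin 3 → ℤ)), (∀ x ∈ A, eval x f = 0) →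
    (∀ p ∈ K, p.Prime ∧ p ≤ Z ∧ ¬ (p : ℤ) ∣ coeff (Finsupp.single 2 d) f) →
    (∀ A' ⊆ A, (∀ x ∈ A', ∀ y ∈ A', ∀ p ∈ K, ∀ i, (p : ℤ) ∣ x i - y i) → A'.card ≤ c) →
    A.card ≤ c * (d * Z ^ 2) ^ K.card := by
  classical
  induction K using Finset.induction_on with
  | empty => intro A _ _ h; simpa using h A (Finset.Subset.refl _) (by simp)
  | insert p K hp ih =>
    intro A hA hK h
    obtain ⟨hpp, hpZ, hpl⟩ := hK p (by simp)
    haveI : Fact p.Prime := ⟨hpp⟩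
    obtain ⟨B, hBc, hB⟩ := modp_count d p f hfd hpl
    rw [Finset.card_insert_of_notMem hp, pow_succ, ← mul_assoc]
    refine (card_le_fibre A (fun x i => (x i : ZMod p)) (c * (d * Z ^ 2) ^ K.card) ?_ B ?_).trans ?_
    · intro b A' hA' hb
      refine ih A' (fun x hx => hA x (hA' hx)) (fun q hq => hK q (by simp [hq])) ?_
      intro A'' hA'' hcong
      refine h A'' (hA''.trans hA') ?_
      intro x hx y hy q hq i
      rcases Finset.mem_insert.1 hq with rfl | hq
      · have := congrFun ((hb x (hA'' hx)).trans (hb y (hA'' hy)).symm) i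
        rw [← ZMod.intCast_zmod_eq_zero_iff_dvd]
        push_cast
        exact sub_eq_zero.2 this
      · exact hcong x hx y hy q hq i
    · intro x hx
      apply hB
      rw [aeval_cast, hA x hx]; simp
    · gcongr
      exact hBc.trans (by gcongr)

lemma bad_count (d Z c D : ℕ) (f : MvPolynomial (Fin 3) ℤ)
    (hfd : f.totalDegree ≤ d) (hlc : ∀ i, coeff (Finsupp.single i d) f ≠ 0) (K : Finset ℕ)
    (π : Fin 3)
    (A : Finset (Fin 3 → ℤ)) (hA : ∀ x ∈ A, eval x f = 0)
    (hK : ∀ p ∈ K, p.Prime ∧ p ≤ Z ∧ ¬ (p : ℤ) ∣ coeff (Finsupp.single 2 d) f)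
    (hP : ∀ A' ⊆ A, A'.Nonempty → (∀ x ∈ A', ∀ y ∈ A', ∀ p ∈ K, ∀ i, (p : ℤ) ∣ x i - y i) →
      ∃ P : Finset (MvPolynomial (Fin 2) ℤ × MvPolynomial (Fin 2) ℤ), P.card ≤ c ∧
        ∀ x ∈ A', ∃ q ∈ P, Irreducible q.1 ∧ ¬ q.1 ∣ q.2 ∧ q.1.totalDegree ≤ D ∧
          q.2.totalDegree ≤ D ∧ eval (pr π x) q.1 = 0 ∧ eval (pr π x) q.2 = 0) :
    A.card ≤ (d * ((2 * D + 1) * D) ^ 2 * c) * (d * Z ^ 2) ^ K.card := by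
  classical
  refine countK d Z _ f hfd K A hA hK ?_
  intro A' hA' hcong
  rcases A'.eq_empty_or_nonempty with rfl | hne
  · simp
  obtain ⟨P, hPc, hPx⟩ := hP A' hA' hne hcong
  choose! q hqP hq using hPx
  refine (card_le_fibre A' q (d * ((2 * D + 1) * D) ^ 2) ?_ P hqP).trans (by gcongr)
  intro b A'' hA'' hb
  rcases A''.eq_empty_or_nonempty with rfl | ⟨x0, hx0⟩
  · simp
  have h0 := hq x0 (hA'' hx0)
  rw [hb x0 hx0] at h0
  refine (drop_card 2 d π f hfd (hlc π) A'' (fun x hx => hA x (hA' (hA'' hx)))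
    (A''.image (pr π)) (fun x hx => Finset.mem_image.2 ⟨x, hx, rfl⟩)).trans ?_
  gcongr
  refine bezout2_card D b.1 b.2 h0.1 h0.2.1 h0.2.2.1 h0.2.2.2.1 _ ?_
  intro y hy
  obtain ⟨x, hx, rfl⟩ := Finset.mem_image.1 hy
  have h1 := hq x (hA'' hx)
  rw [hb x hx] at h1
  exact ⟨h1.2.2.2.2.1, h1.2.2.2.2.2⟩


lemma primes_dvd (P : Finset ℕ) (Y M : ℕ) (hP : ∀ p ∈ P, p.Prime ∧ Y ≤ p) (hY : 1 < Y) (a : ℤ)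
    (ha : a ≠ 0) (hM : |a| < (Y ^ (M + 1) : ℕ)) [DecidablePred fun p : ℕ => (p : ℤ) ∣ a] :
    (P.filter fun p : ℕ => (p : ℤ) ∣ a).card ≤ M := by
  by_contra hcon
  push Not at hcon
  have h1 : ((∏ p ∈ P.filter (fun p : ℕ => (p : ℤ) ∣ a), p : ℕ) : ℤ) ∣ a := by
    push_cast
    refine Finset.prod_dvd_of_coprime ?_ ?_
    · intro p hp q hq hpq
      simp only [Function.onFun]
      rw [Nat.isCoprime_iff_coprime]
      exact (Nat.coprime_primes (hP p (Finset.mem_filter.1 hp).1).1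
        (hP q (Finset.mem_filter.1 hq).1).1).2 hpq
    · intro p hp; exact (Finset.mem_filter.1 hp).2
  have h2 : Y ^ (M + 1) ≤ ∏ p ∈ P.filter (fun p : ℕ => (p : ℤ) ∣ a), p := by
    calc Y ^ (M + 1) ≤ Y ^ (P.filter (fun p : ℕ => (p : ℤ) ∣ a)).card :=
          Nat.pow_le_pow_right (by omega) hcon
      _ = ∏ p ∈ P.filter (fun p : ℕ => (p : ℤ) ∣ a), Y := by rw [Finset.prod_const]
      _ ≤ _ := Finset.prod_le_prod' fun p hp => (hP p (Finset.mem_filter.1 hp).1).2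
  have h3 := Int.le_of_dvd (abs_pos.2 ha) ((dvd_abs _ _).2 h1)
  have h4 : ((Y ^ (M + 1) : ℕ) : ℤ) ≤ |a| := le_trans (by exact_mod_cast h2) h3
  omega

lemma exchange {α : Type*} [Monoid α] (J : Finset ℕ) (t : ℕ) (Hx : Finset ℕ → Set α)
    (hne : ∀ I ⊆ J, I.card = t → (Hx I).Nonempty)
    (hadj : ∀ I ⊆ J, I.card = t → ∀ I' ⊆ J, I'.card = t → (I ∪ I').card ≤ t + 1 →
      ∀ h ∈ Hx I, ∀ h' ∈ Hx I', h ∣ h') :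
    ∀ k : ℕ, ∀ I ⊆ J, I.card = t → ∀ I' ⊆ J, I'.card = t → (I \ I').card = k →
      ∀ h ∈ Hx I, ∀ h' ∈ Hx I', h ∣ h' := by
  intro k
  induction k with
  | zero =>
    intro I hI hIc I' hI' hI'c hk h hh h' hh'
    have h1 : I ⊆ I' := Finset.sdiff_eq_empty_iff_subset.1 (Finset.card_eq_zero.1 hk)
    have h2 : I = I' := Finset.eq_of_subset_of_card_le h1 (by omega)
    subst h2
    exact hadj I hI hIc I hI hIc (by simp; omega) h hh h' hh'
  | succ k ih =>
    intro I hI hIc I' hI' hI'c hk h hh h' hh'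
    obtain ⟨a, ha⟩ : (I \ I').Nonempty := Finset.card_pos.1 (by omega)
    have hc : (I' \ I).card = (I \ I').card := Finset.card_sdiff_comm (by omega)
    obtain ⟨b, hb⟩ : (I' \ I).Nonempty := Finset.card_pos.1 (by omega)
    rw [Finset.mem_sdiff] at ha hb
    have hbe : b ∉ I.erase a := fun h => hb.2 (Finset.mem_of_mem_erase h)
    have hsub : insert b (I.erase a) ⊆ J :=
      Finset.insert_subset (hI' hb.1) ((Finset.erase_subset _ _).trans hI)
    have hcard : (insert b (I.erase a)).card = t := by
      rw [Finset.card_insert_of_notMem hbe, Finset.card_erase_of_mem ha.1]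
      have := Finset.card_pos.2 ⟨a, ha.1⟩
      omega
    obtain ⟨h'', hh''⟩ := hne _ hsub hcard
    refine (hadj I hI hIc _ hsub hcard ?_ h hh h'' hh'').trans
      (ih _ hsub hcard I' hI' hI'c ?_ h'' hh'' h' hh')
    · have : I ∪ insert b (I.erase a) ⊆ insert b I := by
        intro c hc
        simp only [Finset.mem_union, Finset.mem_insert, Finset.mem_erase] at hc ⊢
        tauto
      refine (Finset.card_le_card this).trans ((Finset.card_insert_le _ _).trans (by omega))
    · have : insert b (I.erase a) \ I' = (I \ I').erase a := by
        ext c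
        simp only [Finset.mem_sdiff, Finset.mem_insert, Finset.mem_erase]
        constructor
        · rintro ⟨rfl | h, h2⟩
          · exact absurd hb.1 h2
          · tauto
        · tauto
      rw [this, Finset.card_erase_of_mem (Finset.mem_sdiff.2 ha)]
      omega

/-- bound for derivatives -/
def PB (n D K N : ℕ) : ℕ := (D + 1) ^ n * ((K * D) * N ^ D)

lemma pderiv_totalDegree {n : ℕ} (j : Fin n) (f : MvPolynomial (Fin n) ℤ) :
    (pderiv j f).totalDegree ≤ f.totalDegree - 1 := by
  rw [totalDegree, Finset.sup_le_iff]
  intro α hα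
  rw [mem_support_iff, coeff_pderiv] at hα
  have h1 : coeff (α + Finsupp.single j 1) f ≠ 0 := fun h => hα (by rw [h]; simp)
  have h2 := deg_le_of_coeff f _ h1
  simp at h2
  rw [show (α.sum fun _ e => e) = α.degree from rfl]
  omega

lemma pd_bound (n D K N : ℕ) (hN : 1 ≤ N) (f : MvPolynomial (Fin n) ℤ) (hf : f.totalDegree ≤ D)
    (hK : ∀ α, |coeff α f| ≤ K) (x : Fin n → ℤ) (hx : ∀ i, |x i| ≤ N) (j : Fin n) :
    |eval x (pderiv j f)| ≤ (PB n D K N : ℕ) := by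
  refine eval_le n D (K * D) N hN (pderiv j f) ?_ ?_ x hx
  · exact (pderiv_totalDegree j f).trans (by omega)
  · intro α
    rw [coeff_pderiv]
    by_cases h1 : coeff (α + Finsupp.single j 1) f = 0
    · rw [h1]; simp; positivity
    have h2 := deg_le_of_coeff f _ h1
    simp at h2
    have h3 : α j ≤ α.degree := Finsupp.le_degree j α
    rw [abs_mul]
    push_cast
    have h4 : |(α j : ℤ) + 1| ≤ D := by
      rw [abs_of_nonneg (by positivity)]
      have : α j + 1 ≤ D := by omega
      exact_mod_cast this
    exact mul_le_mul (hK _) h4 (abs_nonneg _) (by positivity)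

lemma exists_pderiv_ne {n : ℕ} (f : MvPolynomial (Fin n) ℤ) (h : 1 ≤ f.totalDegree) :
    ∃ j, pderiv j f ≠ 0 := by
  have hf0 : f ≠ 0 := by rintro rfl; simp at h
  obtain ⟨α, hα, hαd⟩ := Finset.exists_mem_eq_sup f.support (support_nonempty.2 hf0)
            (fun s => s.sum fun _ e => e)
  have : 1 ≤ α.degree := by
    have : f.totalDegree = α.degree := hαd
    omega
  have hα0 : α ≠ 0 := by rintro rfl; simp at this
  obtain ⟨j, hj⟩ : ∃ j, α j ≠ 0 := by
    by_contra hh; push Not at hh; exact hα0 (Finsupp.ext hh)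
  refine ⟨j, fun h0 => ?_⟩
  have h1 := congrArg (coeff (α - Finsupp.single j 1)) h0
  rw [coeff_pderiv, tsub_add_cancel_of_le (by simpa using Nat.one_le_iff_ne_zero.2 hj)] at h1
  simp at h1
  rcases h1 with h1 | h1
  · exact (mem_support_iff.1 hα) h1
  · have : ((α j - 1 : ℕ) : ℤ) + 1 ≠ 0 := by positivity
    exact this h1

lemma not_dvd_pderiv {n : ℕ} (f : MvPolynomial (Fin n) ℤ) (h : 1 ≤ f.totalDegree) (j : Fin n)
    (hj : pderiv j f ≠ 0) : ¬ f ∣ pderiv j f := by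
  rintro ⟨q, hq⟩
  have hf0 : f ≠ 0 := by rintro rfl; simp at h
  have hq0 : q ≠ 0 := by rintro rfl; simp at hq; exact hj hq
  have h1 := pderiv_totalDegree j f
  rw [hq, totalDegree_mul_of_isDomain hf0 hq0] at h1
  omega

lemma gam (D N : ℕ) (hN : 1 ≤ N) (h : MvPolynomial (Fin 2) ℤ) (hh : Irreducible h)
    (h1 : 1 ≤ h.totalDegree) (hD : h.totalDegree ≤ D) :
    ∃ Γ : Finset (MvPolynomial (Fin 2) ℤ), Γ.card ≤ 2 ∧ (∀ g ∈ Γ, ¬ h ∣ g ∧ g.totalDegree ≤ D) ∧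
      ∀ w : Fin 2 → ℤ, (∀ i, |w i| ≤ N) → eval w h = 0 → (∃ g ∈ Γ, eval w g = 0) ∨
        ((∀ α, |coeff α h| ≤ (SB 2 D N : ℤ)) ∧ ∃ j, eval w (pderiv j h) ≠ 0) := by
  classical
  obtain ⟨j, hj⟩ := exists_pderiv_ne h h1
  have hjd := not_dvd_pderiv h h1 j hj
  have hjt : (pderiv j h).totalDegree ≤ D := (pderiv_totalDegree j h).trans (by omega)
  rcases small_or 2 D N hN h hh hD with ⟨g, hgd, hg, hgz⟩ | hs
  · refine ⟨{g}, by simp, by simp [hg, hgd], fun w hw hz => Or.inl ⟨g, by simp, hgz w hw hz⟩⟩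
  · refine ⟨{pderiv j h}, by simp, by simp [hjd, hjt], fun w hw hz => ?_⟩
    by_cases h2 : eval w (pderiv j h) = 0
    · exact Or.inl ⟨_, by simp, h2⟩
    · exact Or.inr ⟨hs, j, h2⟩

/-- linear polynomials kill a 2x2 minor -/
lemma lin_eval (h : MvPolynomial (Fin 2) ℤ) (h1 : h.totalDegree ≤ 1) (w : Fin 2 → ℤ) :
    eval w h = coeff 0 h + coeff (Finsupp.single 0 1) h * w 0 + coeff (Finsupp.single 1 1) h * w 1 := by
  have key : h = monomial 0 (coeff 0 h) + monomial (Finsupp.single 0 1) (coeff (Finsupp.single 0 1) h)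
      + monomial (Finsupp.single 1 1) (coeff (Finsupp.single 1 1) h) := by
    classical
    ext α
    have n1 : (0 : Fin 2 →₀ ℕ) ≠ Finsupp.single 0 1 := fun h => by simpa using DFunLike.congr_fun h 0
    have n2 : (0 : Fin 2 →₀ ℕ) ≠ Finsupp.single 1 1 := fun h => by simpa using DFunLike.congr_fun h 1
    have n3 : (Finsupp.single 0 1 : Fin 2 →₀ ℕ) ≠ Finsupp.single 1 1 :=
      fun h => by simpa using DFunLike.congr_fun h 1
    simp only [coeff_add, coeff_monomial]
    by_cases a0 : α = 0
    · subst a0; simp [n1.symm, n2.symm]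
    by_cases a1 : α = Finsupp.single 0 1
    · subst a1; simp [n1, n3.symm]
    by_cases a2 : α = Finsupp.single 1 1
    · subst a2; simp [n2, n3]
    rw [if_neg (Ne.symm a0), if_neg (Ne.symm a1), if_neg (Ne.symm a2)]
    by_contra hc
    have := deg_le_of_coeff h α (by simpa using hc)
    have h2 : α.degree ≤ 1 := this.trans h1
    rw [Finsupp.degree_eq_sum, Fin.sum_univ_two] at h2
    have c0 : α 0 = 0 ∨ α 0 = 1 := by omega
    rcases c0 with c0 | c0
    · have c1 : α 1 = 0 ∨ α 1 = 1 := by omega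
      rcases c1 with c1 | c1
      · exact a0 (by ext i; fin_cases i <;> simp [c0, c1])
      · exact a2 (by ext i; fin_cases i <;> simp [c0, c1])
    · exact a1 (by ext i; fin_cases i <;> simp [c0]; omega)
  conv_lhs => rw [key]
  simp only [map_add, eval_monomial', mev]
  simp [Fin.prod_univ_two]

lemma lin_minor (h : MvPolynomial (Fin 2) ℤ) (h1 : h.totalDegree = 1) (x u w : Fin 2 → ℤ)
    (hx : eval x h = 0) (hu : eval u h = 0) (hw : eval w h = 0) :
    (u 0 - x 0) * (w 1 - x 1) = (u 1 - x 1) * (w 0 - x 0) := by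
  rw [lin_eval h h1.le] at hx hu hw
  set b := coeff (Finsupp.single 0 1) h with hb
  set g := coeff (Finsupp.single 1 1) h with hg
  by_cases hb0 : b = 0
  · by_cases hg0 : g = 0
    · exfalso
      obtain ⟨j, hj⟩ := exists_pderiv_ne h h1.ge
      apply hj
      have hd := pderiv_totalDegree j h
      rw [h1] at hd
      have : (pderiv j h).totalDegree = 0 := by omega
      rw [totalDegree_eq_zero_iff_eq_C] at this
      rw [this, coeff_pderiv]
      fin_cases j
      · simp; exact hb0
      · simp; exact hg0
    · apply mul_left_cancel₀ hg0
      rw [hb0] at hx hu hw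
      linear_combination (u 0 - x 0) * (hw - hx) - (w 0 - x 0) * (hu - hx)
  · apply mul_left_cancel₀ hb0
    linear_combination (w 1 - x 1) * (hu - hx) - (u 1 - x 1) * (hw - hx)


lemma prim_par {n : ℕ} (v e : Fin n → ℤ) (hv : Finset.univ.gcd v = 1)
    (h : ∀ i j, v i * e j = v j * e i) : ∃ s : ℤ, ∀ i, e i = s * v i := by
  obtain ⟨i, hi⟩ : ∃ i, v i ≠ 0 := by
    by_contra hh
    push Not at hh
    have : Finset.univ.gcd v = 0 := Finset.gcd_eq_zero_iff.2 fun i _ => hh i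
    rw [this] at hv; exact one_ne_zero hv.symm
  have h1 : v i ∣ Finset.univ.gcd (fun j => v j * e i) :=
    Finset.dvd_gcd fun j _ => ⟨e j, (h i j).symm⟩
  rw [Finset.gcd_mul_right, hv, one_mul, dvd_normalize_iff] at h1
  obtain ⟨s, hs⟩ := h1
  refine ⟨s, fun j => ?_⟩
  apply mul_left_cancel₀ hi
  rw [h i j, hs]; ring

lemma natDegree_aeval_le {n : ℕ} (f : MvPolynomial (Fin n) ℤ) (x v : Fin n → ℤ) :
    (aeval (fun i => Polynomial.C (x i) + Polynomial.X * Polynomial.C (v i)) f :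
      Polynomial ℤ).natDegree ≤ f.totalDegree := by
  rw [aeval_def, eval₂_eq]
  refine Polynomial.natDegree_sum_le_of_forall_le _ _ fun α hα => ?_
  refine (Polynomial.natDegree_mul_le).trans ?_
  rw [show algebraMap ℤ (Polynomial ℤ) (coeff α f) = Polynomial.C (coeff α f) from rfl,
    Polynomial.natDegree_C, zero_add]
  refine (Polynomial.natDegree_prod_le _ _).trans ?_
  refine le_trans (Finset.sum_le_sum (g := fun i => α i) fun i _ => ?_)
    (le_totalDegree hα)
  refine Polynomial.natDegree_pow_le.trans ?_
  have : (Polynomial.C (x i) + Polynomial.X * Polynomial.C (v i)).natDegree ≤ 1 := by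
    compute_degree
  nlinarith

def OnLine (f : MvPolynomial (Fin 3) ℤ) (N : ℕ) (x : Fin 3 → ℤ) : Prop :=
  ∃ v : Fin 3 → ℤ, Finset.univ.gcd v = 1 ∧ (∀ i, |v i| ≤ 2 * N) ∧
    ∀ t : ℤ, eval (fun i => x i + t * v i) f = 0

lemma eval_line {n : ℕ} (f : MvPolynomial (Fin n) ℤ) (x v : Fin n → ℤ) (t : ℤ) :
    (aeval (fun i => Polynomial.C (x i) + Polynomial.X * Polynomial.C (v i)) f :
      Polynomial ℤ).eval t = eval (fun i => x i + t * v i) f := by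
  have := MvPolynomial.map_aeval (fun i => Polynomial.C (x i) + Polynomial.X * Polynomial.C (v i))
    (Polynomial.evalRingHom t) f
  simp only [Polynomial.coe_evalRingHom] at this
  rw [this]
  simp [eval₂_eq', eval_eq']

lemma line_count (d N : ℕ) (hd : 1 ≤ d) (f : MvPolynomial (Fin 3) ℤ) (hfd : f.totalDegree ≤ d)
    (A : Finset (Fin 3 → ℤ)) (hA : ∀ x ∈ A, (∀ i, |x i| ≤ N) ∧ eval x f = 0 ∧ ¬ OnLine f N x)
    (hm : ∀ x ∈ A, ∀ u ∈ A, ∀ w ∈ A, ∀ i j, (u i - x i) * (w j - x j) = (u j - x j) * (w i - x i)) :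
    A.card ≤ d := by
  classical
  by_contra hcon
  push Not at hcon
  obtain ⟨x, hx, u, hu, hxu⟩ := Finset.one_lt_card.1 (lt_of_le_of_lt hd hcon)
  obtain ⟨v, hv, hv1⟩ := Finset.extract_gcd (s := (Finset.univ : Finset (Fin 3)))
    (fun i => u i - x i) Finset.univ_nonempty
  set g := Finset.univ.gcd (fun i => u i - x i) with hg
  have hg0 : g ≠ 0 := by
    intro h0
    rw [hg, Finset.gcd_eq_zero_iff] at h0
    apply hxu
    funext i
    have := h0 i (Finset.mem_univ _)
    omega
  have hpar : ∀ w ∈ A, ∃ s : ℤ, ∀ i, w i - x i = s * v i := by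
    intro w hw
    refine prim_par v (fun i => w i - x i) hv1 fun i j => ?_
    have := hm x hx u hu w hw i j
    rw [hv i (Finset.mem_univ _), hv j (Finset.mem_univ _)] at this
    apply mul_left_cancel₀ hg0
    linarith
  choose! s hs using hpar
  set Q : Polynomial ℤ := aeval (fun i => Polynomial.C (x i) + Polynomial.X * Polynomial.C (v i)) f
  have hQ0 : Q ≠ 0 := by
    intro h0
    apply (hA x hx).2.2
    refine ⟨v, hv1, fun i => ?_, fun t => ?_⟩
    · have h1 : |u i - x i| ≤ 2 * N := by
        have h1 := (hA x hx).1 i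
        have h2 := (hA u hu).1 i
        rw [abs_le] at h1 h2 ⊢
        omega
      rw [hv i (Finset.mem_univ _), abs_mul] at h1
      have h2 : 1 ≤ |g| := Int.one_le_abs hg0
      nlinarith [abs_nonneg (v i)]
    · rw [← eval_line, show (aeval _ f : Polynomial ℤ) = Q from rfl, h0]; simp
  have h1 : A.card ≤ Q.roots.toFinset.card := by
    refine Finset.card_le_card_of_injOn s ?_ ?_
    · intro w hw
      simp only [Finset.mem_coe, Multiset.mem_toFinset, Polynomial.mem_roots hQ0, Polynomial.IsRoot]
      rw [eval_line]
      rw [show (fun i => x i + s w * v i) = w from funext fun i => by rw [← hs w hw i]; ring]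
      exact (hA w hw).2.1
    · intro w hw w' hw' h
      funext i
      have a := hs w hw i
      have b := hs w' hw' i
      rw [h] at a
      omega
  have h2 := Q.roots.toFinset_card_le
  have h3 := Q.card_roots'
  have h4 := natDegree_aeval_le f x v
  have h5 : Q.natDegree ≤ f.totalDegree := h4
  omega

def Cl (f : MvPolynomial (Fin 3) ℤ) (N : ℕ) (I : Finset ℕ) (x : Fin 3 → ℤ) : Set (Fin 3 → ℤ) :=
  {y | (∀ i, |y i| ≤ N) ∧ eval y f = 0 ∧ ∀ p ∈ I, ∀ i, (p : ℤ) ∣ y i - x i}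

lemma Cl_eq (f : MvPolynomial (Fin 3) ℤ) (N : ℕ) (I : Finset ℕ) (x x' : Fin 3 → ℤ)
    (h : ∀ p ∈ I, ∀ i, (p : ℤ) ∣ x i - x' i) : Cl f N I x = Cl f N I x' := by
  ext y
  constructor
  · rintro ⟨h1, h2, h3⟩
    exact ⟨h1, h2, fun p hp i => by have := dvd_add (h3 p hp i) (h p hp i); simpa using this⟩
  · rintro ⟨h1, h2, h3⟩
    exact ⟨h1, h2, fun p hp i => by have := dvd_sub (h3 p hp i) (h p hp i); simpa using this⟩


def K1 (d D : ℕ) : ℕ := d * ((2 * D + 1) * D) ^ 2 * (2 * D ^ 2)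

lemma pr_box (π : Fin 3) (x : Fin 3 → ℤ) (N : ℕ) (hx : ∀ i, |x i| ≤ N) : ∀ i, |pr π x i| ≤ N :=
  fun _ => hx _

def Good (f : MvPolynomial (Fin 3) ℤ) (d : ℕ) (x : Fin 3 → ℤ) (p : ℕ) : Prop :=
  ¬ (p : ℤ) ∣ coeff (Finsupp.single 2 d) f * eval x (pderiv 2 f)

open Classical in
lemma core (n d M N Y Z : ℕ) (hn : 1 ≤ n) (hd : 4 ≤ d) (f : MvPolynomial (Fin 3) ℤ)
    (hf : Irreducible f) (hfd : f.totalDegree ≤ d) (hlc : ∀ i, coeff (Finsupp.single i d) f ≠ 0)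
    (P : Finset ℕ) (hP : ∀ p ∈ P, p.Prime ∧ Y ≤ p ∧ p ≤ Z) (hPc : n + 1 + 2 * M ≤ P.card)
    (hN1 : 1 ≤ N) (hN : N ≤ Y ^ (2 * n)) (hY : (2 * (2 * n + 1) * (2 * n + 2)).factorial < Y)
    (hsmall : ∀ α, |coeff α f| ≤ (SB 3 d N : ℤ))
    (hM1 : SB 3 d N * PB 3 d (SB 3 d N) N < Y ^ (M + 1))
    (hM2 : PB 2 (DD d n) (SB 2 (DD d n) N) N < Y ^ (M + 1))
    (A : Finset (Fin 3 → ℤ))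
    (hA : ∀ x ∈ A, (∀ i, |x i| ≤ N) ∧ eval x f = 0 ∧ eval x (pderiv 2 f) ≠ 0 ∧ ¬ OnLine f N x) :
    A.card ≤ (2 ^ P.card * 2 ^ P.card) * ((9 * K1 d (DD d n) + d * DD d n ^ 3) *
      (d * Z ^ 2) ^ (n + 2)) := by
  set D := DD d n with hD
  have hDn : n + 1 ≤ D := by rw [hD, DD]; nlinarith
  have hYpos : 1 < Y := lt_of_le_of_lt (Nat.factorial_pos _) hY
  have hPY : ∀ p ∈ P, p.Prime ∧ Y ≤ p := fun p hp => ⟨(hP p hp).1, (hP p hp).2.1⟩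
  obtain ⟨p0, hp0⟩ : P.Nonempty := Finset.card_pos.1 (by omega)
  have hZ1 : 1 ≤ d * Z ^ 2 := by
    have := hP p0 hp0
    have : 1 ≤ Z := by omega
    exact Nat.mul_pos (by omega) (by positivity)
  -- class data
  have hcl : ∀ (I : Finset ℕ) (S : Set (Fin 3 → ℤ)), ∃ H : Fin 3 → Finset (MvPolynomial (Fin 2) ℤ),
      (∀ x, S = Cl f N I x → I ⊆ P → I.card = n + 1 → (∀ p ∈ I, Good f d x p) →
        ∀ π, (H π).card ≤ D ∧
        (∀ h ∈ H π, Irreducible h ∧ 1 ≤ h.totalDegree ∧ h.totalDegree ≤ D) ∧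
        ∀ y ∈ S, ∃ h ∈ H π, eval (pr π y) h = 0) := by
    intro I S
    by_cases hex : ∃ x, S = Cl f N I x ∧ I ⊆ P ∧ I.card = n + 1 ∧ (∀ p ∈ I, Good f d x p)
    · obtain ⟨x, rfl, hIP, hIc, hg⟩ := hex
      obtain ⟨H, hH⟩ := class_data n d N Y hd f hf hfd (hlc 2) I (fun p hp => hPY p (hIP hp)) hIc hN hY
        (Cl f N I x) (fun y hy => hy.1) (fun y hy => hy.2.1) (by
          intro y hy y' hy' p hp i
          have := dvd_sub (hy.2.2 p hp i) (hy'.2.2 p hp i)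
          simpa using this) (by
          intro y hy p hp hdvd
          apply hg p hp
          apply Dvd.dvd.mul_left
          have := eval_congr_dvd (pderiv 2 f) y x p (fun i => hy.2.2 p hp i)
          have h2 := dvd_sub hdvd this
          simpa using h2)
      exact ⟨H, fun _ _ _ _ _ => hH⟩
    · refine ⟨fun _ => ∅, fun x h1 h2 h3 h4 => absurd ⟨x, h1, h2, h3, h4⟩ hex⟩
  choose H hH using hcl
  have hgam : ∀ h : MvPolynomial (Fin 2) ℤ, ∃ Γ : Finset (MvPolynomial (Fin 2) ℤ),
      Irreducible h → 1 ≤ h.totalDegree → h.totalDegree ≤ D → Γ.card ≤ 2 ∧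
      (∀ g ∈ Γ, ¬ h ∣ g ∧ g.totalDegree ≤ D) ∧
      ∀ w : Fin 2 → ℤ, (∀ i, |w i| ≤ N) → eval w h = 0 → (∃ g ∈ Γ, eval w g = 0) ∨
        ((∀ α, |coeff α h| ≤ (SB 2 D N : ℤ)) ∧ ∃ j, eval w (pderiv j h) ≠ 0) := by
    intro h
    by_cases hh : Irreducible h ∧ 1 ≤ h.totalDegree ∧ h.totalDegree ≤ D
    · obtain ⟨Γ, hΓ⟩ := gam D N hN1 h hh.1 hh.2.1 hh.2.2
      exact ⟨Γ, fun _ _ _ => hΓ⟩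
    · exact ⟨∅, fun a b c => absurd ⟨a, b, c⟩ hh⟩
  choose Γ hΓ using hgam
  have hself : ∀ x ∈ A, ∀ I, x ∈ Cl f N I x := fun x hx I =>
    ⟨(hA x hx).1, (hA x hx).2.1, fun p _ i => by simp⟩
  let E1 : Finset ℕ → Finset ℕ → Fin 3 → Finset (Fin 3 → ℤ) := fun I I' π =>
    A.filter fun x => (I ⊆ P ∧ I.card = n + 1 ∧ ∀ p ∈ I, Good f d x p) ∧
      (I' ⊆ P ∧ I'.card = n + 1 ∧ ∀ p ∈ I', Good f d x p) ∧ (I ∪ I').card ≤ n + 2 ∧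
      ∃ h ∈ H I (Cl f N I x) π, ∃ h' ∈ H I' (Cl f N I' x) π,
        eval (pr π x) h = 0 ∧ eval (pr π x) h' = 0 ∧ ¬ h ∣ h'
  let E0 : Finset ℕ → Fin 3 → Finset (Fin 3 → ℤ) := fun I π =>
    A.filter fun x => (I ⊆ P ∧ I.card = n + 1 ∧ ∀ p ∈ I, Good f d x p) ∧
      ∃ h ∈ H I (Cl f N I x) π, eval (pr π x) h = 0 ∧ ∃ g ∈ Γ h, eval (pr π x) g = 0
  let E2 : Finset ℕ → Fin 3 → Finset (Fin 3 → ℤ) := fun I π =>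
    A.filter fun x => (I ⊆ P ∧ I.card = n + 1 ∧ ∀ p ∈ I, Good f d x p) ∧
      ∃ h ∈ H I (Cl f N I x) π, eval (pr π x) h = 0 ∧ 2 ≤ h.totalDegree ∧
        ∃ j, ∀ p ∈ I, ¬ (p : ℤ) ∣ eval (pr π x) (pderiv j h)
  let E3 : Finset ℕ → Finset (Fin 3 → ℤ) := fun I =>
    A.filter fun x => (I ⊆ P ∧ I.card = n + 1 ∧ ∀ p ∈ I, Good f d x p) ∧
      ∀ π, ∃ h ∈ H I (Cl f N I x) π, eval (pr π x) h = 0 ∧ h.totalDegree = 1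
  have hgoodlc : ∀ x p, Good f d x p → ¬ (p : ℤ) ∣ coeff (Finsupp.single 2 d) f :=
    fun x p h h' => h (h'.mul_right _)
  have hpow : ∀ c (K : Finset ℕ), K.card ≤ n + 2 →
      c * (d * Z ^ 2) ^ K.card ≤ c * (d * Z ^ 2) ^ (n + 2) := by
    intro c K hK
    exact Nat.mul_le_mul_left _ (Nat.pow_le_pow_right hZ1 hK)
  have hD2 : D * 2 ≤ 2 * D ^ 2 := by nlinarith
  have hD3 : D * D ≤ 2 * D ^ 2 := by nlinarith
  have c1 : ∀ I I' π, (E1 I I' π).card ≤ K1 d D * (d * Z ^ 2) ^ (n + 2) := by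
    intro I I' π
    rcases (E1 I I' π).eq_empty_or_nonempty with he | ⟨x0, hx0⟩
    · rw [he]; simp
    obtain ⟨-, ⟨hI, hIc, hIg⟩, ⟨hI', hI'c, hI'g⟩, hU, -⟩ := Finset.mem_filter.1 hx0
    refine (bad_count d Z (2 * D ^ 2) D f hfd hlc (I ∪ I') π _ (fun x hx => (hA x (Finset.mem_filter.1 hx).1).2.1)
      ?_ ?_).trans (hpow _ _ hU)
    · intro p hp
      rcases Finset.mem_union.1 hp with hp | hp
      · exact ⟨(hP p (hI hp)).1, (hP p (hI hp)).2.2, hgoodlc _ _ (hIg p hp)⟩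
      · exact ⟨(hP p (hI' hp)).1, (hP p (hI' hp)).2.2, hgoodlc _ _ (hI'g p hp)⟩
    · rintro A' hA' ⟨x1, hx1⟩ hcong
      obtain ⟨-, ⟨-, -, hIg⟩, ⟨-, -, hI'g⟩, -, -⟩ := Finset.mem_filter.1 (hA' hx1)
      have p1 := hH I (Cl f N I x1) x1 rfl hI hIc hIg π
      have p2 := hH I' (Cl f N I' x1) x1 rfl hI' hI'c hI'g π
      refine ⟨H I (Cl f N I x1) π ×ˢ H I' (Cl f N I' x1) π, ?_, ?_⟩
      · rw [Finset.card_product]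
        exact (Nat.mul_le_mul p1.1 p2.1).trans hD3
      · intro x hx
        obtain ⟨-, -, -, -, h, hh, h', hh', hz, hz', hnd⟩ := Finset.mem_filter.1 (hA' hx)
        rw [Cl_eq f N I x x1 (fun p hp i => hcong x hx x1 hx1 p (Finset.mem_union_left _ hp) i)] at hh
        rw [Cl_eq f N I' x x1 (fun p hp i => hcong x hx x1 hx1 p (Finset.mem_union_right _ hp) i)] at hh'
        exact ⟨(h, h'), Finset.mk_mem_product hh hh', (p1.2.1 h hh).1, hnd, (p1.2.1 h hh).2.2,
          (p2.2.1 h' hh').2.2, hz, hz'⟩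
  have c0 : ∀ I π, (E0 I π).card ≤ K1 d D * (d * Z ^ 2) ^ (n + 2) := by
    intro I π
    rcases (E0 I π).eq_empty_or_nonempty with he | ⟨x0, hx0⟩
    · rw [he]; simp
    obtain ⟨-, ⟨hI, hIc, hIg⟩, -⟩ := Finset.mem_filter.1 hx0
    refine (bad_count d Z (2 * D ^ 2) D f hfd hlc I π _ (fun x hx => (hA x (Finset.mem_filter.1 hx).1).2.1)
      ?_ ?_).trans (hpow _ _ (by omega))
    · intro p hp
      exact ⟨(hP p (hI hp)).1, (hP p (hI hp)).2.2, hgoodlc _ _ (hIg p hp)⟩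
    · rintro A' hA' ⟨x1, hx1⟩ hcong
      obtain ⟨-, ⟨-, -, hIg⟩, -⟩ := Finset.mem_filter.1 (hA' hx1)
      have p1 := hH I (Cl f N I x1) x1 rfl hI hIc hIg π
      refine ⟨(H I (Cl f N I x1) π).biUnion fun h => (Γ h).image fun g => (h, g), ?_, ?_⟩
      · refine le_trans (Finset.card_biUnion_le_card_mul _ _ 2 ?_)
          ((Nat.mul_le_mul_right 2 p1.1).trans hD2)
        intro h hh
        have := p1.2.1 h hh
        exact Finset.card_image_le.trans (hΓ h this.1 this.2.1 this.2.2).1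
      · intro x hx
        obtain ⟨-, -, h, hh, hz, g, hg, hz'⟩ := Finset.mem_filter.1 (hA' hx)
        rw [Cl_eq f N I x x1 (fun p hp i => hcong x hx x1 hx1 p hp i)] at hh
        have h1 := p1.2.1 h hh
        have h2 := (hΓ h h1.1 h1.2.1 h1.2.2).2.1 g hg
        exact ⟨(h, g), Finset.mem_biUnion.2 ⟨h, hh, Finset.mem_image.2 ⟨g, hg, rfl⟩⟩, h1.1, h2.1, h1.2.2,
          h2.2, hz, hz'⟩
  have c2 : ∀ I π, (E2 I π).card ≤ K1 d D * (d * Z ^ 2) ^ (n + 2) := by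
    intro I π
    rcases (E2 I π).eq_empty_or_nonempty with he | ⟨x0, hx0⟩
    · rw [he]; simp
    obtain ⟨-, ⟨hI, hIc, hIg⟩, -⟩ := Finset.mem_filter.1 hx0
    refine (bad_count d Z (2 * D ^ 2) D f hfd hlc I π _ (fun x hx => (hA x (Finset.mem_filter.1 hx).1).2.1)
      ?_ ?_).trans (hpow _ _ (by omega))
    · intro p hp
      exact ⟨(hP p (hI hp)).1, (hP p (hI hp)).2.2, hgoodlc _ _ (hIg p hp)⟩
    · rintro A' hA' ⟨x1, hx1⟩ hcong
      obtain ⟨-, ⟨-, -, hIg⟩, -⟩ := Finset.mem_filter.1 (hA' hx1)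
      have p1 := hH I (Cl f N I x1) x1 rfl hI hIc hIg π
      have hcv : ∀ (h : MvPolynomial (Fin 2) ℤ) (j : Fin 2), ∃ G : MvPolynomial (Fin 2) ℤ,
          2 ≤ h.totalDegree → G.totalDegree ≤ n + 1 ∧ ¬ h ∣ G ∧ ∀ x ∈ A', eval (pr π x) h = 0 →
            (∀ p ∈ I, ¬ (p : ℤ) ∣ eval (pr π x) (pderiv j h)) → eval (pr π x) G = 0 := by
        intro h j
        by_cases h2 : 2 ≤ h.totalDegree
        · obtain ⟨G, a, b, c⟩ := curve_class n N Y hn h j h2 I (fun p hp => hPY p (hI hp)) hIc hN hY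
            {w | ∃ x ∈ A', w = pr π x ∧ eval (pr π x) h = 0 ∧
              ∀ p ∈ I, ¬ (p : ℤ) ∣ eval (pr π x) (pderiv j h)}
            (by rintro _ ⟨x, hx, rfl, -⟩
                exact pr_box π x N (hA x (Finset.mem_filter.1 (hA' hx)).1).1)
            (by rintro _ ⟨x, hx, rfl, hz, -⟩; exact hz)
            (by rintro _ ⟨x, hx, rfl, -⟩ _ ⟨y, hy, rfl, -⟩ p hp i
                exact hcong x hx y hy p hp _)
            (by rintro _ ⟨x, hx, rfl, -, hz⟩; exact hz)
          exact ⟨G, fun _ => ⟨a, b, fun x hx hz hj => c _ ⟨x, hx, rfl, hz, hj⟩⟩⟩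
        · exact ⟨0, fun h => absurd h h2⟩
      choose G hG using hcv
      refine ⟨(H I (Cl f N I x1) π).biUnion fun h => Finset.univ.image fun j => (h, G h j), ?_, ?_⟩
      · refine le_trans (Finset.card_biUnion_le_card_mul _ _ 2 ?_)
          ((Nat.mul_le_mul_right 2 p1.1).trans hD2)
        intro h hh
        exact Finset.card_image_le.trans (by simp)
      · intro x hx
        obtain ⟨-, -, h, hh, hz, h2, j, hj⟩ := Finset.mem_filter.1 (hA' hx)
        rw [Cl_eq f N I x x1 (fun p hp i => hcong x hx x1 hx1 p hp i)] at hh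
        have h1 := p1.2.1 h hh
        have h3 := hG h j h2
        exact ⟨(h, G h j), Finset.mem_biUnion.2 ⟨h, hh, Finset.mem_image.2 ⟨j, Finset.mem_univ _, rfl⟩⟩,
          h1.1, h3.2.1, h1.2.2, h3.1.trans hDn, hz, h3.2.2 x hx hz hj⟩
  have c3 : ∀ I, (E3 I).card ≤ (d * D ^ 3) * (d * Z ^ 2) ^ (n + 2) := by
    intro I
    rcases (E3 I).eq_empty_or_nonempty with he | ⟨x0, hx0⟩
    · rw [he]; simp
    obtain ⟨-, ⟨hI, hIc, hIg⟩, -⟩ := Finset.mem_filter.1 hx0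
    refine (countK d Z (d * D ^ 3) f hfd I _ (fun x hx => (hA x (Finset.mem_filter.1 hx).1).2.1)
      ?_ ?_).trans (hpow _ _ (by omega))
    · intro p hp
      exact ⟨(hP p (hI hp)).1, (hP p (hI hp)).2.2, hgoodlc _ _ (hIg p hp)⟩
    · rintro A' hA' hcong
      rcases A'.eq_empty_or_nonempty with he | ⟨x1, hx1⟩
      · rw [he]; simp
      obtain ⟨-, ⟨-, -, hIg⟩, -⟩ := Finset.mem_filter.1 (hA' hx1)
      have p1 := hH I (Cl f N I x1) x1 rfl hI hIc hIg
      have hex : ∀ x ∈ A', ∀ π, ∃ h ∈ H I (Cl f N I x1) π, eval (pr π x) h = 0 ∧ h.totalDegree = 1 := by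
        intro x hx π
        obtain ⟨-, -, h⟩ := Finset.mem_filter.1 (hA' hx)
        rw [Cl_eq f N I x x1 (fun p hp i => hcong x hx x1 hx1 p hp i)] at h
        exact h π
      choose! q hqH hq using hex
      refine (card_le_fibre A' q d ?_ (Fintype.piFinset fun π => H I (Cl f N I x1) π)
        (fun x hx => Fintype.mem_piFinset.2 (hqH x hx))).trans ?_
      · intro b A'' hA'' hb
        refine line_count d N (by omega) f hfd A'' (fun x hx => ?_) ?_
        · have := hA x (Finset.mem_filter.1 (hA' (hA'' hx))).1
          exact ⟨this.1, this.2.1, this.2.2.2⟩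
        · have hb' : ∀ x ∈ A'', ∀ π, eval (pr π x) (b π) = 0 ∧ (b π).totalDegree = 1 := by
            intro x hx π
            have := hq x (hA'' hx) π
            rwa [hb x hx] at this
          intro x hx u hu w hw
          have hm : ∀ π : Fin 3, (pr π u 0 - pr π x 0) * (pr π w 1 - pr π x 1) =
              (pr π u 1 - pr π x 1) * (pr π w 0 - pr π x 0) := fun π =>
            lin_minor (b π) (hb' x hx π).2 _ _ _ (hb' x hx π).1 (hb' u hu π).1 (hb' w hw π).1
          have m0 : (u 1 - x 1) * (w 2 - x 2) = (u 2 - x 2) * (w 1 - x 1) := hm 0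
          have m1 : (u 0 - x 0) * (w 2 - x 2) = (u 2 - x 2) * (w 0 - x 0) := hm 1
          have m2 : (u 0 - x 0) * (w 1 - x 1) = (u 1 - x 1) * (w 0 - x 0) := hm 2
          intro i j
          fin_cases i <;> fin_cases j <;> simp <;> linarith
      · rw [Fintype.card_piFinset]
        gcongr
        calc ∏ π, (H I (Cl f N I x1) π).card ≤ ∏ π : Fin 3, D :=
              Finset.prod_le_prod' fun π _ => (p1 π).1
          _ = D ^ 3 := by simp
  -- covering
  let Bad : Finset ℕ × Finset ℕ → Finset (Fin 3 → ℤ) := fun q =>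
    (Finset.univ.biUnion fun π => E1 q.1 q.2 π ∪ E0 q.1 π ∪ E2 q.1 π) ∪ E3 q.1
  have hcover : A ⊆ (P.powerset ×ˢ P.powerset).biUnion Bad := by
    intro x hx
    by_contra hnot
    have hnb : ∀ I ⊆ P, ∀ I' ⊆ P, x ∉ Bad (I, I') := by
      intro I hI I' hI' hb
      exact hnot (Finset.mem_biUnion.2 ⟨(I, I'), by simp [hI, hI'], hb⟩)
    have hn1 : ∀ I ⊆ P, ∀ I' ⊆ P, ∀ π, x ∉ E1 I I' π := fun I hI I' hI' π h =>
      hnb I hI I' hI' (Finset.mem_union_left _ (Finset.mem_biUnion.2 ⟨π, Finset.mem_univ _,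
        Finset.mem_union_left _ (Finset.mem_union_left _ h)⟩))
    have hn0 : ∀ I ⊆ P, ∀ π, x ∉ E0 I π := fun I hI π h =>
      hnb I hI I hI (Finset.mem_union_left _ (Finset.mem_biUnion.2 ⟨π, Finset.mem_univ _,
        Finset.mem_union_left _ (Finset.mem_union_right _ h)⟩))
    have hn2 : ∀ I ⊆ P, ∀ π, x ∉ E2 I π := fun I hI π h =>
      hnb I hI I hI (Finset.mem_union_left _ (Finset.mem_biUnion.2 ⟨π, Finset.mem_univ _,
        Finset.mem_union_right _ h⟩))
    have hn3 : ∀ I ⊆ P, x ∉ E3 I := fun I hI h =>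
      hnb I hI I hI (Finset.mem_union_right _ h)
    obtain ⟨hbx, hfx, hdx, -⟩ := hA x hx
    set J := P.filter (fun p => Good f d x p) with hJ
    have hJP : J ⊆ P := Finset.filter_subset _ _
    have hJc : n + 1 + M ≤ J.card := by
      have h1 := Finset.card_filter_add_card_filter_not (s := P)
        (fun p : ℕ => (p : ℤ) ∣ coeff (Finsupp.single 2 d) f * eval x (pderiv 2 f))
      have h2 := primes_dvd P Y M hPY hYpos (coeff (Finsupp.single 2 d) f * eval x (pderiv 2 f))
        (mul_ne_zero (hlc 2) hdx) (by
          rw [abs_mul]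
          have h1 := hsmall (Finsupp.single 2 d)
          have h2 := pd_bound 3 d (SB 3 d N) N hN1 f hfd hsmall x hbx 2
          refine lt_of_le_of_lt (mul_le_mul h1 h2 (abs_nonneg _) (by positivity)) ?_
          exact_mod_cast hM1)
      have h3 : J = P.filter (fun p : ℕ => ¬ (p : ℤ) ∣ coeff (Finsupp.single 2 d) f * eval x (pderiv 2 f)) := by
        ext p; rw [hJ, Finset.mem_filter, Finset.mem_filter]; exact Iff.rfl
      rw [h3]; omega
    have hJg : ∀ I ⊆ J, ∀ p ∈ I, Good f d x p := fun I hI p hp => (Finset.mem_filter.1 (hI hp)).2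
    have hprops : ∀ I ⊆ J, I.card = n + 1 → ∀ π, _ := fun I hI hc =>
      hH I (Cl f N I x) x rfl (hI.trans hJP) hc (hJg I hI)
    let Hx : Fin 3 → Finset ℕ → Set (MvPolynomial (Fin 2) ℤ) := fun π I =>
      {h | h ∈ H I (Cl f N I x) π ∧ eval (pr π x) h = 0}
    have hne : ∀ π, ∀ I ⊆ J, I.card = n + 1 → (Hx π I).Nonempty := by
      intro π I hI hc
      obtain ⟨h, hh, hz⟩ := (hprops I hI hc π).2.2 x (hself x hx I)
      exact ⟨h, hh, hz⟩
    have hdiv : ∀ π, ∀ I ⊆ J, I.card = n + 1 → ∀ I' ⊆ J, I'.card = n + 1 →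
        ∀ h ∈ Hx π I, ∀ h' ∈ Hx π I', h ∣ h' := by
      intro π I hI hIc I' hI' hI'c
      refine exchange J (n + 1) (Hx π) (hne π) ?_ _ I hI hIc I' hI' hI'c rfl
      intro I hI hIc I' hI' hI'c hU h hh h' hh'
      by_contra hnd
      exact hn1 I (hI.trans hJP) I' (hI'.trans hJP) π (Finset.mem_filter.2 ⟨hx,
        ⟨hI.trans hJP, hIc, hJg I hI⟩, ⟨hI'.trans hJP, hI'c, hJg I' hI'⟩, by omega,
        h, hh.1, h', hh'.1, hh.2, hh'.2, hnd⟩)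
    obtain ⟨I0, hI0, hI0c⟩ := Finset.exists_subset_card_eq (s := J) (n := n + 1) (by omega)
    apply hn3 I0 (hI0.trans hJP)
    refine Finset.mem_filter.2 ⟨hx, ⟨hI0.trans hJP, hI0c, hJg I0 hI0⟩, fun π => ?_⟩
    obtain ⟨h0, hh0, hz0⟩ := hne π I0 hI0 hI0c
    refine ⟨h0, hh0, hz0, ?_⟩
    have q0 := (hprops I0 hI0 hI0c π).2.1 h0 hh0
    rcases (hΓ h0 q0.1 q0.2.1 q0.2.2).2.2 (pr π x) (pr_box π x N hbx) hz0 with ⟨g, hg, hgz⟩ | ⟨hs, j, hj⟩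
    · exact absurd (Finset.mem_filter.2 ⟨hx, ⟨hI0.trans hJP, hI0c, hJg I0 hI0⟩, h0, hh0, hz0, g, hg, hgz⟩)
        (hn0 I0 (hI0.trans hJP) π)
    · have h2 := primes_dvd P Y M hPY hYpos (eval (pr π x) (pderiv j h0)) hj (by
          have h2 := pd_bound 2 D (SB 2 D N) N hN1 h0 q0.2.2 hs (pr π x) (pr_box π x N hbx) j
          refine lt_of_le_of_lt h2 ?_
          exact_mod_cast hM2)
      obtain ⟨I, hI, hIc⟩ := Finset.exists_subset_card_eq
        (s := J \ P.filter fun p : ℕ => (p : ℤ) ∣ eval (pr π x) (pderiv j h0)) (n := n + 1) (by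
          have := Finset.le_card_sdiff (P.filter fun p : ℕ => (p : ℤ) ∣ eval (pr π x) (pderiv j h0)) J
          omega)
      have hIJ : I ⊆ J := hI.trans Finset.sdiff_subset
      obtain ⟨h, hh, hz⟩ := hne π I hIJ hIc
      have qh := (hprops I hIJ hIc π).2.1 h hh
      have hd1 : h ∣ h0 := hdiv π I hIJ hIc I0 hI0 hI0c h ⟨hh, hz⟩ h0 ⟨hh0, hz0⟩
      have hd2 : h0 ∣ h := hdiv π I0 hI0 hI0c I hIJ hIc h0 ⟨hh0, hz0⟩ h ⟨hh, hz⟩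
      have hle : h0.totalDegree ≤ h.totalDegree :=
        totalDegree_le_of_dvd_of_isDomain hd2 qh.1.ne_zero
      by_contra hdeg
      apply hn2 I (hIJ.trans hJP) π
      refine Finset.mem_filter.2 ⟨hx, ⟨hIJ.trans hJP, hIc, hJg I hIJ⟩, h, hh, hz, by omega, j, ?_⟩
      intro p hp hdvd
      have hp2 := Finset.mem_sdiff.1 (hI hp)
      apply hp2.2
      refine Finset.mem_filter.2 ⟨hJP hp2.1, ?_⟩
      obtain ⟨q, hq⟩ := hd1
      have e : eval (pr π x) (pderiv j h0) = eval (pr π x) (pderiv j h) * eval (pr π x) q := by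
        rw [hq, pderiv_mul, map_add, map_mul, map_mul, hz, zero_mul, add_zero]
      rw [e]
      exact hdvd.mul_right _
  refine (Finset.card_le_card hcover).trans ?_
  refine (Finset.card_biUnion_le_card_mul _ _ ((9 * K1 d D + d * D ^ 3) * (d * Z ^ 2) ^ (n + 2)) ?_).trans ?_
  · intro q _
    refine (Finset.card_union_le _ _).trans ?_
    have h1 : (Finset.univ.biUnion fun π => E1 q.1 q.2 π ∪ E0 q.1 π ∪ E2 q.1 π).card ≤
        3 * (3 * (K1 d D * (d * Z ^ 2) ^ (n + 2))) := by
      refine (Finset.card_biUnion_le_card_mul _ _ (3 * (K1 d D * (d * Z ^ 2) ^ (n + 2))) ?_).trans (by simp)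
      intro π _
      have a := Finset.card_union_le (E1 q.1 q.2 π ∪ E0 q.1 π) (E2 q.1 π)
      have b := Finset.card_union_le (E1 q.1 q.2 π) (E0 q.1 π)
      have := c1 q.1 q.2 π
      have := c0 q.1 π
      have := c2 q.1 π
      omega
    have h2 := c3 q.1
    rw [add_mul]
    nlinarith
  · rw [Finset.card_product, Finset.card_powerset]


lemma primes_exist (T Y : ℕ) (hY : 1 ≤ Y) : ∃ P : Finset ℕ, P.card = T ∧
    ∀ p ∈ P, p.Prime ∧ Y ≤ p ∧ p ≤ 2 ^ T * Y := by
  induction T with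
  | zero => exact ⟨∅, by simp⟩
  | succ T ih =>
    obtain ⟨P, hc, hP⟩ := ih
    have h0 := Nat.one_le_two_pow (n := T)
    have h3 : Y ≤ 2 ^ T * Y := by nlinarith
    obtain ⟨q, hq, h1, h2⟩ := Nat.exists_prime_lt_and_le_two_mul (2 ^ T * Y) (by omega)
    refine ⟨insert q P, ?_, ?_⟩
    · rw [Finset.card_insert_of_notMem, hc]
      intro h; have := (hP q h).2.2; omega
    · have h4 : 2 ^ (T + 1) * Y = 2 * (2 ^ T * Y) := by ring
      intro p hp
      rcases Finset.mem_insert.1 hp with rfl | hp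
      · exact ⟨hq, by omega, by omega⟩
      · have := hP p hp
        exact ⟨this.1, this.2.1, by omega⟩

lemma root_exists (n N : ℕ) (hn : 1 ≤ n) (hN : 1 ≤ N) : ∃ y : ℕ, 1 ≤ y ∧ N ≤ y ^ n ∧ 
    y ^ n ≤ 2 ^ n * N := by
  have hex : ∃ y : ℕ, N ≤ y ^ n := ⟨N, Nat.le_self_pow (by omega) N⟩
  classical
  refine ⟨Nat.find hex, ?_, Nat.find_spec hex, ?_⟩
  · by_contra h
    have h1 := Nat.find_spec hex
    rw [show Nat.find hex = 0 by omega, zero_pow (by omega)] at h1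
    omega
  · rcases Nat.lt_or_ge (Nat.find hex) 2 with h | h
    · calc (Nat.find hex) ^ n ≤ 1 ^ n := Nat.pow_le_pow_left (by omega) n
        _ ≤ 2 ^ n * N := by rw [one_pow]; exact Nat.mul_pos (by positivity) hN
    · have h1 := Nat.find_min hex (m := Nat.find hex - 1) (by omega)
      calc (Nat.find hex) ^ n ≤ (2 * (Nat.find hex - 1)) ^ n := Nat.pow_le_pow_left (by omega) n
        _ = 2 ^ n * (Nat.find hex - 1) ^ n := by rw [mul_pow]
        _ ≤ 2 ^ n * N := by gcongr; omega

/-- polynomial bounds -/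
def PBd (g : ℕ → ℕ) : Prop := ∃ c κ : ℕ, ∀ N, 1 ≤ N → g N ≤ c * N ^ κ

lemma PBd.mul {g h : ℕ → ℕ} (hg : PBd g) (hh : PBd h) : PBd (fun N => g N * h N) := by
  obtain ⟨c, k, h1⟩ := hg
  obtain ⟨c', k', h2⟩ := hh
  refine ⟨c * c', k + k', fun N hN => ?_⟩
  calc g N * h N ≤ (c * N ^ k) * (c' * N ^ k') := Nat.mul_le_mul (h1 N hN) (h2 N hN)
    _ = _ := by ring

lemma PBd.pow {g : ℕ → ℕ} (hg : PBd g) (m : ℕ) : PBd (fun N => g N ^ m) := by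
  obtain ⟨c, k, h1⟩ := hg
  refine ⟨c ^ m, k * m, fun N hN => ?_⟩
  calc g N ^ m ≤ (c * N ^ k) ^ m := Nat.pow_le_pow_left (h1 N hN) m
    _ = _ := by ring

lemma PBd.const (c : ℕ) : PBd (fun _ => c) := ⟨c, 0, by simp⟩
lemma PBd.id : PBd (fun N => N) := ⟨1, 1, by simp⟩

lemma PBd_SB (n D : ℕ) : PBd (SB n D) :=
  ((PBd.const _).mul (PBd.id.pow D)).pow _

lemma PBd_PB (n D : ℕ) {g : ℕ → ℕ} (hg : PBd g) : PBd (fun N => PB n D (g N) N) :=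
  (PBd.const _).mul ((hg.mul (PBd.const _)).mul (PBd.id.pow D))

/-- choice of parameters: `K, M` with `g N < (K y)^(M+1)` whenever `N ≤ y^m` -/
lemma PBd.lt {g : ℕ → ℕ} (hg : PBd g) (m : ℕ) : ∃ K0 M0 : ℕ, ∀ K M N y, K0 ≤ K → M0 ≤ M → 1 ≤ N →
    1 ≤ y → N ≤ y ^ m → g N < (K * y) ^ (M + 1) := by
  obtain ⟨c, k, h⟩ := hg
  refine ⟨c + 1, m * k, fun K M N y hK hM hN hy hNy => ?_⟩
  calc g N ≤ c * N ^ k := h N hN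
    _ ≤ c * (y ^ m) ^ k := by gcongr
    _ = c * y ^ (m * k) := by rw [pow_mul]
    _ ≤ c * y ^ (M + 1) := by gcongr <;> omega
    _ < (c + 1) * y ^ (M + 1) := by
        have : 0 < y ^ (M + 1) := by positivity
        nlinarith
    _ ≤ K ^ (M + 1) * y ^ (M + 1) := by
        gcongr
        exact hK.trans (Nat.le_self_pow (by omega) K)
    _ = _ := by rw [mul_pow]

open Classical in
lemma core_bound (d : ℕ) (hd : 4 ≤ d) (ε : ℝ) (hε : 0 < ε) : ∃ C : ℝ, 0 ≤ C ∧
    ∀ f : MvPolynomial (Fin 3) ℤ, Irreducible f → f.totalDegree ≤ d →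
    (∀ i, coeff (Finsupp.single i d) f ≠ 0) → ∀ N : ℕ, 1 ≤ N → ∀ A : Finset (Fin 3 → ℤ),
    (∀ x ∈ A, (∀ i, |x i| ≤ N) ∧ eval x f = 0 ∧ ¬ OnLine f N x) →
    (A.card : ℝ) ≤ C * (N : ℝ) ^ (1 + ε) := by
  obtain ⟨n, hn1, hn⟩ : ∃ n : ℕ, 1 ≤ n ∧ 2 / (n : ℝ) ≤ ε := by
    obtain ⟨n, hn⟩ := exists_nat_gt (2 / ε)
    have h0 : 0 < 2 / ε := by positivity
    have hn0 : (0 : ℝ) < n := h0.trans hn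
    refine ⟨n, by exact_mod_cast hn0, ?_⟩
    rw [div_lt_iff₀ hε] at hn
    rw [div_le_iff₀ hn0]; linarith
  obtain ⟨K1', M1, h1⟩ := ((PBd_SB 3 d).mul (PBd_PB 3 d (PBd_SB 3 d))).lt (2 * n)
  obtain ⟨K2, M2, h2⟩ := (PBd_PB 2 (DD d n) (PBd_SB 2 (DD d n))).lt (2 * n)
  obtain ⟨fac, hfac⟩ : ∃ fac : ℕ, fac = (2 * (2 * n + 1) * (2 * n + 2)).factorial := ⟨_, rfl⟩
  obtain ⟨K, hK⟩ : ∃ K : ℕ, K = K1' + K2 + fac + 1 := ⟨_, rfl⟩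
  obtain ⟨M, hM⟩ : ∃ M : ℕ, M = M1 + M2 := ⟨_, rfl⟩
  obtain ⟨T, hT⟩ : ∃ T : ℕ, T = n + 1 + 2 * M := ⟨_, rfl⟩
  obtain ⟨V, hV⟩ : ∃ V : ℕ, V = 9 * K1 d (DD d n) + d * DD d n ^ 3 := ⟨_, rfl⟩
  obtain ⟨W, hW⟩ : ∃ W : ℕ, W = (2 ^ T * 2 ^ T) * (V * (d * (2 ^ T * K) ^ 2) ^ (n + 2)) := ⟨_, rfl⟩
  obtain ⟨W2, hW2⟩ : ∃ W2 : ℕ, W2 = d * ((2 * d + 1) * d * 3) := ⟨_, rfl⟩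
  refine ⟨(W : ℝ) * 2 ^ (2 * n + 4) + W2 + W2, by positivity, ?_⟩
  intro f hf hfd hlc N hN A hA
  have hN1 : (1 : ℝ) ≤ N := by exact_mod_cast hN
  have hNe : (N : ℝ) ≤ (N : ℝ) ^ (1 + ε) := by
    conv_lhs => rw [← Real.rpow_one (N : ℝ)]
    exact Real.rpow_le_rpow_of_exponent_le hN1 (by linarith)
  have hNe0 : (0 : ℝ) ≤ (N : ℝ) ^ (1 + ε) := by positivity
  have hlin : ∀ (g : MvPolynomial (Fin 3) ℤ), ¬ f ∣ g → g.totalDegree ≤ d →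
      ∀ A' : Finset (Fin 3 → ℤ), A' ⊆ A → (∀ x ∈ A', eval x g = 0) →
      (A'.card : ℝ) ≤ W2 * (N : ℝ) ^ (1 + ε) := by
    intro g hg hgd A' hA' hz
    have h3 := surf_card N d d f g hf hg hfd hgd hfd (hlc 2) A'
      (fun x hx => ⟨(hA x (hA' hx)).2.1, hz x hx, (hA x (hA' hx)).1⟩)
    have h4 : A'.card ≤ W2 * N := h3.trans (by
      calc d * ((2 * d + 1) * d * (2 * N + 1)) ≤ d * ((2 * d + 1) * d * (3 * N)) := by
            gcongr; omega
        _ = W2 * N := by rw [hW2]; ring)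
    calc (A'.card : ℝ) ≤ W2 * N := by exact_mod_cast h4
      _ ≤ _ := by gcongr
  rcases small_or 3 d N hN f hf hfd with ⟨g, hgd, hfg, hg⟩ | hsmall
  · refine (hlin g hfg hgd A subset_rfl (fun x hx => hg x (hA x hx).1 (hA x hx).2.1)).trans ?_
    gcongr
    have : (0 : ℝ) ≤ (W : ℝ) * 2 ^ (2 * n + 4) := by positivity
    have : (0 : ℝ) ≤ (W2 : ℝ) := by positivity
    linarith
  obtain ⟨y, hy1, hy2, hy3⟩ := root_exists (2 * n) N (by omega) hN
  have hKpos : 1 ≤ K := by omega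
  obtain ⟨P, hPc, hP⟩ := primes_exist T (K * y) (Nat.mul_pos hKpos hy1)
  have hKy : K ≤ K * y := by nlinarith
  have hfpos : 1 ≤ f.totalDegree := by
    have := deg_le_of_coeff f _ (hlc 2)
    simp at this; omega
  have hpd : pderiv 2 f ≠ 0 := by
    intro h0
    have h3 : coeff (Finsupp.single 2 (d - 1)) (pderiv 2 f) = 0 := by rw [h0]; simp
    rw [coeff_pderiv, ← Finsupp.single_add, show d - 1 + 1 = d by omega] at h3
    simp only [Finsupp.single_eq_same, mul_eq_zero] at h3
    rcases h3 with h3 | h3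
    · exact hlc 2 h3
    · omega
  have hA1 := hlin (pderiv 2 f) (not_dvd_pderiv f hfpos 2 hpd)
    ((pderiv_totalDegree 2 f).trans (by omega)) (A.filter fun x => eval x (pderiv 2 f) = 0)
    (Finset.filter_subset _ _) (fun x hx => (Finset.mem_filter.1 hx).2)
  have hA2 := core n d M N (K * y) (2 ^ T * (K * y)) hn1 hd f hf hfd hlc P hP (by omega) hN
    (hy2.trans (Nat.pow_le_pow_left (by nlinarith) _)) (by rw [← hfac]; omega) hsmall
    (h1 K M N y (by omega) (by omega) hN hy1 hy2) (h2 K M N y (by omega) (by omega) hN hy1 hy2)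
    (A.filter fun x => ¬ eval x (pderiv 2 f) = 0) (fun x hx => by
      have h3 := Finset.mem_filter.1 hx
      have h4 := hA x h3.1
      exact ⟨h4.1, h4.2.1, h3.2, h4.2.2⟩)
  have hyr : (y : ℝ) ≤ 2 * (N : ℝ) ^ (1 / (2 * n : ℝ)) := by
    have h3 : (y : ℝ) ^ (2 * n) ≤ 2 ^ (2 * n) * N := by exact_mod_cast hy3
    have h4 : ((2 : ℝ) * (N : ℝ) ^ (1 / (2 * n : ℝ))) ^ (2 * n) = 2 ^ (2 * n) * N := by
      rw [mul_pow, ← Real.rpow_mul_natCast (by positivity)]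
      congr 1
      push_cast
      rw [one_div, inv_mul_cancel₀ (by positivity), Real.rpow_one]
    rw [← h4] at h3
    exact le_of_pow_le_pow_left₀ (by omega) (by positivity) h3
  have hA3 : ((A.filter fun x => ¬ eval x (pderiv 2 f) = 0).card : ℝ) ≤
      W * 2 ^ (2 * n + 4) * (N : ℝ) ^ (1 + ε) := by
    have h3 : (A.filter fun x => ¬ eval x (pderiv 2 f) = 0).card ≤ W * y ^ (2 * n + 4) := by
      refine hA2.trans (le_of_eq ?_)
      rw [hPc, hW, ← hV, show (d * (2 ^ T * (K * y)) ^ 2) = (d * (2 ^ T * K) ^ 2) * y ^ 2 by ring, mul_pow _ (y ^ 2), ← pow_mul y]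
      rw [show 2 * (n + 2) = 2 * n + 4 by ring]
      simp only [mul_assoc]
    calc ((A.filter fun x => ¬ eval x (pderiv 2 f) = 0).card : ℝ) ≤ W * y ^ (2 * n + 4) := by
          exact_mod_cast h3
      _ ≤ W * (2 * (N : ℝ) ^ (1 / (2 * n : ℝ))) ^ (2 * n + 4) := by gcongr
      _ = W * 2 ^ (2 * n + 4) * (N : ℝ) ^ (1 + 2 / (n : ℝ)) := by
          rw [mul_pow, ← Real.rpow_mul_natCast (by positivity), mul_assoc]
          congr 3
          have : (0 : ℝ) < n := by exact_mod_cast hn1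
          push_cast
          field_simp
          ring
      _ ≤ _ := by
          gcongr
  have h5 := Finset.card_filter_add_card_filter_not (s := A) (fun x => eval x (pderiv 2 f) = 0)
  have h6 : (A.card : ℝ) = ((A.filter fun x => eval x (pderiv 2 f) = 0).card : ℝ) +
      ((A.filter fun x => ¬ eval x (pderiv 2 f) = 0).card : ℝ) := by exact_mod_cast h5.symm
  have : (0 : ℝ) ≤ W2 * (N : ℝ) ^ (1 + ε) := by positivity
  rw [h6]
  linarith


lemma coeff_prod_deg {ι : Type*} (s : Finset ι) (p : ι → Polynomial ℤ) (m : ι → ℕ)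
    (h : ∀ i, (p i).natDegree ≤ m i) :
    (∏ i ∈ s, p i).natDegree ≤ ∑ i ∈ s, m i ∧
    (∏ i ∈ s, p i).coeff (∑ i ∈ s, m i) = ∏ i ∈ s, (p i).coeff (m i) := by
  classical
  induction s using Finset.induction_on with
  | empty => simp
  | insert a s ha ih =>
    rw [Finset.prod_insert ha, Finset.sum_insert ha, Finset.prod_insert ha]
    refine ⟨Polynomial.natDegree_mul_le_of_le (h a) ih.1, ?_⟩
    rw [Polynomial.coeff_mul_add_eq_of_natDegree_le (h a) ih.1, ih.2]

lemma coeff_line {n : ℕ} (d : ℕ) (f : MvPolynomial (Fin n) ℤ) (hf : f.IsHomogeneous d)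
    (x v : Fin n → ℤ) :
    (aeval (fun i => Polynomial.C (x i) + Polynomial.X * Polynomial.C (v i)) f :
      Polynomial ℤ).coeff d = eval v f := by
  rw [aeval_def, eval₂_eq', eval_eq', Polynomial.finset_sum_coeff]
  refine Finset.sum_congr rfl fun α hα => ?_
  rw [show algebraMap ℤ (Polynomial ℤ) (coeff α f) = Polynomial.C (coeff α f) from rfl,
    Polynomial.coeff_C_mul]
  congr 1
  have hd : d = ∑ i, α i := by
    rw [← hf (mem_support_iff.1 hα)]
    simp [Finsupp.weight_apply, Finsupp.sum_fintype]
  have h1 : ∀ i, (Polynomial.C (x i) + Polynomial.X * Polynomial.C (v i)).natDegree ≤ 1 := by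
    intro i; compute_degree
  rw [hd, (coeff_prod_deg _ _ _ fun i => ?_).2]
  · refine Finset.prod_congr rfl fun i _ => ?_
    have := Polynomial.coeff_pow_of_natDegree_le (m := α i) (h1 i)
    rw [mul_one] at this
    rw [this]
    rw [Polynomial.coeff_add, Polynomial.coeff_C, Polynomial.coeff_mul_C, Polynomial.coeff_X]; simp
  · refine Polynomial.natDegree_pow_le.trans ?_
    have := h1 i
    nlinarith

lemma pderiv_comm' {n : ℕ} (i j : Fin n) (f : MvPolynomial (Fin n) ℤ) :
    pderiv i (pderiv j f) = pderiv j (pderiv i f) := by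
  ext α
  rw [coeff_pderiv, coeff_pderiv, coeff_pderiv, coeff_pderiv]
  rw [add_right_comm]
  by_cases h : i = j
  · subst h; ring
  · simp [Finsupp.single_eq_of_ne h, Finsupp.single_eq_of_ne (Ne.symm h)]; ring

/-- the derivative in direction `v` -/
noncomputable def Dv (v : Fin 3 → ℤ) (f : MvPolynomial (Fin 3) ℤ) : MvPolynomial (Fin 3) ℤ :=
  ∑ j, C (v j) * pderiv j f

lemma eval_Dv (v x : Fin 3 → ℤ) (f : MvPolynomial (Fin 3) ℤ) :
    eval x (Dv v f) = ∑ j, v j * eval x (pderiv j f) := by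
  simp [Dv]

lemma Dv_deg (v : Fin 3 → ℤ) (f : MvPolynomial (Fin 3) ℤ) :
    (Dv v f).totalDegree ≤ f.totalDegree - 1 := by
  refine totalDegree_finsetSum_le fun j _ => ?_
  refine (totalDegree_mul _ _).trans ?_
  rw [totalDegree_C, zero_add]
  exact pderiv_totalDegree j f

lemma Dv_ne (d : ℕ) (hd : 2 ≤ d) (v : Fin 3 → ℤ) (f φ : MvPolynomial (Fin 3) ℤ) (hφ : φ.IsHomogeneous d)
    (hfφ : (f - φ).totalDegree < d) (hv : ∃ j, eval v (pderiv j φ) ≠ 0) : Dv v f ≠ 0 := by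
  intro h0
  have h1 : Dv v (f - φ) = - Dv v φ := by
    have : Dv v (f - φ) = Dv v f - Dv v φ := by
      simp only [Dv, map_sub, mul_sub, Finset.sum_sub_distrib]
    rw [this, h0, zero_sub]
  have h2 : (Dv v φ).IsHomogeneous (d - 1) := by
    refine IsHomogeneous.sum _ _ _ fun j _ => ?_
    have := (isHomogeneous_C (Fin 3) (v j)).mul (hφ.pderiv (i := j))
    rwa [zero_add] at this
  have h3 : Dv v φ = 0 := by
    by_contra hne
    have h4 := h2.totalDegree hne
    have h5 := Dv_deg v (f - φ)
    rw [h1, totalDegree_neg, h4] at h5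
    by_cases h6 : (f - φ).totalDegree = 0
    · omega
    · omega
  obtain ⟨i, hi⟩ := hv
  apply hi
  have h4 : eval v (pderiv i (Dv v φ)) = 0 := by rw [h3]; simp
  have h5 : pderiv i (Dv v φ) = ∑ j, C (v j) * pderiv j (pderiv i φ) := by
    rw [Dv, map_sum]
    refine Finset.sum_congr rfl fun j _ => ?_
    rw [pderiv_C_mul, pderiv_comm']
  rw [h5] at h4
  have h6 := congrArg (eval v) (hφ.pderiv (i := i)).sum_X_mul_pderiv
  simp only [map_sum, map_mul, eval_X, eval_C, map_nsmul] at h4 h6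
  rw [h4] at h6
  rw [nsmul_eq_mul] at h6
  rcases mul_eq_zero.1 h6.symm with h | h
  · exfalso; have : (d - 1 : ℕ) = 0 := by exact_mod_cast h
    omega
  · exact h

lemma Dv_zero (f : MvPolynomial (Fin 3) ℤ) (x v : Fin 3 → ℤ)
    (h : ∀ t : ℤ, eval (fun i => x i + t * v i) f = 0) (t : ℤ) :
    eval (fun i => x i + t * v i) (Dv v f) = 0 := by
  rw [eval_Dv]
  set x' : Fin 3 → ℤ := fun i => x i + t * v i
  set a := ∑ j, v j * eval x' (pderiv j f)
  by_contra ha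
  have h0 : eval x' f = 0 := h t
  obtain ⟨k, hk⟩ := taylor1 f x' v (|a| + 1)
  have h1 : eval (fun i => x' i + (|a| + 1) * v i) f = 0 := by
    have := h (t + (|a| + 1))
    rw [← this]; congr 2; funext i; simp only [x']; ring
  rw [h1, h0, zero_add] at hk
  have h2 : (|a| + 1) ∣ a := by
    have h3 : (|a| + 1) * (a + (|a| + 1) * k) = 0 := by linarith
    rcases mul_eq_zero.1 h3 with h4 | h4
    · have := abs_nonneg a; omega
    · exact ⟨-k, by linarith⟩
  have := Int.le_of_dvd (abs_pos.2 ha) ((dvd_abs _ _).2 h2)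
  omega

lemma line_rat (f : MvPolynomial (Fin 3) ℤ) (x v : Fin 3 → ℤ)
    (h : ∀ t : ℤ, eval (fun i => x i + t * v i) f = 0) (q : ℚ) :
    aeval (fun i => (x i : ℚ) + q * v i) f = 0 := by
  have h1 : (aeval (fun i => Polynomial.C (x i) + Polynomial.X * Polynomial.C (v i)) f :
      Polynomial ℤ) = 0 := Polynomial.funext fun t => by rw [eval_line, h]; simp
  have h2 := congrArg (Polynomial.aeval q) h1
  rw [map_zero] at h2
  rw [← h2]
  have := MvPolynomial.comp_aeval_apply (R := ℤ) (fun i => Polynomial.C (x i) + Polynomial.X * Polynomial.C (v i))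
    (Polynomial.aeval (R := ℤ) q) f
  rw [this]
  congr 2
  funext i
  simp

lemma ratio_set (R : MvPolynomial (Fin 2) ℤ) (hR : R ≠ 0) (D : ℕ) (hD : R.totalDegree ≤ D)
    (a b : Fin 2) (hab : a ≠ b) : ∃ Z : Finset ℚ, Z.card ≤ D ∧ ∃ c0 : ℚ, c0 ≠ 0 ∧
      ∀ u : Fin 2 → ℚ, aeval u R = 0 → u a = c0 → u b ∈ Z := by
  classical
  obtain ⟨y, hy⟩ : ∃ y : Fin 2 → ℤ, eval y (R * X a) ≠ 0 := by
    by_contra hh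
    push Not at hh
    have : R * X a = 0 := MvPolynomial.funext fun y => by rw [hh y]; simp
    rcases mul_eq_zero.1 this with h | h
    · exact hR h
    · exact X_ne_zero a h
  rw [map_mul, eval_X] at hy
  set x : Fin 2 → ℤ := fun k => if k = a then y a else 0
  set v : Fin 2 → ℤ := fun k => if k = a then 0 else 1
  set Q : Polynomial ℤ := aeval (fun i => Polynomial.C (x i) + Polynomial.X * Polynomial.C (v i)) R with hQ
  have hQ0 : Q ≠ 0 := by
    intro h0
    have h1 := eval_line R x v (y b)
    rw [← hQ, h0] at h1
    have h2 : (fun i => x i + y b * v i) = y := by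
      funext k
      by_cases hk : k = a
      · simp [x, v, hk]
      · have : k = b := by omega
        simp [x, v, hk, this, hab.symm]
    rw [h2] at h1
    apply hy
    rw [← h1]; simp
  refine ⟨(Q.aroots ℚ).toFinset, ?_, (y a : ℚ), ?_, ?_⟩
  · refine (Multiset.toFinset_card_le _).trans ((Polynomial.card_roots' _).trans ?_)
    exact (Polynomial.natDegree_map_le).trans ((natDegree_aeval_le R x v).trans hD)
  · have : y a ≠ 0 := fun h => hy (by rw [h]; simp)
    exact_mod_cast this
  · intro u hu hua
    rw [Multiset.mem_toFinset, Polynomial.mem_aroots]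
    refine ⟨hQ0, ?_⟩
    have := MvPolynomial.comp_aeval_apply (R := ℤ) (fun i => Polynomial.C (x i) + Polynomial.X * Polynomial.C (v i))
      (Polynomial.aeval (R := ℤ) (u b)) R
    rw [hQ, this, ← hu]
    congr 2
    funext k
    by_cases hk : k = a
    · simp [x, v, hk, hua]
    · have : k = b := by omega
      simp [x, v, hk, this, hab.symm]


/-- values of a 2x2 minor -/
lemma minor_set (D : ℕ) (hD1 : 1 ≤ D) (f g : MvPolynomial (Fin 3) ℤ) (hf : Irreducible f) (hfg : ¬ f ∣ g)
    (hfD : f.totalDegree ≤ D) (hgD : g.totalDegree ≤ D) (v : Fin 3 → ℤ) (i j : Fin 3)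
    (hvi : v i ≠ 0) : ∃ Z : Finset ℚ, Z.card ≤ (2 * D + 1) * D ∧ ∀ x : Fin 3 → ℤ,
      (∀ q : ℚ, aeval (fun i => (x i : ℚ) + q * v i) f = 0) →
      (∀ q : ℚ, aeval (fun i => (x i : ℚ) + q * v i) g = 0) →
      ((x j * v i - x i * v j : ℤ) : ℚ) ∈ Z := by
  classical
  by_cases hij : j = i
  · refine ⟨{0}, ?_, fun x _ _ => by rw [hij]; simp⟩
    rw [Finset.card_singleton]; nlinarith
  obtain ⟨k, hki, hkj⟩ : ∃ k : Fin 3, i ≠ k ∧ j ≠ k := by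
    have : ∀ i j : Fin 3, ∃ k : Fin 3, i ≠ k ∧ j ≠ k := by decide
    exact this i j
  obtain ⟨a, ha⟩ := Fin.exists_succAbove_eq hki
  obtain ⟨b, hb⟩ := Fin.exists_succAbove_eq hkj
  have hab : a ≠ b := by rintro rfl; exact hij (hb.symm.trans ha)
  obtain ⟨R, hR, hRd, hz⟩ := elim 2 k D f g hf hfg hfD hgD
  obtain ⟨Z, hZ, c0, -, hc⟩ := ratio_set R hR _ hRd a b hab
  refine ⟨Z.image fun w => w * v i - c0 * v j, Finset.card_image_le.trans hZ, ?_⟩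
  intro x h1 h2
  have hviq : (v i : ℚ) ≠ 0 := by exact_mod_cast hvi
  have h3 := hz _ (h1 ((c0 - x i) / v i)) (h2 ((c0 - x i) / v i))
  have h4 := hc _ h3 (by simp only [ha]; field_simp; ring)
  rw [Finset.mem_image]
  refine ⟨_, h4, ?_⟩
  simp only [hb]
  push_cast
  field_simp
  ring

lemma lines_dir (d N : ℕ) (hd : 4 ≤ d) (f φ : MvPolynomial (Fin 3) ℤ) (hf : Irreducible f)
    (hfd : f.totalDegree = d)
    (hφ : φ.IsHomogeneous d) (hfφ : (f - φ).totalDegree < d) (v : Fin 3 → ℤ)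
    (hv : ∃ j, eval v (pderiv j φ) ≠ 0) (hv1 : Finset.univ.gcd v = 1) (i : Fin 3) (hvi : v i ≠ 0)
    (A : Finset (Fin 3 → ℤ)) (hA : ∀ x ∈ A, (∀ i, |x i| ≤ N) ∧
      ∀ t : ℤ, eval (fun i => x i + t * v i) f = 0) :
    A.card ≤ (2 * (2 * N / (v i).natAbs) + 1) * ((2 * d + 1) * d) ^ 3 := by
  classical
  have hne := Dv_ne d (by omega) v f φ hφ hfφ hv
  have hDd := Dv_deg v f
  have hfg : ¬ f ∣ Dv v f := by
    intro h
    have := totalDegree_le_of_dvd_of_isDomain h hne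
    omega
  choose Z hZc hZ using fun j => minor_set d (by omega) f (Dv v f) hf hfg hfd.le (by omega) v i j hvi
  refine (card_le_fibre A (fun x j => ((x j * v i - x i * v j : ℤ) : ℚ))
    (2 * (2 * N / (v i).natAbs) + 1) ?_ (Fintype.piFinset Z) ?_).trans ?_
  · intro s A' hA' hs
    rcases A'.eq_empty_or_nonempty with rfl | ⟨x0, hx0⟩
    · simp
    have hpar : ∀ x ∈ A', ∃ t : ℤ, ∀ k, x k - x0 k = t * v k := by
      intro x hx
      refine prim_par v (fun k => x k - x0 k) hv1 ?_
      have h1 : ∀ j, (x j - x0 j) * v i = (x i - x0 i) * v j := by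
        intro j
        have h2 := congrFun ((hs x hx).trans (hs x0 hx0).symm) j
        have h3 : x j * v i - x i * v j = x0 j * v i - x0 i * v j := by exact_mod_cast h2
        linarith
      intro k j
      apply mul_left_cancel₀ hvi
      linear_combination v k * h1 j - v j * h1 k
    choose! t ht using hpar
    have hcard : (Finset.Icc (-((2 * N / (v i).natAbs : ℕ) : ℤ)) ((2 * N / (v i).natAbs : ℕ) : ℤ)).card =
        2 * (2 * N / (v i).natAbs) + 1 := by
      rw [Int.card_Icc]; omega
    rw [← hcard]
    refine Finset.card_le_card_of_injOn t ?_ ?_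
    · intro x hx
      have h1 := (hA x (hA' hx)).1 i
      have h2 := (hA x0 (hA' hx0)).1 i
      have h3 := ht x hx i
      have h4 : (t x).natAbs * (v i).natAbs ≤ 2 * N := by
        rw [← Int.natAbs_mul, ← h3]
        rw [abs_le] at h1 h2
        omega
      have h5 := (Nat.le_div_iff_mul_le (Int.natAbs_pos.2 hvi)).2 h4
      simp only [Finset.coe_Icc, Set.mem_Icc]
      omega
    · intro x hx x' hx' h
      funext k
      have a := ht x hx k
      have b := ht x' hx' k
      rw [h] at a
      omega
  · intro x hx
    rw [Fintype.mem_piFinset]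
    intro j
    have h1 := (hA x hx).2
    exact hZ j x (line_rat f x v h1) (line_rat _ x v (Dv_zero f x v h1))
  · gcongr
    rw [Fintype.card_piFinset]
    refine (Finset.prod_le_prod' fun j _ => hZc j).trans ?_
    simp

lemma modp_count2 (d p : ℕ) [Fact p.Prime] (f : MvPolynomial (Fin 2) ℤ)
    (hfd : f.totalDegree ≤ d) (hlc : ¬ (p : ℤ) ∣ coeff (Finsupp.single 1 d) f) :
    ∃ B : Finset (Fin 2 → ZMod p), B.card ≤ d * p ∧
      ∀ x : Fin 2 → ZMod p, aeval x f = 0 → x ∈ B := by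
  classical
  refine ⟨Finset.univ.filter fun x => aeval x f = 0, ?_, fun x hx => by simpa using hx⟩
  have := card_le_fibre (Finset.univ.filter fun x : Fin 2 → ZMod p => aeval x f = 0)
    (fun x j => x ((1 : Fin 2).succAbove j)) d ?_ Finset.univ (fun _ _ => Finset.mem_univ _)
  · refine this.trans ?_
    rw [Finset.card_univ, Fintype.card_fun, ZMod.card, Fintype.card_fin, pow_one]
  · intro y A' hA' hy
    obtain ⟨Z, hc, hZ⟩ := fibre (A := ZMod p) 1 d 1 f hfd (by
      rwa [Ne, ZMod.intCast_zmod_eq_zero_iff_dvd]) y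
    refine le_trans (Finset.card_le_card_of_injOn (fun x => x 1) ?_ ?_) hc
    · intro x hx
      exact hZ x (fun j => congrFun (hy x hx) j) (Finset.mem_filter.1 (hA' hx)).2
    · intro x hx x' hx' h
      funext i
      rcases Fin.eq_self_or_eq_succAbove 1 i with rfl | ⟨j, rfl⟩
      · exact h
      · exact (congrFun (hy x hx) j).trans (congrFun (hy x' hx') j).symm

/-- dehomogenisation -/
noncomputable def dhv : Fin 3 → MvPolynomial (Fin 2) ℤ := ![X 0, X 1, 1]
noncomputable def dh (φ : MvPolynomial (Fin 3) ℤ) : MvPolynomial (Fin 2) ℤ := aeval dhv φ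

lemma aeval_dh {S : Type*} [CommRing S] (φ : MvPolynomial (Fin 3) ℤ) (x : Fin 2 → S) :
    aeval x (dh φ) = aeval ![x 0, x 1, 1] φ := by
  rw [dh, MvPolynomial.comp_aeval_apply]
  congr 2
  funext i
  fin_cases i <;> simp [dhv]

lemma eval_dh (φ : MvPolynomial (Fin 3) ℤ) (x : Fin 2 → ℤ) :
    eval x (dh φ) = eval ![x 0, x 1, 1] φ := by
  have := aeval_dh φ x
  rwa [aeval_eq_eval, aeval_eq_eval] at this

lemma pderiv_dh (φ : MvPolynomial (Fin 3) ℤ) : pderiv 1 (dh φ) = dh (pderiv 1 φ) := by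
  unfold dh
  induction φ using MvPolynomial.induction_on with
  | C a => simp
  | add p q hp hq => rw [map_add, map_add, map_add, map_add, hp, hq]
  | mul_X p i hp =>
    rw [map_mul, pderiv_mul, pderiv_mul, map_add, map_mul, map_mul, hp, aeval_X]
    congr 2
    fin_cases i
    · simp [dhv, pderiv_X]
    · simp [dhv, pderiv_X]
    · simp [dhv, pderiv_X]

lemma dh_deg (φ : MvPolynomial (Fin 3) ℤ) : (dh φ).totalDegree ≤ φ.totalDegree := by
  rw [dh, aeval_def, eval₂_eq']
  refine totalDegree_finsetSum_le fun α hα => ?_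
  refine (totalDegree_mul _ _).trans ?_
  rw [show algebraMap ℤ (MvPolynomial (Fin 2) ℤ) (coeff α φ) = C (coeff α φ) from rfl,
    totalDegree_C, zero_add]
  refine (totalDegree_finsetProd _ _).trans ?_
  refine le_trans (Finset.sum_le_sum (g := fun i => α i) fun i _ => ?_) ?_
  · refine (totalDegree_pow _ _).trans ?_
    have : (dhv i).totalDegree ≤ 1 := by fin_cases i <;> simp [dhv]
    nlinarith
  · have := le_totalDegree hα
    rwa [Finsupp.sum_fintype _ _ (by simp)] at this

lemma dh_coeff (d : ℕ) (φ : MvPolynomial (Fin 3) ℤ) (hφ : φ.IsHomogeneous d) :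
    coeff (Finsupp.single 1 d) (dh φ) = coeff (Finsupp.single 1 d) φ := by
  have h1 : ∀ α : Fin 3 →₀ ℕ, ∏ i, dhv i ^ α i =
      monomial (Finsupp.single 0 (α 0) + Finsupp.single 1 (α 1)) 1 := by
    intro α
    rw [Fin.prod_univ_three]
    simp only [dhv]
    simp [X_pow_eq_monomial, monomial_mul]
  rw [dh, aeval_def, eval₂_eq', coeff_sum]
  rw [Finset.sum_eq_single (Finsupp.single 1 d)]
  · rw [h1, show algebraMap ℤ (MvPolynomial (Fin 2) ℤ) = C from rfl, coeff_C_mul, coeff_monomial]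
    simp
  · intro α hα hne
    rw [h1, show algebraMap ℤ (MvPolynomial (Fin 2) ℤ) = C from rfl, coeff_C_mul, coeff_monomial, if_neg, mul_zero]
    intro h
    apply hne
    have h2 := DFunLike.congr_fun h 0
    have h3 := DFunLike.congr_fun h 1
    simp at h2 h3
    have hd : α 0 + α 1 + α 2 = d := by
      rw [← hφ (mem_support_iff.1 hα)]
      simp [Finsupp.weight_apply, Finsupp.sum_fintype, Fin.sum_univ_three]
    refine Finsupp.ext fun i => ?_
    fin_cases i
    · simpa using h2
    · simpa using h3
    · simp; omega
  · intro h
    rw [notMem_support_iff.1 h]; simp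


lemma eval_scale {n : ℕ} (d : ℕ) (f : MvPolynomial (Fin n) ℤ) (hf : f.IsHomogeneous d) (x : Fin n → ℤ)
    (c : ℤ) : eval (fun i => c * x i) f = c ^ d * eval x f := by
  rw [eval_eq', eval_eq', Finset.mul_sum]
  refine Finset.sum_congr rfl fun α hα => ?_
  have hd : d = ∑ i, α i := by
    rw [← hf (mem_support_iff.1 hα)]
    simp [Finsupp.weight_apply, Finsupp.sum_fintype]
  simp only [mul_pow]
  rw [Finset.prod_mul_distrib, Finset.prod_pow_eq_pow_sum, ← hd]
  ring

lemma cone_det (d p : ℕ) (hp : p.Prime) (φ : MvPolynomial (Fin 3) ℤ) (hφ : φ.IsHomogeneous d)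
    (r : Fin 3 → Fin 3 → ℤ) (h0 : ∀ a, eval (r a) φ = 0) (h2 : ∀ a, ¬ (p : ℤ) ∣ r a 2)
    (h3 : ¬ (p : ℤ) ∣ eval (r 0) (pderiv 1 φ))
    (hc : ∀ a i, (p : ℤ) ∣ r a i * r 0 2 - r 0 i * r a 2) :
    (p : ℤ) ^ 3 ∣ Matrix.det (Matrix.of r) := by
  have hpi := Nat.prime_iff_prime_int.1 hp
  have hz : ∀ a, ∃ u w : ℤ, u * r a 2 + w * (p : ℤ) ^ 3 = 1 := by
    intro a
    have := (hpi.coprime_iff_not_dvd.2 (h2 a)).pow_left (m := 3)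
    obtain ⟨w, u, h⟩ := this
    exact ⟨u, w, by linarith⟩
  choose u w huw using hz
  have hpu : ∀ a, ¬ (p : ℤ) ∣ u a := by
    intro a h
    apply hpi.not_dvd_one
    rw [← huw a]
    exact dvd_add (h.mul_right _) ((dvd_pow_self _ (by norm_num)).mul_left _)
  have hpp : (p : ℤ) ∣ (p : ℤ) ^ 3 := dvd_pow_self _ (by norm_num)
  set x : Fin 3 → Fin 2 → ℤ := fun a => ![u a * r a 0, u a * r a 1] with hx
  have hcl : ∀ a i, (p : ℤ) ^ 3 ∣ (![x a 0, x a 1, 1] : Fin 3 → ℤ) i - u a * r a i := by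
    intro a i
    fin_cases i
    · simp [hx]
    · simp [hx]
    · refine ⟨w a, ?_⟩
      have := huw a
      simp
      linarith
  have hdd := det_dvd (ι := Fin 3) (m := 1) (dh φ) 1 (p : ℤ) 3 (x 0) ?_ ?_ dhv x ?_ ?_
  · have h5 := det_congr (Matrix.of fun a b => eval (x a) (dhv b)) (Matrix.of fun a b => u a * r a b)
      ((p : ℤ) ^ 3) (by
        intro a b
        have := hcl a b
        fin_cases b <;> simpa [dhv] using this)
    have h6 := (dvd_sub_right hdd).1 h5
    rw [show (Matrix.of fun a b => u a * r a b) = Matrix.of (fun a b => u a * (Matrix.of r) a b) from rfl,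
      Matrix.det_mul_column] at h6
    refine IsCoprime.dvd_of_dvd_mul_left ?_ h6
    refine IsCoprime.prod_right fun a _ => ?_
    exact (hpi.coprime_iff_not_dvd.2 (hpu a)).pow_left
  · rw [pderiv_dh, eval_dh]
    refine (hpi.coprime_iff_not_dvd.2 fun hd => ?_).symm
    have h4 := eval_congr_dvd (pderiv 1 φ) ![x 0 0, x 0 1, 1] (fun i => u 0 * r 0 i) (p : ℤ)
      (fun i => hpp.trans (hcl 0 i))
    have h5 := (dvd_sub_right hd).1 h4
    rw [eval_scale _ _ hφ.pderiv] at h5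
    rcases hpi.dvd_or_dvd h5 with h | h
    · exact hpu 0 (hpi.dvd_of_dvd_pow h)
    · exact h3 h
  · intro σ hσ
    have := inj_bound1 σ hσ
    simpa using this
  · intro a i
    have key : ∀ i : Fin 3, (p : ℤ) ∣ u a * r a i - u 0 * r 0 i := by
      intro i
      have e : u a * r a i - u 0 * r 0 i = u a * u 0 * (r a i * r 0 2 - r 0 i * r a 2) +
          (p : ℤ) ^ 3 * (u a * r a i * w 0 - u 0 * r 0 i * w a) := by
        linear_combination (-u a * r a i) * huw 0 + (u 0 * r 0 i) * huw a
      rw [e]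
      exact dvd_add ((hc a i).mul_left _) (hpp.mul_right _)
    fin_cases i
    · exact key 0
    · exact key 1
  · intro a
    rw [eval_dh]
    have h4 := eval_congr_dvd φ ![x a 0, x a 1, 1] (fun i => u a * r a i) ((p : ℤ) ^ 3) (hcl a)
    rwa [eval_scale _ _ hφ, h0, mul_zero, sub_zero] at h4

lemma cone_lin (d : ℕ) (hd : 2 ≤ d) (φ : MvPolynomial (Fin 3) ℤ) (hφ : φ.IsHomogeneous d)
    (hirr : Irreducible φ) (c : Fin 3 → ℤ) (hc : c ≠ 0) (A : Finset (Fin 3 → ℤ))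
    (hA : ∀ v ∈ A, Finset.univ.gcd v = 1 ∧ eval v φ = 0 ∧ v 2 ≠ 0 ∧ ∑ j, c j * v j = 0) :
    A.card ≤ 2 * ((2 * d + 1) * d) ^ 2 := by
  classical
  have hφ0 := hirr.ne_zero
  have hφd := hφ.totalDegree hφ0
  set ℓ : MvPolynomial (Fin 3) ℤ := ∑ j, C (c j) * X j with hℓ
  have hℓd : ℓ.totalDegree ≤ 1 := by
    refine totalDegree_finsetSum_le fun j _ => ?_
    refine (totalDegree_mul _ _).trans ?_
    rw [totalDegree_C, totalDegree_X]
  have hℓ0 : ℓ ≠ 0 := by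
    intro h
    apply hc
    funext i
    have := congrArg (eval (Pi.single i 1)) h
    simpa [hℓ, Pi.single_apply] using this
  have hnd : ¬ φ ∣ ℓ := by
    intro h
    have := totalDegree_le_of_dvd_of_isDomain h hℓ0
    omega
  have hratio : ∀ k : Fin 2, ∃ Z : Finset ℚ, Z.card ≤ (2 * d + 1) * d ∧ ∀ v ∈ A,
      ((v (Fin.castSucc k) : ℚ) / v 2) ∈ Z := by
    intro k
    obtain ⟨m, hm1, hm2⟩ : ∃ m : Fin 3, (2 : Fin 3) ≠ m ∧ Fin.castSucc k ≠ m := by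
      revert k; decide
    obtain ⟨a, ha⟩ := Fin.exists_succAbove_eq hm1
    obtain ⟨b, hb⟩ := Fin.exists_succAbove_eq hm2
    have hab : a ≠ b := by
      rintro rfl
      have := ha.symm.trans hb
      revert this; fin_cases k <;> decide
    obtain ⟨R, hR, hRd, hz⟩ := elim 2 m d φ ℓ hirr hnd hφd.le (by omega)
    obtain ⟨Z, hZ, c0, hc0, hcz⟩ := ratio_set R hR _ hRd a b hab
    refine ⟨Z.image fun w => w / c0, Finset.card_image_le.trans hZ, ?_⟩
    intro v hv
    obtain ⟨-, hv1, hv2, hv3⟩ := hA v hv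
    have hline : ∀ t : ℤ, eval (fun i => (0 : Fin 3 → ℤ) i + t * v i) φ = 0 := by
      intro t
      simp only [Pi.zero_apply, zero_add]
      rw [eval_scale d φ hφ, hv1, mul_zero]
    have hline2 : ∀ t : ℤ, eval (fun i => (0 : Fin 3 → ℤ) i + t * v i) ℓ = 0 := by
      intro t
      simp only [Pi.zero_apply, zero_add, hℓ, map_sum, map_mul, eval_C, eval_X]
      rw [← mul_zero t, ← hv3, Finset.mul_sum]
      exact Finset.sum_congr rfl fun j _ => by ring
    have hv2q : (v 2 : ℚ) ≠ 0 := by exact_mod_cast hv2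
    have h3 := hz _ (line_rat φ 0 v hline (c0 / v 2)) (line_rat ℓ 0 v hline2 (c0 / v 2))
    have h4 := hcz _ h3 (by simp only [ha]; simp; field_simp)
    rw [Finset.mem_image]
    refine ⟨_, h4, ?_⟩
    simp only [hb]
    simp
    field_simp
  choose Z hZc hZ using hratio
  refine (card_le_fibre A (fun v (k : Fin 2) => ((v (Fin.castSucc k) : ℚ) / v 2)) 2 ?_
    (Fintype.piFinset Z) ?_).trans ?_
  · intro s A' hA' hs
    rcases A'.eq_empty_or_nonempty with rfl | ⟨x0, hx0⟩
    · simp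
    have hsub : A' ⊆ {x0, -x0} := by
      intro v hv
      obtain ⟨g1, -, hv2, -⟩ := hA v (hA' hv)
      obtain ⟨g0, -, hx2, -⟩ := hA x0 (hA' hx0)
      have hv2q : (v 2 : ℚ) ≠ 0 := by exact_mod_cast hv2
      have hx2q : (x0 2 : ℚ) ≠ 0 := by exact_mod_cast hx2
      have e : ∀ i : Fin 3, v i * x0 2 = x0 i * v 2 := by
        intro i
        refine Fin.lastCases ?_ (fun k => ?_) i
        · exact mul_comm _ _
        · have := congrFun ((hs v hv).trans (hs x0 hx0).symm) k
          rw [div_eq_div_iff hv2q hx2q] at this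
          exact_mod_cast this
      obtain ⟨s, hs⟩ := prim_par x0 v g0 (by
        intro i j
        apply mul_left_cancel₀ hx2
        linear_combination x0 i * e j - x0 j * e i)
      have hs1 : s ∣ 1 := by
        rw [← g1]
        exact Finset.dvd_gcd fun i _ => ⟨x0 i, hs i⟩
      rw [Finset.mem_insert, Finset.mem_singleton]
      rcases Int.isUnit_iff.1 (isUnit_of_dvd_one hs1) with rfl | rfl
      · left; funext i; rw [hs i]; ring
      · right; funext i; rw [hs i]; simp
    exact (Finset.card_le_card hsub).trans Finset.card_le_two
  · intro v hv
    rw [Fintype.mem_piFinset]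
    exact fun k => hZ k v hv
  · gcongr
    rw [Fintype.card_piFinset]
    refine (Finset.prod_le_prod' fun j _ => hZc j).trans ?_
    simp


lemma cone_p (d H p : ℕ) (hd : 2 ≤ d) (hp : p.Prime) (hHp : 2 * H ≤ p)
    (φ : MvPolynomial (Fin 3) ℤ) (hφ : φ.IsHomogeneous d) (hH : 1 ≤ H)
    (hirr : Irreducible φ) (hlc : ¬ (p : ℤ) ∣ coeff (Finsupp.single 1 d) φ) (A : Finset (Fin 3 → ℤ))
    (hA : ∀ v ∈ A, Finset.univ.gcd v = 1 ∧ (∀ i, |v i| ≤ H) ∧ eval v φ = 0 ∧ ¬ (p : ℤ) ∣ v 2 ∧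
      ¬ (p : ℤ) ∣ eval v (pderiv 1 φ)) :
    A.card ≤ (2 * ((2 * d + 1) * d) ^ 2) * (d * p) := by
  classical
  haveI := Fact.mk hp
  have hφd := hφ.totalDegree hirr.ne_zero
  obtain ⟨B, hBc, hB⟩ := modp_count2 d p (dh φ) ((dh_deg φ).trans hφd.le) (by rwa [dh_coeff d φ hφ])
  have hz : ∀ v ∈ A, (v 2 : ZMod p) ≠ 0 := fun v hv h =>
    (hA v hv).2.2.2.1 ((ZMod.intCast_zmod_eq_zero_iff_dvd _ _).1 h)
  refine (card_le_fibre A (fun v (k : Fin 2) => ((v (Fin.castSucc k) : ZMod p) / v 2))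
    (2 * ((2 * d + 1) * d) ^ 2) ?_ B ?_).trans (Nat.mul_le_mul_left _ hBc)
  · intro s A' hA' hs
    rcases A'.eq_empty_or_nonempty with rfl | ⟨x0, hx0⟩
    · simp
    obtain ⟨c, hc0, hc⟩ := lin_dep (ι := Fin 3) (A' : Set (Fin 3 → ℤ)) (by
      intro r hr
      have hr' : ∀ a, r a ∈ A := fun a => hA' (hr a)
      have h1 := cone_det d p hp φ hφ r (fun a => (hA _ (hr' a)).2.2.1) (fun a => (hA _ (hr' a)).2.2.2.1)
        (hA _ (hr' 0)).2.2.2.2 (by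
          intro a i
          refine Fin.lastCases ?_ (fun k => ?_) i
          · have : r a 2 * r 0 2 - r 0 2 * r a 2 = 0 := by ring
            exact this ▸ dvd_zero _
          · have h2 := congrFun ((hs _ (hr a)).trans (hs _ (hr 0)).symm) k
            rw [div_eq_div_iff (hz _ (hr' a)) (hz _ (hr' 0))] at h2
            rw [← ZMod.intCast_zmod_eq_zero_iff_dvd]
            push_cast
            rw [sub_eq_zero]
            exact h2)
      by_contra hne
      have h2 := Int.le_of_dvd (abs_pos.2 hne) ((dvd_abs _ _).2 h1)
      have h3 : ∀ a b, |r a b| ≤ (H : ℤ) := fun a b => (hA _ (hr' a)).2.1 b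
      have h4 : |Matrix.det (Matrix.of r)| ≤ 6 * (H : ℤ) ^ 3 := by
        have := Matrix.det_le (A := Matrix.of r) (abv := AbsoluteValue.abs) (x := (H : ℤ)) h3
        simpa [Nat.factorial] using this
      have h5 : (2 * (H : ℤ)) ^ 3 ≤ (p : ℤ) ^ 3 := by
        gcongr; exact_mod_cast hHp
      have h6 : (0 : ℤ) < (H : ℤ) ^ 3 := by positivity
      nlinarith)
    refine cone_lin d hd φ hφ hirr c hc0 A' fun v hv => ?_
    have h1 := hA v (hA' hv)
    exact ⟨h1.1, h1.2.2.1, fun h => h1.2.2.2.1 (by rw [h]; exact dvd_zero _), hc v hv⟩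
  · intro v hv
    apply hB
    rw [aeval_dh]
    have h1 : aeval (fun i => (v i : ZMod p)) φ = 0 := by
      have := (hA v hv).2.2.1
      rw [aeval_cast, this]; simp
    have h2 : aeval (fun i => ((v 2 : ZMod p))⁻¹ * (v i : ZMod p)) φ = 0 := by
      have : aeval (fun i => ((v 2 : ZMod p))⁻¹ * (v i : ZMod p)) φ = ((v 2 : ZMod p))⁻¹ ^ d *
          aeval (fun i => (v i : ZMod p)) φ := by
        rw [aeval_def, aeval_def, eval₂_eq', eval₂_eq', Finset.mul_sum]
        refine Finset.sum_congr rfl fun α hα => ?_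
        have hd : d = ∑ i, α i := by
          rw [← hφ (mem_support_iff.1 hα)]
          simp [Finsupp.weight_apply, Finsupp.sum_fintype]
        simp only [mul_pow]
        rw [Finset.prod_mul_distrib, Finset.prod_pow_eq_pow_sum, ← hd]
        ring
      rw [this, h1, mul_zero]
    rw [← h2]
    congr 2
    funext i
    have := hz v hv
    fin_cases i
    · simp [div_eq_inv_mul]
    · simp [div_eq_inv_mul]
    · simp; field_simp

open Classical in
lemma cone_count (d : ℕ) (hd : 2 ≤ d) : ∃ K : ℕ, ∀ φ : MvPolynomial (Fin 3) ℤ, φ.IsHomogeneous d →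
    Irreducible φ → (∀ i, coeff (Finsupp.single i d) φ ≠ 0) → ∀ H : ℕ, 1 ≤ H →
    ∀ A : Finset (Fin 3 → ℤ), (∀ v ∈ A, Finset.univ.gcd v = 1 ∧ (∀ i, |v i| ≤ H) ∧ eval v φ = 0) →
    A.card ≤ K * H := by
  obtain ⟨K0, M, h1⟩ := ((PBd_SB 3 d).mul (PBd.id.mul (PBd_PB 3 d (PBd_SB 3 d)))).lt 1
  obtain ⟨K, hK⟩ : ∃ K, K = K0 + 2 := ⟨_, rfl⟩
  obtain ⟨W2, hW2⟩ : ∃ W2 : ℕ, W2 = d * ((2 * d + 1) * d * 3) := ⟨_, rfl⟩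
  refine ⟨W2 + W2 + (M + 1) * ((2 * ((2 * d + 1) * d) ^ 2) * (d * (2 ^ (M + 1) * K))), ?_⟩
  intro φ hφ hirr hlc H hH A hA
  have hφd := hφ.totalDegree hirr.ne_zero
  have hlin : ∀ (g : MvPolynomial (Fin 3) ℤ), ¬ φ ∣ g → g.totalDegree ≤ d →
      ∀ A' : Finset (Fin 3 → ℤ), A' ⊆ A → (∀ x ∈ A', eval x g = 0) → A'.card ≤ W2 * H := by
    intro g hg hgd A' hA' hz
    have h3 := surf_card H d d φ g hirr hg hφd.le hgd hφd.le (hlc 2) A'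
      (fun x hx => ⟨(hA x (hA' hx)).2.2, hz x hx, (hA x (hA' hx)).2.1⟩)
    exact h3.trans (by
      calc d * ((2 * d + 1) * d * (2 * H + 1)) ≤ d * ((2 * d + 1) * d * (3 * H)) := by
            gcongr; omega
        _ = W2 * H := by rw [hW2]; ring)
  rcases small_or 3 d H hH φ hirr hφd.le with ⟨g, hgd, hfg, hg⟩ | hsmall
  · refine (hlin g hfg hgd A subset_rfl (fun x hx => hg x (hA x hx).2.1 (hA x hx).2.2)).trans ?_
    gcongr; rw [add_assoc]; exact Nat.le_add_right _ _
  have hpd : pderiv 1 φ ≠ 0 := by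
    intro h0
    have h3 : coeff (Finsupp.single 1 (d - 1)) (pderiv 1 φ) = 0 := by rw [h0]; simp
    rw [coeff_pderiv, ← Finsupp.single_add, show d - 1 + 1 = d by omega] at h3
    simp only [Finsupp.single_eq_same, mul_eq_zero] at h3
    rcases h3 with h3 | h3
    · exact hlc 1 h3
    · omega
  have hA1 := hlin (pderiv 1 φ) (not_dvd_pderiv φ (by omega) 1 hpd)
    ((pderiv_totalDegree 1 φ).trans (by omega)) (A.filter fun x => eval x (pderiv 1 φ) = 0)
    (Finset.filter_subset _ _) (fun x hx => (Finset.mem_filter.1 hx).2)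
  have hA2 := hlin (X 2) (fun h => by
      have := totalDegree_le_of_dvd_of_isDomain h (X_ne_zero 2)
      rw [totalDegree_X] at this
      omega) (by rw [totalDegree_X]; omega) (A.filter fun x => x 2 = 0)
    (Finset.filter_subset _ _) (fun x hx => by simpa using (Finset.mem_filter.1 hx).2)
  obtain ⟨P, hPc, hP⟩ := primes_exist (M + 1) (K * H) (Nat.mul_pos (by omega) hH)
  have hKH : 2 * H ≤ K * H := Nat.mul_le_mul_right _ (by omega)
  set S : ℕ → Finset (Fin 3 → ℤ) := fun p => A.filter fun v =>
    ¬ (p : ℤ) ∣ coeff (Finsupp.single 1 d) φ * (v 2 * eval v (pderiv 1 φ)) with hS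
  have hSc : ∀ p ∈ P, (S p).card ≤ (2 * ((2 * d + 1) * d) ^ 2) * (d * (2 ^ (M + 1) * (K * H))) := by
    intro p hpP
    obtain ⟨hp, hp1, hp2⟩ := hP p hpP
    by_cases hlcp : (p : ℤ) ∣ coeff (Finsupp.single 1 d) φ
    · have : S p = ∅ := by
        rw [hS]; simp only [Finset.filter_eq_empty_iff, not_not]
        exact fun v _ => hlcp.mul_right _
      rw [this]; simp
    refine (cone_p d H p hd hp (hKH.trans hp1) φ hφ hH hirr hlcp (S p) ?_).trans (by gcongr)
    intro v hv
    obtain ⟨hv1, hv2⟩ := Finset.mem_filter.1 hv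
    obtain ⟨a, b, c⟩ := hA v hv1
    exact ⟨a, b, c, fun h => hv2 ((h.mul_right _).mul_left _), fun h => hv2 ((h.mul_left _).mul_left _)⟩
  have hcov : A ⊆ (A.filter fun x => eval x (pderiv 1 φ) = 0) ∪ (A.filter fun x => x 2 = 0) ∪
      P.biUnion S := by
    intro v hv
    by_cases e1 : eval v (pderiv 1 φ) = 0
    · simp [hv, e1]
    by_cases e2 : v 2 = 0
    · simp [hv, e2]
    refine Finset.mem_union_right _ ?_
    by_contra hcon
    obtain ⟨-, hb, -⟩ := hA v hv
    have h2 := primes_dvd P (K * H) M (fun p hp => ⟨(hP p hp).1, (hP p hp).2.1⟩) (by omega)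
      (coeff (Finsupp.single 1 d) φ * (v 2 * eval v (pderiv 1 φ)))
      (mul_ne_zero (hlc 1) (mul_ne_zero e2 e1)) (by
        rw [abs_mul, abs_mul]
        have e3 := hsmall (Finsupp.single 1 d)
        have e4 := pd_bound 3 d (SB 3 d H) H hH φ hφd.le hsmall v hb 1
        refine lt_of_le_of_lt (mul_le_mul e3 (mul_le_mul (hb 2) e4 (abs_nonneg _) (by positivity))
          (by positivity) (by positivity)) ?_
        have := h1 K M H H (by omega) le_rfl hH hH (by simp)
        exact_mod_cast this)
    have h3 : P.filter (fun p : ℕ => (p : ℤ) ∣ coeff (Finsupp.single 1 d) φ * (v 2 * eval v (pderiv 1 φ))) = P := by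
      refine Finset.filter_true_of_mem fun p hp => ?_
      by_contra hnd
      exact hcon (Finset.mem_biUnion.2 ⟨p, hp, Finset.mem_filter.2 ⟨hv, hnd⟩⟩)
    rw [h3] at h2
    omega
  have h5 := (Finset.card_le_card hcov).trans ((Finset.card_union_le _ _).trans
    (Nat.add_le_add (Finset.card_union_le _ _) (Finset.card_biUnion_le_card_mul _ _ _ hSc)))
  rw [hPc] at h5
  refine h5.trans ((Nat.add_le_add (Nat.add_le_add hA1 hA2) le_rfl).trans (le_of_eq ?_))
  ring


lemma top_eval (d : ℕ) (f φ : MvPolynomial (Fin 3) ℤ) (hφ : φ.IsHomogeneous d)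
    (hfφ : (f - φ).totalDegree < d) (x v : Fin 3 → ℤ)
    (h : ∀ t : ℤ, eval (fun i => x i + t * v i) f = 0) : eval v φ = 0 := by
  have h1 : (aeval (fun i => Polynomial.C (x i) + Polynomial.X * Polynomial.C (v i)) f :
      Polynomial ℤ) = 0 := Polynomial.funext fun t => by rw [eval_line, h]; simp
  have h2 := natDegree_aeval_le (f - φ) x v
  have h3 := Polynomial.coeff_eq_zero_of_natDegree_lt (lt_of_le_of_lt h2 hfφ)
  rw [map_sub, h1, Polynomial.coeff_sub, coeff_line d φ hφ] at h3
  simpa using h3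

open Classical in
lemma lines_count (d : ℕ) (hd : 4 ≤ d) : ∃ K : ℕ, ∀ f φ ψ : MvPolynomial (Fin 3) ℤ, ∀ c : ℤ,
    Irreducible f → f.totalDegree = d → φ.IsHomogeneous d → (f - φ).totalDegree < d → φ = C c * ψ →
    c ≠ 0 → ψ.IsHomogeneous d → Irreducible ψ → (∀ i, coeff (Finsupp.single i d) ψ ≠ 0) →
    (∀ v : Fin 3 → ℤ, v ≠ 0 → ∃ j, eval v (pderiv j φ) ≠ 0) → ∀ N : ℕ, 1 ≤ N →
    ∀ A : Finset (Fin 3 → ℤ), (∀ x ∈ A, (∀ i, |x i| ≤ N) ∧ OnLine f N x) →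
    A.card ≤ (Nat.log 2 (2 * N) + 1) * (K * N) := by
  obtain ⟨K, hK⟩ := cone_count d (by omega)
  obtain ⟨W, hW⟩ : ∃ W, W = ((2 * d + 1) * d) ^ 3 := ⟨_, rfl⟩
  refine ⟨K * 2 * (6 * W), ?_⟩
  intro f φ ψ c hf hfd hφ hfφ hφψ hc hψ hψi hψc hsm N hN A hA
  choose! v hv1 hvN hv using fun x hx => (hA x hx).2
  have hi : ∀ w : Fin 3 → ℤ, ∃ i, ∀ j, |w j| ≤ |w i| := fun w => Finite.exists_max (fun j => |w j|)
  choose i hi using hi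
  set m : (Fin 3 → ℤ) → ℕ := fun w => (w (i w)).natAbs with hm
  have hne : ∀ x ∈ A, v x ≠ 0 := by
    intro x hx h
    have := hv1 x hx
    have h0 : Finset.univ.gcd (v x) = 0 := Finset.gcd_eq_zero_iff.2 (fun j _ => by rw [h]; rfl)
    rw [h0] at this
    exact one_ne_zero this.symm
  have hm1 : ∀ x ∈ A, v x (i (v x)) ≠ 0 := by
    intro x hx h
    apply hne x hx
    funext j
    have := hi (v x) j
    rw [h] at this
    simpa using this
  have hm2 : ∀ x ∈ A, m (v x) ≤ 2 * N := by
    intro x hx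
    have := hvN x hx (i (v x))
    rw [Int.abs_eq_natAbs] at this
    simp only [hm]
    omega
  refine (card_le_fibre A (fun x => Nat.log 2 (m (v x))) (K * 2 * (6 * W) * N) ?_
    (Finset.range (Nat.log 2 (2 * N) + 1)) ?_).trans ?_
  · intro k A' hA' hk
    rcases A'.eq_empty_or_nonempty with rfl | ⟨x1, hx1⟩
    · simp
    have hk0 : 2 ^ k ≤ 2 * N := by
      have h1 := hm2 x1 (hA' hx1)
      have h2 := Nat.pow_log_le_self 2 (x := m (v x1)) (by simp only [hm]; have := hm1 x1 (hA' hx1); omega)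
      rw [hk x1 hx1] at h2
      omega
    have hVc := hK ψ hψ hψi hψc (2 ^ (k + 1)) Nat.one_le_two_pow (A'.image v) (by
      intro w hw
      obtain ⟨x, hx, rfl⟩ := Finset.mem_image.1 hw
      refine ⟨hv1 x (hA' hx), fun j => ?_, ?_⟩
      · have h1 := Nat.lt_pow_succ_log_self (b := 2) (by norm_num) (m (v x))
        rw [hk x hx] at h1
        have h2 := hi (v x) j
        simp only [hm] at h1
        have h3 : |v x (i (v x))| < ((2 ^ (k + 1) : ℕ) : ℤ) := by
          rw [Int.abs_eq_natAbs]; exact_mod_cast h1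
        omega
      · have h1 := top_eval d f φ hφ hfφ x (v x) (hv x (hA' hx))
        rw [hφψ, map_mul, eval_C] at h1
        exact (mul_eq_zero.1 h1).resolve_left hc)
    refine (card_le_fibre A' v (3 * (2 * N / 2 ^ k) * W) ?_ (A'.image v)
      (fun x hx => Finset.mem_image_of_mem _ hx)).trans ?_
    · intro w A'' hA'' hw
      rcases A''.eq_empty_or_nonempty with rfl | ⟨x0, hx0⟩
      · simp
      have hx0A := hA' (hA'' hx0)
      have h1 := lines_dir d N hd f φ hf hfd hφ hfφ w (hsm w (hw x0 hx0 ▸ hne x0 hx0A))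
        (hw x0 hx0 ▸ hv1 x0 hx0A) (i w) (by have := hm1 x0 hx0A; rwa [hw x0 hx0] at this) A''
        (fun x hx => ⟨(hA x (hA' (hA'' hx))).1, by
          have := hv x (hA' (hA'' hx)); rwa [hw x hx] at this⟩)
      rw [← hW] at h1
      refine h1.trans (Nat.mul_le_mul_right _ ?_)
      have h2 := Nat.pow_log_le_self 2 (x := m (v x0)) (by simp only [hm]; have := hm1 x0 hx0A; omega)
      rw [hk x0 (hA'' hx0), hw x0 hx0] at h2
      have h3 : 2 * N / (w (i w)).natAbs ≤ 2 * N / 2 ^ k := Nat.div_le_div_left h2 (by positivity)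
      have h4 : 1 ≤ 2 * N / 2 ^ k := (Nat.one_le_div_iff (by positivity)).2 hk0
      omega
    · calc 3 * (2 * N / 2 ^ k) * W * (A'.image v).card ≤ 3 * (2 * N / 2 ^ k) * W * (K * 2 ^ (k + 1)) := by
            gcongr
        _ = (2 * N / 2 ^ k * 2 ^ k) * (3 * W * K * 2) := by ring
        _ ≤ (2 * N) * (3 * W * K * 2) := Nat.mul_le_mul_right _ (Nat.div_mul_le_self _ _)
        _ = K * 2 * (6 * W) * N := by ring
  · intro x hx
    rw [Finset.mem_range, Nat.lt_succ_iff]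
    exact Nat.log_mono_right (hm2 x hx)
  · rw [Finset.card_range]
    exact le_of_eq (by ring)

open Classical in
lemma main_irred (d : ℕ) (hd : 4 ≤ d) (ε : ℝ) (hε : 0 < ε) : ∃ K : ℝ, 0 ≤ K ∧
    ∀ f φ ψ : MvPolynomial (Fin 3) ℤ, ∀ c : ℤ,
    Irreducible f → f.totalDegree = d → φ.IsHomogeneous d → (f - φ).totalDegree < d → φ = C c * ψ →
    c ≠ 0 → ψ.IsHomogeneous d → Irreducible ψ → (∀ i, coeff (Finsupp.single i d) φ ≠ 0) →
    (∀ v : Fin 3 → ℤ, v ≠ 0 → ∃ j, eval v (pderiv j φ) ≠ 0) → ∀ N : ℕ, 1 ≤ N →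
    ∀ A : Finset (Fin 3 → ℤ), (∀ x ∈ A, (∀ i, |x i| ≤ N) ∧ eval x f = 0) →
    (A.card : ℝ) ≤ K * (N : ℝ) ^ (1 + ε) := by
  obtain ⟨K1, hK10, hK1⟩ := core_bound d hd ε hε
  obtain ⟨K2, hK2⟩ := lines_count d hd
  set L : ℝ := 2 ^ ε / ε / Real.log 2 + 1 with hL
  have hlog2 : 0 < Real.log 2 := Real.log_pos (by norm_num)
  have hL0 : 0 ≤ L := by positivity
  refine ⟨K1 + L * K2, by positivity, ?_⟩
  intro f φ ψ c hf hfd hφ hfφ hφψ hc hψ hψi hφc hsm N hN A hA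
  have hψc : ∀ i, coeff (Finsupp.single i d) ψ ≠ 0 := by
    intro i h
    apply hφc i
    rw [hφψ, coeff_C_mul, h, mul_zero]
  have hfc : ∀ i, coeff (Finsupp.single i d) f ≠ 0 := by
    intro i
    have h1 : coeff (Finsupp.single i d) (f - φ) = 0 := by
      by_contra h
      have := deg_le_of_coeff _ _ h
      simp at this
      omega
    rw [coeff_sub, sub_eq_zero] at h1
    rw [h1]; exact hφc i
  have hA1 := hK1 f hf hfd.le hfc N hN (A.filter fun x => ¬ OnLine f N x) (fun x hx => by
    have h1 := Finset.mem_filter.1 hx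
    exact ⟨(hA x h1.1).1, (hA x h1.1).2, h1.2⟩)
  have hA2 := hK2 f φ ψ c hf hfd hφ hfφ hφψ hc hψ hψi hψc hsm N hN (A.filter fun x => OnLine f N x)
    (fun x hx => by
      have h1 := Finset.mem_filter.1 hx
      exact ⟨(hA x h1.1).1, h1.2⟩)
  have hN1 : (1 : ℝ) ≤ N := by exact_mod_cast hN
  have hlog : ((Nat.log 2 (2 * N) + 1 : ℕ) : ℝ) ≤ L * (N : ℝ) ^ ε := by
    have h1 := Real.natLog_le_logb (2 * N) 2
    have h2 : Real.logb ((2 : ℕ) : ℝ) ((2 * N : ℕ) : ℝ) ≤ 2 ^ ε / ε / Real.log 2 * (N : ℝ) ^ ε := by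
      rw [Real.logb]
      push_cast
      have h3 := Real.log_le_rpow_div (x := 2 * (N : ℝ)) (by positivity) hε
      rw [Real.mul_rpow (by norm_num) (by positivity)] at h3
      calc Real.log (2 * N) / Real.log 2 ≤ (2 ^ ε * (N : ℝ) ^ ε / ε) / Real.log 2 := by gcongr
        _ = _ := by ring
    have h3 : (1 : ℝ) ≤ (N : ℝ) ^ ε := Real.one_le_rpow hN1 hε.le
    have h4 := h1.trans h2
    push_cast at h4 ⊢
    rw [hL, add_mul, one_mul]
    exact add_le_add h4 h3
  have h5 := Finset.card_filter_add_card_filter_not (s := A) (fun x => OnLine f N x)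
  have h6 : (A.card : ℝ) = ((A.filter fun x => OnLine f N x).card : ℝ) +
      ((A.filter fun x => ¬ OnLine f N x).card : ℝ) := by exact_mod_cast h5.symm
  have h7 : ((A.filter fun x => OnLine f N x).card : ℝ) ≤ L * K2 * (N : ℝ) ^ (1 + ε) := by
    calc ((A.filter fun x => OnLine f N x).card : ℝ) ≤
          ((Nat.log 2 (2 * N) + 1 : ℕ) : ℝ) * (K2 * N) := by exact_mod_cast hA2
      _ ≤ L * (N : ℝ) ^ ε * (K2 * N) := by gcongr
      _ = _ := by rw [Real.rpow_add (by positivity), Real.rpow_one]; ring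
  rw [h6]
  linarith


lemma prim_factor {n : ℕ} (h : MvPolynomial (Fin n) ℤ) (h1 : 1 ≤ h.totalDegree)
    (hno : ∀ a b, h = a * b → a.totalDegree = 0 ∨ b.totalDegree = 0) :
    ∃ (c : ℤ) (f : MvPolynomial (Fin n) ℤ), c ≠ 0 ∧ h = C c * f ∧ Irreducible f := by
  classical
  have h0 : h ≠ 0 := by rintro rfl; simp at h1
  obtain ⟨g, hg, hg1⟩ := Finset.extract_gcd (s := h.support) (fun α => coeff α h) (support_nonempty.2 h0)
  set c := h.support.gcd (fun α => coeff α h) with hc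
  set f : MvPolynomial (Fin n) ℤ := ∑ α ∈ h.support, monomial α (g α) with hf
  have hcf : ∀ α, coeff α f = if α ∈ h.support then g α else 0 := by
    intro α
    simp [hf, coeff_sum, coeff_monomial]
  have hh : h = C c * f := by
    ext α
    rw [coeff_C_mul, hcf]
    split_ifs with hα
    · exact hg α hα
    · rw [mul_zero]; exact notMem_support_iff.1 hα
  have hc0 : c ≠ 0 := by
    intro hc0; rw [hc0] at hh; simp at hh; exact h0 hh
  have hf0 : f ≠ 0 := by
    intro hf0; rw [hf0, mul_zero] at hh; exact h0 hh
  have hdeg : ∀ (k : ℤ) (p : MvPolynomial (Fin n) ℤ), k ≠ 0 → (C k * p).totalDegree = p.totalDegree := by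
    intro k p hk
    by_cases hp : p = 0
    · simp [hp]
    rw [totalDegree_mul_of_isDomain (by simpa using hk) hp, totalDegree_C, zero_add]
  have hun : ∀ a b, f = a * b → a.totalDegree = 0 → IsUnit a := by
    intro a b hab ha
    rw [totalDegree_eq_zero_iff_eq_C] at ha
    rw [ha] at hab ⊢
    have : coeff 0 a ∣ 1 := by
      rw [← hg1]
      refine Finset.dvd_gcd fun α hα => ?_
      have h2 := hcf α
      rw [if_pos hα, hab, coeff_C_mul] at h2
      exact ⟨_, h2.symm⟩
    exact (isUnit_of_dvd_one this).map C
  refine ⟨c, f, hc0, hh, ?_, ?_⟩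
  · intro hu
    have := (isUnit_iff_totalDegree_of_isReduced.1 hu).2
    rw [hh, hdeg c f hc0] at h1
    omega
  · intro a b hab
    rcases hno (C c * a) b (by rw [hh, hab]; ring) with h2 | h2
    · rw [hdeg c a hc0] at h2
      exact Or.inl (hun a b hab h2)
    · exact Or.inr (hun b a (by rw [hab]; ring) h2)

lemma top_mul {n : ℕ} (a b : MvPolynomial (Fin n) ℤ) (p q : ℕ) (hp : a.totalDegree ≤ p)
    (hq : b.totalDegree ≤ q) : homogeneousComponent (p + q) (a * b) =
    homogeneousComponent p a * homogeneousComponent q b := by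
  classical
  ext α
  rw [coeff_homogeneousComponent, coeff_mul, coeff_mul]
  have hza : ∀ β : Fin n →₀ ℕ, p < β.degree → coeff β a = 0 := fun β hβ => by
    by_contra h; have := deg_le_of_coeff a β h; omega
  have hzb : ∀ β : Fin n →₀ ℕ, q < β.degree → coeff β b = 0 := fun β hβ => by
    by_contra h; have := deg_le_of_coeff b β h; omega
  split_ifs with hα
  · refine Finset.sum_congr rfl fun x hx => ?_
    have h1 : x.1.degree + x.2.degree = p + q := by
      rw [← map_add, Finset.HasAntidiagonal.mem_antidiagonal.1 hx, hα]
    rw [coeff_homogeneousComponent, coeff_homogeneousComponent]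
    rcases lt_trichotomy x.1.degree p with h | h | h
    · rw [hzb x.2 (by omega)]; simp
    · rw [if_pos h, if_pos (by omega)]
    · rw [hza x.1 h]; simp
  · symm
    refine Finset.sum_eq_zero fun x hx => ?_
    have h1 : x.1.degree + x.2.degree = α.degree := by
      rw [← map_add, Finset.HasAntidiagonal.mem_antidiagonal.1 hx]
    rw [coeff_homogeneousComponent, coeff_homogeneousComponent]
    by_cases h : x.1.degree = p
    · rw [if_neg (c := x.2.degree = q) (by omega), mul_zero]
    · rw [if_neg h, zero_mul]

lemma top_ne {n : ℕ} (a : MvPolynomial (Fin n) ℤ) (ha : a ≠ 0) :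
    homogeneousComponent a.totalDegree a ≠ 0 := by
  intro h
  obtain ⟨α, hα, hαd⟩ := Finset.exists_mem_eq_sup a.support (support_nonempty.2 ha)
            (fun s => s.sum fun _ e => e)
  have h1 := congrArg (coeff α) h
  rw [coeff_homogeneousComponent, if_pos] at h1
  · exact mem_support_iff.1 hα (by simpa using h1)
  · exact hαd.symm

open Classical in
lemma main3 (d : ℕ) (hd : 4 ≤ d) (ε : ℝ) (hε : 0 < ε) : ∃ K : ℝ, 0 ≤ K ∧
    ∀ f φ : MvPolynomial (Fin 3) ℤ,
    φ.IsHomogeneous d → (f - φ).totalDegree < d → (∀ i, coeff (Finsupp.single i d) φ ≠ 0) →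
    (∀ v : Fin 3 → ℤ, v ≠ 0 → ∃ j, eval v (pderiv j φ) ≠ 0) →
    (∀ a b, φ = a * b → a.totalDegree = 0 ∨ b.totalDegree = 0) → ∀ N : ℕ, 1 ≤ N →
    ∀ A : Finset (Fin 3 → ℤ), (∀ x ∈ A, (∀ i, |x i| ≤ N) ∧ eval x f = 0) →
    (A.card : ℝ) ≤ K * (N : ℝ) ^ (1 + ε) := by
  obtain ⟨K, hK0, hK⟩ := main_irred d hd ε hε
  refine ⟨K, hK0, ?_⟩
  intro f φ hφ hfφ hc hsm hno N hN A hA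
  have hφ0 : φ ≠ 0 := by rintro rfl; exact hc 0 (by simp)
  have hφd := hφ.totalDegree hφ0
  have htop : homogeneousComponent d f = φ := by
    have h1 : homogeneousComponent d (f - φ) = 0 := homogeneousComponent_eq_zero _ _ hfφ
    rw [map_sub, sub_eq_zero] at h1
    rw [h1]
    exact homogeneousComponent_eq_self hφ
  have hfd : f.totalDegree = d := by
    apply le_antisymm
    · have : f = (f - φ) + φ := by ring
      rw [this]
      exact (totalDegree_add _ _).trans (max_le (by omega) hφd.le)
    · by_contra h
      exact hφ0 (by rw [← htop]; exact homogeneousComponent_eq_zero _ _ (by omega))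
  have hf0 : f ≠ 0 := by rintro rfl; simp at hfd; omega
  have hnof : ∀ a b, f = a * b → a.totalDegree = 0 ∨ b.totalDegree = 0 := by
    intro a b hab
    have ha : a ≠ 0 := by rintro rfl; simp at hab; exact hf0 hab
    have hb : b ≠ 0 := by rintro rfl; simp at hab; exact hf0 hab
    have h1 := totalDegree_mul_of_isDomain ha hb
    have h2 := top_mul a b _ _ le_rfl le_rfl
    rw [← h1, ← hab, hfd, htop] at h2
    rcases hno _ _ h2 with h3 | h3
    · left; rwa [(homogeneousComponent_isHomogeneous _ a).totalDegree (top_ne a ha)] at h3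
    · right; rwa [(homogeneousComponent_isHomogeneous _ b).totalDegree (top_ne b hb)] at h3
  obtain ⟨c, f1, hc0, hff1, hf1⟩ := prim_factor f (by omega) hnof
  have hf1d : f1.totalDegree = d := by
    rw [hff1, totalDegree_mul_of_isDomain (by simpa using hc0) hf1.ne_zero, totalDegree_C, zero_add] at hfd
    exact hfd
  set φ1 := homogeneousComponent d f1 with hφ1
  have hφφ1 : φ = C c * φ1 := by
    rw [← htop, hff1, homogeneousComponent_C_mul]
  have hφ1h : φ1.IsHomogeneous d := homogeneousComponent_isHomogeneous _ _
  have hφ10 : φ1 ≠ 0 := by rintro h; rw [h, mul_zero] at hφφ1; exact hφ0 hφφ1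
  have hφ1d := hφ1h.totalDegree hφ10
  obtain ⟨c', ψ, hc'0, hφψ, hψ⟩ := prim_factor φ1 (by omega) (by
    intro a b hab
    rcases hno (C c * a) b (by rw [hφφ1, hab]; ring) with h | h
    · left
      by_cases ha : a = 0
      · simp [ha]
      rwa [totalDegree_mul_of_isDomain (by simpa using hc0) ha, totalDegree_C, zero_add] at h
    · exact Or.inr h)
  refine hK f1 φ1 ψ c' hf1 hf1d hφ1h ?_ hφψ hc'0 ?_ hψ ?_ ?_ N hN A ?_
  · have h1 : f - φ = C c * (f1 - φ1) := by rw [mul_sub, ← hff1, ← hφφ1]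
    by_cases h2 : f1 - φ1 = 0
    · rw [h2]; simp; omega
    rw [h1, totalDegree_mul_of_isDomain (by simpa using hc0) h2, totalDegree_C, zero_add] at hfφ
    exact hfφ
  · intro α hα
    refine hφ1h (d := α) ?_
    rw [hφψ, coeff_C_mul]
    exact mul_ne_zero hc'0 hα
  · intro i h
    exact hc i (by rw [hφφ1, coeff_C_mul, h, mul_zero])
  · intro v hv
    obtain ⟨j, hj⟩ := hsm v hv
    refine ⟨j, fun h => hj ?_⟩
    rw [hφφ1, pderiv_C_mul, map_mul, h, mul_zero]
  · intro x hx
    obtain ⟨h1, h2⟩ := hA x hx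
    rw [hff1, map_mul, eval_C] at h2
    exact ⟨h1, (mul_eq_zero.1 h2).resolve_left hc0⟩


lemma dim_ge_of_integral (k A : Type) [Field k] [CommRing A] [IsDomain A] [Algebra k A] (s : ℕ)
    (g : MvPolynomial (Fin s) k →ₐ[k] A) (hg : Function.Injective g) (hi : g.IsIntegral) :
    (s : WithBot ℕ∞) ≤ ringKrullDim A := by
  have h1 : ringKrullDim (MvPolynomial (Fin s) k) = s := by
    rw [MvPolynomial.ringKrullDim_of_isNoetherianRing]
    simp
  letI := g.toRingHom.toAlgebra
  have hI : Algebra.IsIntegral (MvPolynomial (Fin s) k) A := ⟨hi⟩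
  rw [← h1]
  refine iSup_le fun l => ?_
  have hf : FaithfulSMul (MvPolynomial (Fin s) k) A :=
    (faithfulSMul_iff_algebraMap_injective _ _).2 hg
  obtain ⟨⟨P, hP, hP2⟩⟩ := Ideal.nonempty_primesOver (S := A) (RelSeries.head l).asIdeal
  obtain ⟨L, hL, -, -⟩ := Ideal.exists_ltSeries_of_hasGoingUp l P
  rw [← hL]
  exact le_iSup (fun p : LTSeries (PrimeSpectrum A) => (p.length : WithBot ℕ∞)) L

lemma card_le_dim (k Ω : Type) [Field k] [Field Ω] [Algebra k Ω] (n : ℕ) (w : Fin n → Ω)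
    (J : Ideal (MvPolynomial (Fin n) k)) (hJ : ∀ p ∈ J, aeval w p = 0)
    (I : Finset Ω) (hI : (I : Set Ω) ⊆ Set.range w) (hind : AlgebraicIndepOn k id (I : Set Ω)) :
    (I.card : WithBot ℕ∞) ≤ ringKrullDim (MvPolynomial (Fin n) k ⧸ J) := by
  set φ := (aeval w : MvPolynomial (Fin n) k →ₐ[k] Ω) with hφ
  have hdim : ringKrullDim φ.range ≤ ringKrullDim (MvPolynomial (Fin n) k ⧸ J) := by
    refine ringKrullDim_le_of_surjective
      (Ideal.Quotient.lift J φ.rangeRestrict.toRingHom ?_) ?_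
    · intro p hp
      ext
      exact hJ p hp
    · apply Ideal.Quotient.lift_surjective_of_surjective
      exact φ.rangeRestrict_surjective
  refine le_trans ?_ hdim
  have hft : Algebra.FiniteType k φ.range :=
    Algebra.FiniteType.of_surjective φ.rangeRestrict φ.rangeRestrict_surjective
  obtain ⟨s, g, hg, hi⟩ := exists_integral_inj_algHom_of_fg k φ.range
  refine le_trans ?_ (dim_ge_of_integral k φ.range s g hg hi)
  have h1 : Algebra.trdeg k φ.range = s := by
    letI := g.toRingHom.toAlgebra
    have : IsScalarTower k (MvPolynomial (Fin s) k) φ.range :=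
      IsScalarTower.of_algebraMap_eq fun x => (g.commutes x).symm
    have hI : Algebra.IsIntegral (MvPolynomial (Fin s) k) φ.range := ⟨hi⟩
    have hf : FaithfulSMul (MvPolynomial (Fin s) k) φ.range :=
      (faithfulSMul_iff_algebraMap_injective _ _).2 hg
    have := trdeg_add_eq k (MvPolynomial (Fin s) k) (A := φ.range)
    rw [trdeg_eq_zero (R := MvPolynomial (Fin s) k), add_zero] at this
    rw [← this, MvPolynomial.trdeg_of_isDomain]
    simp
  have hm : ∀ x : I, (x : Ω) ∈ φ.range := by
    intro x
    obtain ⟨i, hi⟩ := hI x.2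
    exact ⟨X i, by simp [hφ, hi]⟩
  have hind' : AlgebraicIndependent k (fun x : I => (⟨x, hm x⟩ : φ.range)) := by
    have h2 : AlgebraicIndependent k (fun x : I => φ.range.val ⟨x, hm x⟩) := hind
    exact AlgebraicIndependent.of_comp φ.range.val h2
  have := hind'.cardinalMk_le_trdeg
  rw [h1] at this
  simp at this
  exact_mod_cast this


open AlgebraicIndependent in
lemma generic_smooth (k Ω : Type) [Field k] [CharZero k] [Field Ω] [Algebra k Ω] (n d : ℕ)
    (F : MvPolynomial (Fin n) k) (hF : F.IsHomogeneous d) (hd : d ≠ 0) (hF0 : F ≠ 0)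
    (hdim : ringKrullDim (MvPolynomial (Fin n) k ⧸
      Ideal.span ({F} ∪ Set.range (fun i => pderiv i F))) + 4 ≤ (n : WithBot ℕ∞))
    (u : Fin n → Fin 3 → Ω) (hu : AlgebraicIndependent k (fun p : Fin n × Fin 3 => u p.1 p.2))
    (s : Fin 3 → Ω) (j₀ : Fin 3) (hs : s j₀ = 1)
    (h : ∀ j, ∑ i, aeval (fun i => ∑ j, u i j * s j) (pderiv i F) * u i j = 0) : False := by
  classical
  obtain ⟨w, hw⟩ : ∃ w : Fin n → Ω, w = fun i => ∑ j, u i j * s j := ⟨_, rfl⟩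
  rw [← hw] at h
  have hwi : ∀ i, w i = ∑ j, u i j * s j := fun i => by rw [hw]
  have hcz : CharZero Ω := charZero_of_injective_algebraMap (algebraMap k Ω).injective
  have hFw : aeval w F = 0 := by
    have h1 := congrArg (aeval w) hF.sum_X_mul_pderiv
    rw [map_sum] at h1
    have h2 : ∑ i, aeval w (X i * pderiv i F) = ∑ j, s j * ∑ i, aeval w (pderiv i F) * u i j := by
      simp_rw [map_mul, aeval_X, Finset.mul_sum]
      rw [Finset.sum_comm]
      refine Finset.sum_congr rfl fun i _ => ?_
      rw [hwi i, Finset.sum_mul]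
      exact Finset.sum_congr rfl fun j _ => by ring
    rw [h2] at h1
    simp only [h, mul_zero, Finset.sum_const_zero, map_nsmul] at h1
    rw [eq_comm, smul_eq_zero] at h1
    exact h1.resolve_left hd
  set M := matroid k Ω with hM
  have hmem : ∀ (T : Set Ω) x, x ∈ M.closure T ↔ IsAlgebraic (Algebra.adjoin k T) x := by
    intro T x
    rw [hM, matroid_closure_eq]; rfl
  -- the reduction to a spanning set
  have key : ∀ T : Set Ω, (∀ i, w i ∈ M.closure T) → (∀ j, j ≠ j₀ → s j ∈ M.closure T) →
      (∀ i j, j ≠ j₀ → u i j ∈ M.closure T) → (3 * n : ℕ) ≤ M.eRk T := by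
    intro T h1 h2 h3
    rw [← M.eRk_closure_eq]
    have hinj : Function.Injective (fun p : Fin n × Fin 3 => u p.1 p.2) := hu.injective
    have hr : M.Indep (Set.range (fun p : Fin n × Fin 3 => u p.1 p.2)) := by
      rw [hM, matroid_indep_iff]
      exact (algebraicIndependent_subtype_range hinj).2 hu
    have hc : ((3 * n : ℕ) : ℕ∞) = (Set.range (fun p : Fin n × Fin 3 => u p.1 p.2)).encard := by
      rw [← Set.image_univ, hinj.encard_image]
      simp [mul_comm]
    rw [hc, ← hr.eRk_eq_encard]
    apply M.eRk_mono
    rintro _ ⟨⟨i, j⟩, rfl⟩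
    by_cases hj : j = j₀
    · subst hj
      have : u i j = w i - ∑ j' ∈ Finset.univ.erase j, u i j' * s j' := by
        rw [hwi, ← Finset.add_sum_erase _ _ (Finset.mem_univ j), hs]; ring
      simp only [this]
      rw [hM, matroid_closure_eq] at *
      refine sub_mem (h1 i) (sum_mem fun j' hj' => ?_)
      have := Finset.ne_of_mem_erase hj'
      exact mul_mem (h3 i j' this) (h2 j' this)
    · exact h3 i j hj
  set W := Set.range w with hW
  set S := ((Finset.univ.erase j₀).image s : Finset Ω) with hS
  have hSc : (S : Set Ω).encard ≤ 2 := by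
    rw [Set.encard_coe_eq_coe_finsetCard]
    have : S.card ≤ 2 := le_trans Finset.card_image_le (by simp)
    exact_mod_cast this
  have hsub : ∀ (T : Set Ω), T ⊆ M.closure T := fun T => M.subset_closure T (by simp [hM])
  by_cases hcase : ∀ i, aeval w (pderiv i F) = 0
  · set U := ((Finset.univ ×ˢ Finset.univ.erase j₀).image (fun p : Fin n × Fin 3 => u p.1 p.2))
      with hU
    have hUc : (U : Set Ω).encard ≤ (2 * n : ℕ) := by
      rw [Set.encard_coe_eq_coe_finsetCard]
      have : U.card ≤ 2 * n := le_trans Finset.card_image_le (by simp [mul_comm])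
      exact_mod_cast this
    have h1 := key (W ∪ (S ∪ U)) (fun i => hsub _ (Or.inl ⟨i, rfl⟩))
      (fun j hj => hsub _ (Or.inr (Or.inl (by simp [hS]; exact ⟨j, hj, rfl⟩))))
      (fun i j hj => hsub _ (Or.inr (Or.inr (by simp [hU]; exact ⟨i, j, hj, rfl⟩))))
    have h2 : M.eRk (W ∪ (S ∪ U)) ≤ M.eRk W + (2 + (2 * n : ℕ)) :=
      (M.eRk_union_le_eRk_add_eRk _ _).trans (add_le_add le_rfl
        ((M.eRk_union_le_eRk_add_eRk _ _).trans (add_le_add ((M.eRk_le_encard _).trans hSc)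
          ((M.eRk_le_encard _).trans hUc))))
    obtain ⟨I, hI⟩ := M.exists_isBasis W
    have hIf : I.Finite := (Set.finite_range w).subset hI.subset
    have h3 := card_le_dim k Ω n w (Ideal.span ({F} ∪ Set.range (fun i => pderiv i F))) (by
      intro p hp
      have : Ideal.span ({F} ∪ Set.range (fun i => pderiv i F)) ≤ RingHom.ker (aeval w) := by
        rw [Ideal.span_le]
        rintro q (rfl | ⟨i, rfl⟩)
        · exact hFw
        · exact hcase i
      exact this hp) hIf.toFinset (by simpa using hI.subset)
      (by rw [hIf.coe_toFinset]; exact matroid_indep_iff.1 hI.indep)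
    have h4 : (hIf.toFinset.card : WithBot ℕ∞) + 4 ≤ n := le_trans (by gcongr) hdim
    have h4' : hIf.toFinset.card + 4 ≤ n := by exact_mod_cast h4
    have h5 : M.eRk W = hIf.toFinset.card := by
      rw [hI.eRk_eq_encard, hIf.encard_eq_coe_toFinset_card]
    rw [h5] at h2
    have h6 : 3 * n ≤ hIf.toFinset.card + (2 + 2 * n) := by exact_mod_cast h1.trans h2
    omega
  · push Not at hcase
    obtain ⟨i₀, hi₀⟩ := hcase
    set U := ((Finset.univ.erase i₀ ×ˢ Finset.univ.erase j₀).image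
      (fun p : Fin n × Fin 3 => u p.1 p.2)) with hU
    have hn : 1 ≤ n := i₀.pos
    have hUc : (U : Set Ω).encard ≤ (2 * (n - 1) : ℕ) := by
      rw [Set.encard_coe_eq_coe_finsetCard]
      have : U.card ≤ 2 * (n - 1) := le_trans Finset.card_image_le (by simp [mul_comm])
      exact_mod_cast this
    set T : Set Ω := W ∪ (S ∪ U) with hT
    have hwT : ∀ i, w i ∈ M.closure T := fun i => hsub _ (Or.inl ⟨i, rfl⟩)
    have huT : ∀ i j, i ≠ i₀ → j ≠ j₀ → u i j ∈ M.closure T := fun i j hi hj =>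
      hsub _ (Or.inr (Or.inr (by simp [hU]; exact ⟨i, hi, j, hj, rfl⟩)))
    have hpT : ∀ p : MvPolynomial (Fin n) k, aeval w p ∈ M.closure T := by
      intro p
      rw [hmem]
      have : aeval w p ∈ Algebra.adjoin k T := by
        have h1 : aeval w p ∈ Algebra.adjoin k (Set.range w) := by
          rw [Algebra.adjoin_range_eq_range_aeval]; exact ⟨p, rfl⟩
        exact Algebra.adjoin_mono Set.subset_union_left h1
      exact isAlgebraic_algebraMap (⟨_, this⟩ : Algebra.adjoin k T)
    have h1 := key T hwT
      (fun j hj => hsub _ (Or.inr (Or.inl (by simp [hS]; exact ⟨j, hj, rfl⟩))))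
      (fun i j hj => by
        by_cases hi : i = i₀
        · subst hi
          have h2 := h j
          rw [← Finset.add_sum_erase _ _ (Finset.mem_univ i)] at h2
          have h3 : u i j = (aeval w (pderiv i F))⁻¹ *
              (- ∑ x ∈ Finset.univ.erase i, aeval w (pderiv x F) * u x j) := by
            rw [← eq_neg_of_add_eq_zero_left h2]
            field_simp
          rw [h3]
          have h4 : (aeval w (pderiv i F))⁻¹ ∈ M.closure T := by
            rw [hmem]
            exact IsAlgebraic.inv ((hmem _ _).1 (hpT _))
          have h5 : ∀ x ∈ Finset.univ.erase i, aeval w (pderiv x F) ∈ M.closure T ∧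
              u x j ∈ M.closure T := fun x hx => ⟨hpT _, huT x j (Finset.ne_of_mem_erase hx) hj⟩
          rw [hM, matroid_closure_eq] at *
          exact mul_mem h4 (neg_mem (sum_mem fun x hx => mul_mem (h5 x hx).1 (h5 x hx).2))
        · exact huT i j hi hj)
    have h2 : M.eRk T ≤ M.eRk W + (2 + (2 * (n - 1) : ℕ)) :=
      (M.eRk_union_le_eRk_add_eRk _ _).trans (add_le_add le_rfl
        ((M.eRk_union_le_eRk_add_eRk _ _).trans (add_le_add ((M.eRk_le_encard _).trans hSc)
          ((M.eRk_le_encard _).trans hUc))))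
    obtain ⟨I, hI⟩ := M.exists_isBasis W
    have hIf : I.Finite := (Set.finite_range w).subset hI.subset
    have h5 : M.eRk W = hIf.toFinset.card := by
      rw [hI.eRk_eq_encard, hIf.encard_eq_coe_toFinset_card]
    rw [h5] at h2
    have h6 : 3 * n ≤ hIf.toFinset.card + (2 + 2 * (n - 1)) := by exact_mod_cast h1.trans h2
    have h7 : hIf.toFinset ⊆ Finset.univ.image w := by
      intro x hx
      have := hI.subset (hIf.mem_toFinset.1 hx)
      simpa [hW] using this
    have h8 : hIf.toFinset = Finset.univ.image w := by
      apply Finset.eq_of_subset_of_card_le h7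
      exact le_trans Finset.card_image_le (by simp; omega)
    have hinj : Function.Injective w := by
      have h9 : (Finset.univ.image w).card = (Finset.univ : Finset (Fin n)).card := by
        rw [← h8]; have := Finset.card_le_card h7; have := Finset.card_image_le (s := (Finset.univ : Finset (Fin n))) (f := w); simp at *; omega
      have := Finset.card_image_iff.1 h9
      simpa using this
    have hIW : I = Set.range w := by
      rw [← hIf.coe_toFinset, h8]; simp
    have h9 : AlgebraicIndepOn k id I := matroid_indep_iff.1 hI.indep
    have h10 : AlgebraicIndependent k w := by
      rw [hIW] at h9
      exact (algebraicIndependent_subtype_range hinj).1 h9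
    exact hF0 ((injective_iff_map_eq_zero _).1 h10 F hFw)


/-- monomials of degree `M` in three variables -/
abbrev Mon (M : ℕ) : Type := {β : Fin 3 →₀ ℕ // β ∈ Finset.univ.finsuppAntidiag M}

lemma mem_Mon {M : ℕ} {β : Fin 3 →₀ ℕ} : β ∈ (Finset.univ : Finset (Fin 3)).finsuppAntidiag M ↔
    β.degree = M := by
  simp [Finset.mem_finsuppAntidiag, Finsupp.degree_eq_sum]

/-- a maximal minor of the Macaulay matrix of the partial derivatives -/
noncomputable def Gd {R : Type} [CommRing R] (φ : MvPolynomial (Fin 3) R) (M : ℕ)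
    (e : Mon M → Fin 3 × (Fin 3 →₀ ℕ)) : R :=
  (Matrix.of fun β β' : Mon M => coeff β.1 (monomial (e β').2 1 * pderiv (e β').1 φ)).det

lemma Gd_map {R S : Type} [CommRing R] [CommRing S] (f : R →+* S) (φ : MvPolynomial (Fin 3) R)
    (M : ℕ) (e : Mon M → Fin 3 × (Fin 3 →₀ ℕ)) : f (Gd φ M e) = Gd (map f φ) M e := by
  unfold Gd
  rw [RingHom.map_det]
  congr 1
  ext β β'
  simp only [RingHom.mapMatrix_apply, Matrix.map_apply, Matrix.of_apply]
  rw [← coeff_map, map_mul, pderiv_map, map_monomial, map_one]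

lemma exists_minor {Ω ι κ : Type} [Field Ω] [Fintype ι] [DecidableEq ι] (c : κ → ι → Ω)
    (hc : Submodule.span Ω (Set.range c) = ⊤) :
    ∃ e : ι → κ, (Matrix.of fun i i' => c (e i') i).det ≠ 0 := by
  obtain ⟨κ', a, -, hsp, hli⟩ := exists_linearIndependent' Ω c
  rw [hc] at hsp
  let b := Module.Basis.mk hli hsp.ge
  let eq := (Pi.basisFun Ω ι).indexEquiv b
  refine ⟨fun i => a (eq i), ?_⟩
  have h1 : LinearIndependent Ω (fun i => c (a (eq i))) := hli.comp eq eq.injective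
  have h2 := (Matrix.linearIndependent_cols_iff_isUnit
    (A := Matrix.of fun i i' => c (a (eq i')) i)).1 h1
  exact ((Matrix.isUnit_iff_isUnit_det _).1 h2).ne_zero

lemma X_pow_mem {Ω : Type} [Field Ω] [IsAlgClosed Ω] (s : Set (MvPolynomial (Fin 3) Ω))
    (h : ∀ v : Fin 3 → Ω, (∀ p ∈ s, eval v p = 0) → v = 0) (i : Fin 3) :
    X i ∈ (Ideal.span s).radical := by
  rw [← vanishingIdeal_zeroLocus_eq_radical (K := Ω), mem_vanishingIdeal_iff]
  intro x hx
  rw [zeroLocus_span] at hx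
  have := h x (fun p hp => by simpa [aeval_eq_eval] using hx p hp)
  simp [this]

lemma Gd_exists {Ω : Type} [Field Ω] [IsAlgClosed Ω] (φ : MvPolynomial (Fin 3) Ω)
    (h : ∀ v : Fin 3 → Ω, (∀ j, eval v (pderiv j φ) = 0) → v = 0) :
    ∃ M e, Gd φ M e ≠ 0 := by
  classical
  have h1 : ∀ i : Fin 3, ∃ N, (X i : MvPolynomial (Fin 3) Ω) ^ N ∈
      Ideal.span (Set.range fun j => pderiv j φ) := fun i =>
    X_pow_mem (Set.range fun j => pderiv j φ) (fun v hv => h v fun j => hv _ ⟨j, rfl⟩) i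
  choose N hN using h1
  refine ⟨N 0 + N 1 + N 2, ?_⟩
  apply exists_minor (fun (x : Fin 3 × (Fin 3 →₀ ℕ)) (β : Mon (N 0 + N 1 + N 2)) =>
    coeff β.1 (monomial x.2 1 * pderiv x.1 φ))
  rw [eq_top_iff, ← (Pi.basisFun Ω (Mon (N 0 + N 1 + N 2))).span_eq, Submodule.span_le]
  rintro _ ⟨β, rfl⟩
  have hβ : ∃ i, N i ≤ β.1 i := by
    have h2 := mem_Mon.1 β.2
    rw [Finsupp.degree_eq_sum, Fin.sum_univ_three] at h2
    by_contra hcon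
    push Not at hcon
    have := hcon 0; have := hcon 1; have := hcon 2
    omega
  obtain ⟨i, hi⟩ := hβ
  have h3 : (monomial β.1 1 : MvPolynomial (Fin 3) Ω) ∈
      Ideal.span (Set.range fun j => pderiv j φ) := by
    have : (monomial β.1 1 : MvPolynomial (Fin 3) Ω) =
        monomial (β.1 - Finsupp.single i (N i)) 1 * X i ^ N i := by
      rw [X_pow_eq_monomial, monomial_mul, one_mul, tsub_add_cancel_of_le]
      simpa using hi
    rw [this]
    exact Ideal.mul_mem_left _ _ (hN i)
  rw [Ideal.mem_span_range_iff_exists_fun] at h3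
  obtain ⟨a, ha⟩ := h3
  have h4 : (Pi.basisFun Ω (Mon (N 0 + N 1 + N 2))) β = ∑ j, ∑ γ ∈ (a j).support,
      coeff γ (a j) • (fun β' : Mon (N 0 + N 1 + N 2) =>
        coeff β'.1 (monomial γ 1 * pderiv j φ)) := by
    ext β'
    simp only [Finset.sum_apply, Pi.smul_apply, smul_eq_mul]
    have h5 := congrArg (coeff β'.1) ha
    rw [coeff_sum] at h5
    have h6 : ∀ j, coeff β'.1 (a j * pderiv j φ) =
        ∑ γ ∈ (a j).support, coeff γ (a j) * coeff β'.1 (monomial γ 1 * pderiv j φ) := by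
      intro j
      conv_lhs => rw [(a j).as_sum, Finset.sum_mul, coeff_sum]
      refine Finset.sum_congr rfl fun γ _ => ?_
      rw [← coeff_C_mul, ← mul_assoc, C_mul_monomial, mul_one]
    rw [Finset.sum_congr rfl fun j _ => (h6 j).symm, h5, coeff_monomial]
    rw [Pi.basisFun_apply, Pi.single_apply]
    by_cases hb : β' = β
    · rw [if_pos hb, if_pos (by rw [hb])]
    · rw [if_neg hb, if_neg (fun h => hb (Subtype.ext h.symm))]
  rw [h4]
  refine Submodule.sum_mem _ fun j _ => Submodule.sum_mem _ fun γ _ =>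
    Submodule.smul_mem _ _ (Submodule.subset_span ⟨(j, γ), rfl⟩)

lemma Gd_smooth {R : Type} [CommRing R] [IsDomain R] (φ : MvPolynomial (Fin 3) R) (d M : ℕ)
    (hφ : φ.IsHomogeneous d) (e : Mon M → Fin 3 × (Fin 3 →₀ ℕ)) (hG : Gd φ M e ≠ 0)
    (v : Fin 3 → R) (hv : ∀ j, eval v (pderiv j φ) = 0) : v = 0 := by
  classical
  by_contra hv0
  apply hG
  unfold Gd
  rw [← Matrix.exists_vecMul_eq_zero_iff]
  refine ⟨fun β => ∏ i, v i ^ β.1 i, ?_, ?_⟩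
  · intro h0
    obtain ⟨i, hi⟩ : ∃ i, v i ≠ 0 := by
      by_contra hcon; push Not at hcon; exact hv0 (funext hcon)
    have h1 := congrFun h0 ⟨Finsupp.single i M, mem_Mon.2 (by simp)⟩
    simp only [Pi.zero_apply, Finset.prod_eq_zero_iff] at h1
    obtain ⟨j, -, hj⟩ := h1
    by_cases hij : i = j
    · subst hij
      rw [Finsupp.single_eq_same] at hj
      exact hi (eq_zero_of_pow_eq_zero hj)
    · simp [Finsupp.single_apply, hij] at hj
  · ext β'
    simp only [Matrix.vecMul, dotProduct, Matrix.of_apply, Pi.zero_apply]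
    obtain ⟨q, hq⟩ : ∃ q, q = monomial (e β').2 1 * pderiv (e β').1 φ := ⟨_, rfl⟩
    have hqh : q.IsHomogeneous ((e β').2.degree + (d - 1)) := by
      rw [hq]
      exact (isHomogeneous_monomial _ rfl).mul hφ.pderiv
    have hq0 : eval v q = 0 := by rw [hq, map_mul, hv, mul_zero]
    rw [← hq]
    by_cases hM : (e β').2.degree + (d - 1) = M
    · rw [hM] at hqh
      rw [← hq0, eval_eq', Finset.sum_coe_sort (Finset.univ.finsuppAntidiag M)
        (fun β => (∏ i, v i ^ β i) * coeff β q)]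
      symm
      rw [Finset.sum_subset (s₂ := Finset.univ.finsuppAntidiag M)]
      · exact Finset.sum_congr rfl fun _ _ => mul_comm _ _
      · intro β hβ
        rw [mem_Mon]
        have := hqh (mem_support_iff.1 hβ)
        rwa [Finsupp.degree_eq_weight_one]
      · intro β _ hβ
        rw [notMem_support_iff.1 hβ, zero_mul]
    · refine Finset.sum_eq_zero fun β _ => ?_
      rw [hqh.coeff_eq_zero, mul_zero]
      rw [mem_Mon.1 β.2]
      exact Ne.symm hM


lemma common_zero {K : Type} [Field K] [IsAlgClosed K] (a b : MvPolynomial (Fin 3) K)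
    (ha : eval 0 a = 0) (hb : eval 0 b = 0) : ∃ v : Fin 3 → K, v ≠ 0 ∧ eval v a = 0 ∧ eval v b = 0 := by
  classical
  by_contra hcon
  push Not at hcon
  have hX := X_pow_mem ({a, b} : Set (MvPolynomial (Fin 3) K)) (fun v hv => by
    by_contra hv0
    exact hcon v hv0 (hv a (by simp)) (hv b (by simp)))
  let g1 : (MvPolynomial (Fin 3) K) →ₐ[K] (MvPolynomial (Fin 3) K) := aeval ![0, X 1, X 2]
  let g2 : (MvPolynomial (Fin 3) K) →ₐ[K] (MvPolynomial (Fin 3) K) := aeval ![0, 0, X 2]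
  let g3 : (MvPolynomial (Fin 3) K) →ₐ[K] (MvPolynomial (Fin 3) K) := aeval ![0, 0, 0]
  have h21 : g2 = g2.comp g1 := by
    apply algHom_ext; intro i; fin_cases i <;> simp [g1, g2]
  have h32 : g3 = g3.comp g2 := by
    apply algHom_ext; intro i; fin_cases i <;> simp [g3, g2]
  have hp1 : (RingHom.ker g1).IsPrime := RingHom.ker_isPrime _
  have hp2 : (RingHom.ker g2).IsPrime := RingHom.ker_isPrime _
  have hp3 : (RingHom.ker g3).IsPrime := RingHom.ker_isPrime _
  have l0 : (⊥ : Ideal (MvPolynomial (Fin 3) K)) < RingHom.ker g1 := by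
    rw [bot_lt_iff_ne_bot]
    intro h
    have : (X 0 : (MvPolynomial (Fin 3) K)) ∈ RingHom.ker g1 := by simp [RingHom.mem_ker, g1]
    rw [h] at this
    simp at this
  have l1 : RingHom.ker g1 < RingHom.ker g2 := by
    refine lt_of_le_of_ne (fun x hx => ?_) (fun h => ?_)
    · rw [RingHom.mem_ker] at hx ⊢
      rw [h21, AlgHom.comp_apply, hx, map_zero]
    · have : (X 1 : (MvPolynomial (Fin 3) K)) ∈ RingHom.ker g2 := by simp [RingHom.mem_ker, g2]
      rw [← h, RingHom.mem_ker] at this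
      simp [g1] at this
  have l2 : RingHom.ker g2 < RingHom.ker g3 := by
    refine lt_of_le_of_ne (fun x hx => ?_) (fun h => ?_)
    · rw [RingHom.mem_ker] at hx ⊢
      rw [h32, AlgHom.comp_apply, hx, map_zero]
    · have : (X 2 : (MvPolynomial (Fin 3) K)) ∈ RingHom.ker g3 := by simp [RingHom.mem_ker, g3]
      rw [← h, RingHom.mem_ker] at this
      simp [g2] at this
  have k0 := Ideal.height_strict_mono_of_isPrime l0
  have k1 := Ideal.height_strict_mono_of_isPrime l1
  have k2 := Ideal.height_strict_mono_of_isPrime l2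
  have hg3 : ∀ p : (MvPolynomial (Fin 3) K), g3 p = C (eval 0 p) := by
    intro p
    have h1 : g3 = (Algebra.ofId K (MvPolynomial (Fin 3) K)).comp (aeval (0 : Fin 3 → K)) := by
      apply algHom_ext; intro i; fin_cases i <;> simp [g3]
    rw [h1]; simp [Algebra.ofId_apply, aeval_eq_eval, algebraMap_eq]
  have hmem : ∀ p : (MvPolynomial (Fin 3) K), p ∈ RingHom.ker g3 ↔ eval 0 p = 0 := by
    intro p; rw [RingHom.mem_ker, hg3]; simp
  have hmax : RingHom.ker g3 ∈ (Ideal.span (({a, b} : Finset (MvPolynomial (Fin 3) K)) : Set (MvPolynomial (Fin 3) K))).minimalPrimes := by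
    refine ⟨⟨hp3, ?_⟩, ?_⟩
    · rw [Ideal.span_le]
      intro p hp
      simp only [Finset.coe_insert, Finset.coe_singleton, Set.mem_insert_iff, Set.mem_singleton_iff] at hp
      rcases hp with rfl | rfl
      · exact (hmem _).2 ha
      · exact (hmem _).2 hb
    · rintro q ⟨hq, hq2⟩ -
      have hXq : ∀ i, (X i : (MvPolynomial (Fin 3) K)) ∈ q := by
        intro i
        have h1 := hX i
        have h2 : (Ideal.span ({a, b} : Set (MvPolynomial (Fin 3) K))).radical ≤ q := by
          rw [hq.radical_le_iff]; simpa using hq2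
        exact h2 h1
      intro p hp
      have hp' := (hmem p).1 hp
      rw [← Ideal.Quotient.eq_zero_iff_mem]
      have h3 : Ideal.Quotient.mkₐ K q = (Ideal.Quotient.mkₐ K q).comp g3 := by
        apply algHom_ext; intro i
        have : (Ideal.Quotient.mkₐ K q) (X i) = 0 := Ideal.Quotient.eq_zero_iff_mem.2 (hXq i)
        rw [AlgHom.comp_apply, this]
        fin_cases i <;> simp [g3]
      have h4 := congrArg (fun f => f p) h3
      simp only [AlgHom.comp_apply] at h4
      rw [(RingHom.mem_ker).1 hp, map_zero] at h4
      exact h4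
  have k3 := Ideal.height_le_card_of_mem_minimalPrimes_span_finset hmax
  have k4 : (RingHom.ker g3).height ≤ 2 :=
    k3.trans (by exact_mod_cast Finset.card_le_two)
  have e0 := Order.add_one_le_of_lt k0
  have e1 := Order.add_one_le_of_lt k1
  have e2 := Order.add_one_le_of_lt k2
  have : (3 : ℕ∞) ≤ 2 := by
    calc (3 : ℕ∞) = 0 + 1 + 1 + 1 := by norm_num
      _ ≤ (⊥ : Ideal (MvPolynomial (Fin 3) K)).height + 1 + 1 + 1 := by gcongr; exact zero_le
      _ ≤ (RingHom.ker g1).height + 1 + 1 := by gcongr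
      _ ≤ (RingHom.ker g2).height + 1 := by gcongr
      _ ≤ (RingHom.ker g3).height := e2
      _ ≤ 2 := k4
  exact absurd this (by norm_num)

lemma const_of_factor (φ a b : MvPolynomial (Fin 3) ℤ) (d : ℕ) (hφ : φ.IsHomogeneous d)
    (hφ0 : φ ≠ 0) (h : φ = a * b) (ha : eval 0 a ≠ 0) : a.totalDegree = 0 := by
  have key : a = C (eval 0 a) := by
    have h1 : (a - C (eval 0 a)) * φ = 0 := by
      apply MvPolynomial.funext
      intro v
      simp only [map_mul, map_sub, eval_C, map_zero]
      by_cases hv : eval v φ = 0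
      · rw [hv, mul_zero]
      have hs : ∀ p : MvPolynomial (Fin 3) ℤ, ∃ P : Polynomial ℤ, ∀ t : ℤ,
          P.eval t = eval (fun i => t * v i) p := by
        intro p
        refine ⟨aeval (fun i => Polynomial.X * Polynomial.C (v i)) p, fun t => ?_⟩
        rw [← Polynomial.coe_evalRingHom, aeval_def, ← coe_eval₂Hom, ← RingHom.comp_apply]
        congr 1
        ext i <;> simp
      obtain ⟨P, hP⟩ := hs a
      obtain ⟨Q, hQ⟩ := hs b
      have h2 : P * Q = Polynomial.C (eval v φ) * Polynomial.X ^ d := by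
        apply Polynomial.funext
        intro t
        rw [Polynomial.eval_mul, hP, hQ, ← map_mul, ← h, eval_scale d φ hφ v t]
        simp [mul_comm]
      have hP0 : P.eval 0 = eval 0 a := by rw [hP]; congr 1; ext <;> simp
      have h3 : P ∣ Polynomial.C (eval v φ) * Polynomial.X ^ d := ⟨Q, h2.symm⟩
      have hcop : ¬ Polynomial.X ∣ P := by
        rw [Polynomial.X_dvd_iff, Polynomial.coeff_zero_eq_eval_zero, hP0]; exact ha
      have h4 : Polynomial.X ^ d ∣ Q := by
        have : (Polynomial.X : Polynomial ℤ) ^ d ∣ P * Q := ⟨_, by rw [h2]; ring⟩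
        exact Polynomial.prime_X.pow_dvd_of_dvd_mul_left d hcop this
      obtain ⟨Q', hQ'⟩ := h4
      have h5 : P * Q' = Polynomial.C (eval v φ) := by
        have : Polynomial.X ^ d * (P * Q') = Polynomial.X ^ d * Polynomial.C (eval v φ) := by
          rw [mul_comm _ (Polynomial.C _), ← h2, hQ']; ring
        exact mul_left_cancel₀ (pow_ne_zero _ Polynomial.X_ne_zero) this
      have h6 : P.natDegree = 0 := by
        have h7 := congrArg Polynomial.natDegree h5
        have h8 : P * Q' ≠ 0 := by rw [h5]; simpa using hv
        rw [Polynomial.natDegree_mul (left_ne_zero_of_mul h8) (right_ne_zero_of_mul h8),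
          Polynomial.natDegree_C] at h7
        omega
      rw [Polynomial.natDegree_eq_zero] at h6
      obtain ⟨c, hc⟩ := h6
      have h9 : eval v a = eval 0 a := by
        rw [← hP0]
        have := hP 1
        simp only [one_mul] at this
        rw [← this, ← hc]; simp
      rw [h9, sub_self, zero_mul]
    have h2 := (mul_eq_zero.1 h1).resolve_right hφ0
    exact sub_eq_zero.1 h2
  rw [key, totalDegree_C]

lemma no_factor (φ : MvPolynomial (Fin 3) ℤ) (d M : ℕ) (hφ : φ.IsHomogeneous d) (hφ0 : φ ≠ 0)
    (e : Mon M → Fin 3 × (Fin 3 →₀ ℕ)) (hG : Gd φ M e ≠ 0) (a b : MvPolynomial (Fin 3) ℤ)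
    (h : φ = a * b) : a.totalDegree = 0 ∨ b.totalDegree = 0 := by
  by_contra hcon
  push Not at hcon
  have ha : eval 0 a = 0 := by
    by_contra h1; exact hcon.1 (const_of_factor φ a b d hφ hφ0 h h1)
  have hb : eval 0 b = 0 := by
    by_contra h1; exact hcon.2 (const_of_factor φ b a d hφ hφ0 (by rw [h, mul_comm]) h1)
  let K := AlgebraicClosure ℚ
  let f := Int.castRingHom K
  have hf : ∀ p : MvPolynomial (Fin 3) ℤ, eval 0 p = 0 → eval 0 (map f p) = 0 := by
    intro p hp
    have h1 : eval (f ∘ 0) (map f p) = f (eval 0 p) := by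
      rw [eval_map]; exact (eval₂_comp f 0 p).symm
    rw [hp, map_zero] at h1
    rw [← h1]; congr 1; ext <;> simp
  obtain ⟨v, hv, hva, hvb⟩ := common_zero (map f a) (map f b) (hf a ha) (hf b hb)
  apply hv
  apply Gd_smooth (map f φ) d M (hφ.map f) e
  · rw [← Gd_map]
    intro h0
    exact hG ((injective_iff_map_eq_zero f).1 (RingHom.injective_int f) _ h0)
  · intro j
    rw [h, map_mul, pderiv_mul]
    simp [hva, hvb]


/-- restriction of a polynomial to a parametrised linear subspace -/
noncomputable def restr {R : Type} [CommRing R] {n m : ℕ} (F : MvPolynomial (Fin n) R)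
    (U : Fin n → Fin m → R) : MvPolynomial (Fin m) R :=
  aeval (fun i => ∑ j, C (U i j) * X j) F

lemma restr_map {R S : Type} [CommRing R] [CommRing S] (f : R →+* S) {n m : ℕ}
    (F : MvPolynomial (Fin n) R) (U : Fin n → Fin m → R) :
    map f (restr F U) = restr (map f F) (fun i j => f (U i j)) := by
  unfold restr
  induction F using MvPolynomial.induction_on with
  | C a => simp [algebraMap_eq]
  | add p q hp hq => simp only [map_add, hp, hq]
  | mul_X p i hp => simp only [map_mul, hp, aeval_X, map_sum, map_X, map_C]

lemma eval_restr {R : Type} [CommRing R] {n m : ℕ}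
    (F : MvPolynomial (Fin n) R) (U : Fin n → Fin m → R) (v : Fin m → R) :
    eval v (restr F U) = eval (fun i => ∑ j, U i j * v j) F := by
  unfold restr
  induction F using MvPolynomial.induction_on with
  | C a => simp [algebraMap_eq]
  | add p q hp hq => simp only [map_add, hp, hq]
  | mul_X p i hp => simp only [map_mul, hp, aeval_X, map_sum, eval_X, eval_C]

lemma restr_hom {R : Type} [CommRing R] {n m d : ℕ}
    (F : MvPolynomial (Fin n) R) (hF : F.IsHomogeneous d) (U : Fin n → Fin m → R) :
    (restr F U).IsHomogeneous d := by
  have := hF.aeval (fun i => ∑ j, C (U i j) * X j) (n := 1) (fun i => by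
    apply IsHomogeneous.sum
    intro j _
    have := (isHomogeneous_C (Fin m) (U i j)).mul (isHomogeneous_X R j)
    simpa using this)
  rw [one_mul] at this
  exact this

lemma pderiv_restr {R : Type} [CommRing R] {n m : ℕ}
    (F : MvPolynomial (Fin n) R) (U : Fin n → Fin m → R) (j : Fin m) :
    pderiv j (restr F U) = ∑ i, restr (pderiv i F) U * C (U i j) := by
  unfold restr
  induction F using MvPolynomial.induction_on with
  | C a => simp [algebraMap_eq]
  | add p q hp hq => simp only [map_add, hp, hq, add_mul, Finset.sum_add_distrib]
  | mul_X p i hp =>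
    have h1 : pderiv j (∑ j', C (U i j') * X j' : MvPolynomial (Fin m) R) = C (U i j) := by
      rw [map_sum, Finset.sum_eq_single j]
      · simp [pderiv_mul]
      · intro b _ hb; simp [pderiv_mul, pderiv_X_of_ne hb]
      · simp
    simp only [map_mul, aeval_X, pderiv_mul, hp, h1, map_add, add_mul, Finset.sum_add_distrib]
    congr 1
    · rw [Finset.sum_mul]; exact Finset.sum_congr rfl fun _ _ => by ring
    · rw [Finset.sum_eq_single i]
      · simp
      · intro b _ hb; simp [pderiv_X_of_ne (Ne.symm hb)]
      · simp

lemma coeff_single_hom {R : Type} [CommRing R] {m d : ℕ}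
    (φ : MvPolynomial (Fin m) R) (hφ : φ.IsHomogeneous d) (j : Fin m) :
    coeff (Finsupp.single j d) φ = eval (Pi.single j 1) φ := by
  classical
  rw [eval_eq']
  rw [Finset.sum_eq_single (Finsupp.single j d)]
  · rw [Finset.prod_eq_one, mul_one]
    intro i _
    by_cases h : i = j
    · subst h; simp
    · rw [Finsupp.single_eq_of_ne (by tauto), pow_zero]
  · intro b hb hb2
    have h1 : b.degree = d := by
      rw [Finsupp.degree_eq_weight_one]; exact hφ (mem_support_iff.1 hb)
    obtain ⟨i, hi, hbi⟩ : ∃ i, i ≠ j ∧ b i ≠ 0 := by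
      by_contra hcon
      push Not at hcon
      apply hb2
      ext i
      by_cases h : i = j
      · subst h
        rw [Finsupp.degree_eq_sum, Finset.sum_eq_single i (fun i _ hi => hcon i hi) (by simp)] at h1
        simp [h1]
      · rw [hcon i h, Finsupp.single_eq_of_ne (by tauto)]
    rw [Finset.prod_eq_zero (Finset.mem_univ i), mul_zero]
    rw [Pi.single_eq_of_ne hi, zero_pow hbi]
  · intro h
    rw [notMem_support_iff.1 h, zero_mul]

lemma restr_coeff {n d : ℕ} (F : MvPolynomial (Fin n) ℤ) (hF : F.IsHomogeneous d)
    (U : Fin n → Fin 3 → ℤ) (j : Fin 3) :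
    coeff (Finsupp.single j d) (restr F U) = eval (fun i => U i j) F := by
  rw [coeff_single_hom _ (restr_hom F hF U), eval_restr]
  congr 2; ext i; simp [Pi.single_apply]


lemma eval_scale_gen {R : Type} [CommRing R] {n : ℕ} (d : ℕ) (f : MvPolynomial (Fin n) R)
    (hf : f.IsHomogeneous d) (x : Fin n → R)
    (c : R) : eval (fun i => c * x i) f = c ^ d * eval x f := by
  rw [eval_eq', eval_eq', Finset.mul_sum]
  refine Finset.sum_congr rfl fun α hα => ?_
  have hd : d = ∑ i, α i := by
    have h1 : α.degree = d := by
      rw [Finsupp.degree_eq_weight_one]; exact hf (mem_support_iff.1 hα)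
    rw [← h1, Finsupp.degree_eq_sum]
  simp only [mul_pow, Finset.prod_mul_distrib]
  rw [hd, Finset.prod_pow_eq_pow_sum]
  ring

lemma smooth_generic (k Ω : Type) [Field k] [CharZero k] [Field Ω] [Algebra k Ω] (n d : ℕ)
    (F : MvPolynomial (Fin n) k) (hF : F.IsHomogeneous d) (hd : d ≠ 0) (hF0 : F ≠ 0)
    (hdim : ringKrullDim (MvPolynomial (Fin n) k ⧸
      Ideal.span ({F} ∪ Set.range (fun i => pderiv i F))) + 4 ≤ (n : WithBot ℕ∞))
    (u : Fin n → Fin 3 → Ω) (hu : AlgebraicIndependent k (fun p : Fin n × Fin 3 => u p.1 p.2))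
    (v : Fin 3 → Ω) (hv : ∀ j, eval v (pderiv j (restr (map (algebraMap k Ω) F) u)) = 0) :
    v = 0 := by
  by_contra hv0
  obtain ⟨j₀, hj₀⟩ : ∃ j, v j ≠ 0 := by
    by_contra hcon; push Not at hcon; exact hv0 (funext hcon)
  refine generic_smooth k Ω n d F hF hd hF0 hdim u hu (fun j => (v j₀)⁻¹ * v j) j₀
    (inv_mul_cancel₀ hj₀) (fun j => ?_)
  have h1 := eval_scale_gen (d - 1) (pderiv j (restr (map (algebraMap k Ω) F) u))
    (restr_hom _ (hF.map (algebraMap k Ω)) u).pderiv v (v j₀)⁻¹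
  rw [hv, mul_zero, pderiv_restr, map_sum] at h1
  rw [← h1]
  refine Finset.sum_congr rfl fun i _ => ?_
  rw [map_mul, eval_C, eval_restr, pderiv_map, eval_map, aeval_def]

lemma eval_nat {R S : Type} [CommRing R] [CommRing S] (f : R →+* S) {n : ℕ}
    (v : Fin n → R) (p : MvPolynomial (Fin n) R) :
    f (eval v p) = eval (fun i => f (v i)) (map f p) := by
  rw [eval_map]; exact eval₂_comp f v p

/-- product of the quantities which must not vanish -/
noncomputable def QQ {R : Type} [CommRing R] {n : ℕ} (c : Fin 3 → Fin n)
    (F : MvPolynomial (Fin n) R) (V : Fin n → Fin n → R) (M : ℕ)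
    (e : Mon M → Fin 3 × (Fin 3 →₀ ℕ)) : R :=
  (∏ j, eval (fun i => V i (c j)) F) * Gd (restr F (fun i j => V i (c j))) M e

lemma QQ_map {R S : Type} [CommRing R] [CommRing S] (f : R →+* S) {n : ℕ} (c : Fin 3 → Fin n)
    (F : MvPolynomial (Fin n) R) (V : Fin n → Fin n → R) (M : ℕ)
    (e : Mon M → Fin 3 × (Fin 3 →₀ ℕ)) :
    f (QQ c F V M e) = QQ c (map f F) (fun i j => f (V i j)) M e := by
  unfold QQ
  rw [map_mul, map_prod, Gd_map, restr_map]
  simp only [eval_nat]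

/-- the universal form of degree `d` -/
noncomputable def UF (n d : ℕ) : MvPolynomial (Fin n) (MvPolynomial
    {α : Fin n →₀ ℕ // α ∈ (Finset.univ : Finset (Fin n)).finsuppAntidiag d} ℤ) :=
  ∑ α : {α : Fin n →₀ ℕ // α ∈ (Finset.univ : Finset (Fin n)).finsuppAntidiag d},
    monomial α.1 (X α)

lemma UF_map (n d : ℕ) (F : MvPolynomial (Fin n) ℤ) (hF : F.IsHomogeneous d) :
    map (eval (fun α : {α : Fin n →₀ ℕ // α ∈ (Finset.univ : Finset (Fin n)).finsuppAntidiag d} =>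
      coeff α.1 F)) (UF n d) = F := by
  unfold UF
  simp only [map_sum, map_monomial, eval_X]
  rw [Finset.sum_coe_sort ((Finset.univ : Finset (Fin n)).finsuppAntidiag d)
    (fun α => monomial α (coeff α F))]
  conv_rhs => rw [F.as_sum]
  symm
  apply Finset.sum_subset
  · intro β hβ
    have h1 : β.degree = d := by
      rw [Finsupp.degree_eq_weight_one]; exact hF (mem_support_iff.1 hβ)
    simpa [Finset.mem_finsuppAntidiag, Finsupp.degree_eq_sum] using h1
  · intro β _ hβ
    rw [notMem_support_iff.1 hβ, map_zero]

lemma rename_eval₂_C {σ τ : Type} (f : σ → τ) (p : MvPolynomial σ ℤ) :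
    rename f p = eval₂ C (fun i => X (f i)) p := by
  induction p using MvPolynomial.induction_on with
  | C a => rw [rename_C, eval₂_C]
  | add p q hp hq => rw [map_add, hp, hq, eval₂_add]
  | mul_X p i hp => rw [map_mul, hp, eval₂_mul, eval₂_X, rename_X]

lemma exists_V (n d : ℕ) (hd : d ≠ 0) (c : Fin 3 → Fin n) (hc : Function.Injective c)
    (F : MvPolynomial (Fin n) ℤ) (hF : F.IsHomogeneous d)
    (hF0 : map (Int.castRingHom (AlgebraicClosure ℚ)) F ≠ 0)
    (hdim : ringKrullDim (MvPolynomial (Fin n) (AlgebraicClosure ℚ) ⧸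
      Ideal.span ({map (Int.castRingHom (AlgebraicClosure ℚ)) F} ∪ Set.range (fun i =>
        pderiv i (map (Int.castRingHom (AlgebraicClosure ℚ)) F)))) + 4 ≤ (n : WithBot ℕ∞)) :
    ∃ (V : Matrix (Fin n) (Fin n) ℤ) (M : ℕ) (e : Mon M → Fin 3 × (Fin 3 →₀ ℕ)),
      V.det ≠ 0 ∧ QQ c F V M e ≠ 0 := by
  classical
  let k := AlgebraicClosure ℚ
  let Rk := MvPolynomial (Fin n × Fin n) k
  let Ω := AlgebraicClosure (FractionRing Rk)
  let P := MvPolynomial (Fin n × Fin n) ℤ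
  have hinj : Function.Injective (algebraMap Rk Ω) := by
    rw [IsScalarTower.algebraMap_eq Rk (FractionRing Rk) Ω]
    exact (algebraMap (FractionRing Rk) Ω).injective.comp (IsFractionRing.injective Rk _)
  let g : P →+* Ω := (algebraMap Rk Ω).comp (map (Int.castRingHom k))
  let V0 : Fin n → Fin 3 → P := fun i j => X (i, c j)
  let u : Fin n → Fin 3 → Ω := fun i j => g (V0 i j)
  have hu : AlgebraicIndependent k (fun p : Fin n × Fin 3 => u p.1 p.2) := by
    have h1 : AlgebraicIndependent k (fun p : Fin n × Fin n => algebraMap Rk Ω (X p)) :=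
      (algebraicIndependent_X (Fin n × Fin n) k).map' (f := IsScalarTower.toAlgHom k Rk Ω) hinj
    have h2 := h1.comp (fun p : Fin n × Fin 3 => (p.1, c p.2)) (by
      rintro ⟨a, b⟩ ⟨a', b'⟩ h
      simp only [Prod.mk.injEq] at h
      rw [h.1, hc h.2])
    convert h2 using 1
    ext p
    show algebraMap Rk Ω (map (Int.castRingHom k) (X (p.1, c p.2))) = _
    rw [map_X]; rfl
  obtain ⟨M, e, hMe⟩ := Gd_exists _ (smooth_generic k Ω n d _ (hF.map _) hd hF0 hdim u hu)
  let FP : MvPolynomial (Fin n) P := map C F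
  have h3 : map (algebraMap k Ω) (map (Int.castRingHom k) F) = map g FP := by
    rw [map_map, map_map]
    rw [RingHom.ext_int ((algebraMap k Ω).comp (Int.castRingHom k)) (g.comp C)]
  rw [h3, ← restr_map, ← Gd_map] at hMe
  have h4 : Gd (restr FP V0) M e ≠ 0 := fun h => hMe (by rw [h, map_zero])
  have hF00 : F ≠ 0 := fun h => hF0 (by rw [h, map_zero])
  have h5 : ∀ j, eval (fun i => V0 i j) FP ≠ 0 := by
    intro j h
    apply hF00
    apply rename_injective (fun i : Fin n => (i, c j)) (fun a b hab => by simpa using hab)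
    rw [map_zero, ← h, eval_map, rename_eval₂_C]
  have h6 : (Matrix.mvPolynomialX (Fin n) (Fin n) ℤ).det ≠ 0 :=
    Matrix.det_mvPolynomialX_ne_zero (Fin n) ℤ
  have h7 : (Matrix.mvPolynomialX (Fin n) (Fin n) ℤ).det *
      ((∏ j, eval (fun i => V0 i j) FP) * Gd (restr FP V0) M e) ≠ 0 :=
    mul_ne_zero h6 (mul_ne_zero (Finset.prod_ne_zero_iff.2 fun j _ => h5 j) h4)
  obtain ⟨x, hx⟩ : ∃ x : Fin n × Fin n → ℤ, eval x ((Matrix.mvPolynomialX (Fin n) (Fin n) ℤ).det *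
      ((∏ j, eval (fun i => V0 i j) FP) * Gd (restr FP V0) M e)) ≠ 0 := by
    by_contra hcon
    push Not at hcon
    exact h7 (MvPolynomial.funext fun x => by rw [hcon, map_zero])
  have h8 : map (eval x) FP = F := by
    rw [map_map, show (eval x).comp C = RingHom.id ℤ from RingHom.ext_int _ _, map_id]
  rw [map_mul, map_mul, map_prod, Gd_map, restr_map, h8] at hx
  have h9 : ∀ j, eval x (eval (fun i => V0 i j) FP) = eval (fun i => x (i, c j)) F := by
    intro j
    rw [eval_nat, h8]; simp [V0]
  simp only [h9] at hx
  refine ⟨Matrix.of fun i j => x (i, j), M, e, ?_, ?_⟩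
  · intro h
    apply left_ne_zero_of_mul hx
    rw [RingHom.map_det, ← h]
    congr 1
    ext i j
    simp [Matrix.mvPolynomialX]
  · have := right_ne_zero_of_mul hx
    simpa [V0, QQ] using this

lemma uniform_V (n d : ℕ) (hd : d ≠ 0) (c : Fin 3 → Fin n) (hc : Function.Injective c) :
    ∃ T : Finset (Matrix (Fin n) (Fin n) ℤ), (∀ V ∈ T, V.det ≠ 0) ∧
    ∀ F : MvPolynomial (Fin n) ℤ, F.IsHomogeneous d →
    map (Int.castRingHom (AlgebraicClosure ℚ)) F ≠ 0 →
    ringKrullDim (MvPolynomial (Fin n) (AlgebraicClosure ℚ) ⧸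
      Ideal.span ({map (Int.castRingHom (AlgebraicClosure ℚ)) F} ∪ Set.range (fun i =>
        pderiv i (map (Int.castRingHom (AlgebraicClosure ℚ)) F)))) + 4 ≤ (n : WithBot ℕ∞) →
    ∃ V ∈ T, ∃ (M : ℕ) (e : Mon M → Fin 3 × (Fin 3 →₀ ℕ)),
      QQ c F V M e ≠ 0 := by
  classical
  let σ : Type := {α : Fin n →₀ ℕ // α ∈ (Finset.univ : Finset (Fin n)).finsuppAntidiag d}
  obtain ⟨Q, hQd⟩ : ∃ Q : (Matrix (Fin n) (Fin n) ℤ) → (M : ℕ) →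
      (Mon M → Fin 3 × (Fin 3 →₀ ℕ)) → MvPolynomial σ ℤ, ∀ V M e, Q V M e =
        QQ c (UF n d) (fun i j => C (V i j)) M e := ⟨fun V M e => _, fun V M e => rfl⟩
  have hQ : ∀ F : MvPolynomial (Fin n) ℤ, F.IsHomogeneous d → ∀ V M e,
      eval (fun α : σ => coeff α.1 F) (Q V M e) = QQ c F V M e := by
    intro F hF V M e
    rw [hQd, QQ_map, UF_map n d F hF]
    simp only [eval_C]
  let S : Set (MvPolynomial σ ℤ) := {q | ∃ V M e, V.det ≠ 0 ∧ q = Q V M e}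
  obtain ⟨T, hTS, hT⟩ := (Submodule.fg_span_iff_fg_span_finset_subset S).1
    (IsNoetherian.noetherian (Submodule.span (MvPolynomial σ ℤ) S))
  have hch : ∀ q : T, ∃ V : Matrix (Fin n) (Fin n) ℤ, V.det ≠ 0 ∧ ∃ M e, q.1 = Q V M e := by
    intro q
    obtain ⟨V, M, e, h1, h2⟩ := hTS q.2
    exact ⟨V, h1, M, e, h2⟩
  choose W hW1 hW2 using hch
  refine ⟨Finset.univ.image W, ?_, ?_⟩
  · intro V hV
    obtain ⟨q, -, rfl⟩ := Finset.mem_image.1 hV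
    exact hW1 q
  · intro F hF hF0 hdim
    by_contra hcon
    push Not at hcon
    obtain ⟨V, M, e, hV, hne⟩ := exists_V n d hd c hc F hF hF0 hdim
    apply hne
    rw [← hQ F hF]
    have h1 : Q V M e ∈ Submodule.span (MvPolynomial σ ℤ) (T : Set (MvPolynomial σ ℤ)) := by
      rw [← hT]; exact Submodule.subset_span ⟨V, M, e, hV, rfl⟩
    have h2 : Ideal.span (T : Set (MvPolynomial σ ℤ)) ≤
        RingHom.ker (eval (fun α : σ => coeff α.1 F)) := by
      rw [Ideal.span_le]
      intro q hq
      obtain ⟨M, e, h3⟩ := hW2 ⟨q, hq⟩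
      have h4 : q = Q (W ⟨q, hq⟩) M e := h3
      show eval _ q = 0
      rw [h4, hQ F hF]
      exact hcon _ (Finset.mem_image_of_mem _ (Finset.mem_univ _)) M e
    exact h2 h1


/-- `p` and `q` have degree at most `e` and the same part of degree `e` -/
def Dtop (p q : MvPolynomial (Fin 3) ℤ) (e : ℕ) : Prop :=
  p.totalDegree ≤ e ∧ q.totalDegree ≤ e ∧ (p = q ∨ (p - q).totalDegree + 1 ≤ e)

lemma Dtop.mul {p q p' q' : MvPolynomial (Fin 3) ℤ} {e e' : ℕ} (h : Dtop p q e) (h' : Dtop p' q' e') :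
    Dtop (p * p') (q * q') (e + e') := by
  obtain ⟨h1, h2, h3⟩ := h
  obtain ⟨h1', h2', h3'⟩ := h'
  refine ⟨(totalDegree_mul _ _).trans (by omega), (totalDegree_mul _ _).trans (by omega), ?_⟩
  by_cases hp : p = q
  · by_cases hp' : p' = q'
    · left; rw [hp, hp']
    · right
      have h4 := h3'.resolve_left hp'
      rw [hp, ← mul_sub]
      have := totalDegree_mul q (p' - q')
      omega
  · right
    have h4 := h3.resolve_left hp
    have h5 : p * p' - q * q' = (p - q) * p' + q * (p' - q') := by ring
    have h6 := totalDegree_mul (p - q) p'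
    have h7 := totalDegree_mul q (p' - q')
    have h8 := totalDegree_add ((p - q) * p') (q * (p' - q'))
    rw [← h5] at h8
    rcases h3' with h9 | h9
    · rw [h9, sub_self, mul_zero, add_zero] at h5
      rw [h9, h5, ← h9]; omega
    · omega

lemma Dtop.one : Dtop 1 1 0 := ⟨by simp, by simp, Or.inl rfl⟩

lemma Dtop.pow {p q : MvPolynomial (Fin 3) ℤ} {e : ℕ} (h : Dtop p q e) (k : ℕ) :
    Dtop (p ^ k) (q ^ k) (k * e) := by
  induction k with
  | zero => simpa using Dtop.one
  | succ k ih => rw [pow_succ, pow_succ, Nat.succ_mul]; exact ih.mul h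

lemma Dtop.prod {ι : Type} (s : Finset ι) (p q : ι → MvPolynomial (Fin 3) ℤ) (e : ι → ℕ)
    (h : ∀ i, Dtop (p i) (q i) (e i)) : Dtop (∏ i ∈ s, p i) (∏ i ∈ s, q i) (∑ i ∈ s, e i) := by
  classical
  induction s using Finset.induction_on with
  | empty => simpa using Dtop.one
  | insert a s ha ih =>
    rw [Finset.prod_insert ha, Finset.prod_insert ha, Finset.sum_insert ha]
    exact (h a).mul ih

lemma Dtop.sub_lt {p q : MvPolynomial (Fin 3) ℤ} {e : ℕ} (he : 1 ≤ e) (h : Dtop p q e) :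
    (p - q).totalDegree < e := by
  rcases h.2.2 with h | h
  · rw [h, sub_self, totalDegree_zero]; omega
  · omega

/-- restriction to a translated linear subspace -/
noncomputable def arestr {n : ℕ} (F : MvPolynomial (Fin n) ℤ) (b : Fin n → ℤ)
    (U : Fin n → Fin 3 → ℤ) : MvPolynomial (Fin 3) ℤ :=
  aeval (fun i => C (b i) + ∑ j, C (U i j) * X j) F

lemma eval_arestr {n : ℕ} (F : MvPolynomial (Fin n) ℤ) (b : Fin n → ℤ)
    (U : Fin n → Fin 3 → ℤ) (v : Fin 3 → ℤ) :
    eval v (arestr F b U) = eval (fun i => b i + ∑ j, U i j * v j) F := by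
  unfold arestr
  induction F using MvPolynomial.induction_on with
  | C a => rw [aeval_C, algebraMap_eq, eval_C, eval_C]
  | add p q hp hq => simp only [map_add, hp, hq]
  | mul_X p i hp => simp only [map_mul, hp, aeval_X, map_add, map_sum, eval_X, eval_C]

lemma arestr_sub {n d : ℕ} (hd : 1 ≤ d) (F : MvPolynomial (Fin n) ℤ) (hF : F.IsHomogeneous d)
    (b : Fin n → ℤ) (U : Fin n → Fin 3 → ℤ) :
    (arestr F b U - restr F U).totalDegree < d := by
  unfold arestr restr
  rw [aeval_def, aeval_def, eval₂_eq', eval₂_eq', ← Finset.sum_sub_distrib]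
  refine lt_of_le_of_lt (totalDegree_finsetSum_le (d := d - 1) ?_) (by omega)
  intro α hα
  have h1 : α.degree = d := by
    rw [Finsupp.degree_eq_weight_one]; exact hF (mem_support_iff.1 hα)
  have hL : ∀ i, (∑ j, C (U i j) * X j : MvPolynomial (Fin 3) ℤ).totalDegree ≤ 1 := by
    intro i
    refine totalDegree_finsetSum_le fun j _ => ?_
    refine (totalDegree_mul _ _).trans ?_
    rw [totalDegree_C, totalDegree_X]
  have h2 : ∀ i, Dtop (C (b i) + ∑ j, C (U i j) * X j) (∑ j, C (U i j) * X j) 1 := by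
    intro i
    refine ⟨(totalDegree_add _ _).trans ?_, hL i, Or.inr ?_⟩
    · rw [totalDegree_C]; exact max_le (by omega) (hL i)
    · rw [add_sub_cancel_right, totalDegree_C]
  have h3 := Dtop.prod Finset.univ _ _ _ (fun i => (h2 i).pow (α i))
  simp only [mul_one] at h3
  rw [← Finsupp.degree_eq_sum, h1] at h3
  have h4 := h3.sub_lt hd
  rw [← mul_sub, algebraMap_eq]
  refine (totalDegree_mul _ _).trans ?_
  rw [totalDegree_C]
  omega


lemma count_slice (m d : ℕ) (hd : 4 ≤ d) (ε : ℝ) (hε : 0 < ε) : ∃ K : ℝ, 0 ≤ K ∧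
    ∀ V : Matrix (Fin (m + 3)) (Fin (m + 3)) ℤ, ∀ F : MvPolynomial (Fin (m + 3)) ℤ,
    F.IsHomogeneous d → ∀ M e, QQ (Fin.natAdd m) F V M e ≠ 0 → ∀ N : ℕ, 1 ≤ N →
    ∀ A : Finset (Fin (m + 3) → ℤ), (∀ η ∈ A, (∀ i, |η i| ≤ N) ∧ eval (V.mulVec η) F = 0) →
    (A.card : ℝ) ≤ K * (N : ℝ) ^ (1 + ε) * (3 * N) ^ m := by
  classical
  obtain ⟨K, hK0, hK⟩ := main3 d hd ε hε
  refine ⟨K, hK0, ?_⟩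
  intro V F hF M e hQ N hN A hA
  obtain ⟨φ, hφd⟩ : ∃ φ, φ = restr F (fun i j => V i (Fin.natAdd m j)) := ⟨_, rfl⟩
  have hφ : φ.IsHomogeneous d := by rw [hφd]; exact restr_hom F hF _
  unfold QQ at hQ
  rw [← hφd] at hQ
  have hG := right_ne_zero_of_mul hQ
  have hprod := Finset.prod_ne_zero_iff.1 (left_ne_zero_of_mul hQ)
  have hcoeff : ∀ j, coeff (Finsupp.single j d) φ ≠ 0 := by
    intro j
    rw [hφd, restr_coeff F hF]
    exact hprod j (Finset.mem_univ _)
  have hφ0 : φ ≠ 0 := by rintro h; exact hcoeff 0 (by rw [h, coeff_zero])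
  have hsm : ∀ v : Fin 3 → ℤ, v ≠ 0 → ∃ j, eval v (pderiv j φ) ≠ 0 := by
    intro v hv
    by_contra hcon
    push Not at hcon
    exact hv (Gd_smooth φ d M hφ e hG v hcon)
  have hno := no_factor φ d M hφ hφ0 e hG
  have hR0 : 0 ≤ K * (N : ℝ) ^ (1 + ε) := by positivity
  have hcard := card_le_fibre A (fun η => fun k : Fin m => η (Fin.castAdd 3 k))
    ⌊K * (N : ℝ) ^ (1 + ε)⌋₊ (by
      intro a A' hA' hfib
      apply Nat.le_floor
      have h1 : (A'.image (fun η => fun j : Fin 3 => η (Fin.natAdd m j))).card = A'.card := by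
        apply Finset.card_image_of_injOn
        intro η hη η' hη' heq
        funext i
        refine Fin.addCases (fun k => ?_) (fun j => ?_) i
        · exact (congrFun (hfib η hη) k).trans (congrFun (hfib η' hη') k).symm
        · exact congrFun heq j
      rw [← h1]
      refine hK (arestr F (fun i => ∑ k : Fin m, V i (Fin.castAdd 3 k) * a k)
        (fun i j => V i (Fin.natAdd m j))) φ hφ ?_ hcoeff hsm hno N hN _ ?_
      · rw [hφd]; exact arestr_sub (by omega) F hF _ _
      · intro x hx
        obtain ⟨η, hη, rfl⟩ := Finset.mem_image.1 hx
        obtain ⟨h2, h3⟩ := hA η (hA' hη)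
        refine ⟨fun i => h2 _, ?_⟩
        rw [eval_arestr, ← h3]
        congr 2
        funext i
        simp only [Matrix.mulVec, dotProduct]
        rw [Fin.sum_univ_add, ← hfib η hη])
    (Fintype.piFinset fun _ => Finset.Icc (-(N : ℤ)) N) (by
      intro η hη
      rw [Fintype.mem_piFinset]
      intro k
      rw [Finset.mem_Icc]
      exact abs_le.1 ((hA η hη).1 _))
  rw [Fintype.card_piFinset_const, Int.card_Icc] at hcard
  have h5 : ((N : ℤ) + 1 - -(N : ℤ)).toNat = 2 * N + 1 := by omega
  rw [h5] at hcard
  calc (A.card : ℝ) ≤ ((⌊K * (N : ℝ) ^ (1 + ε)⌋₊ * (2 * N + 1) ^ m : ℕ) : ℝ) := by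
        exact_mod_cast hcard
    _ = (⌊K * (N : ℝ) ^ (1 + ε)⌋₊ : ℝ) * (2 * N + 1) ^ m := by push_cast; ring
    _ ≤ K * (N : ℝ) ^ (1 + ε) * (3 * N) ^ m := by
        have hN' : (1 : ℝ) ≤ N := by exact_mod_cast hN
        gcongr
        · exact Nat.floor_le hR0
        · linarith

lemma count_V (m d : ℕ) (hd : 4 ≤ d) (ε : ℝ) (hε : 0 < ε)
    (V : Matrix (Fin (m + 3)) (Fin (m + 3)) ℤ) (hV : V.det ≠ 0) : ∃ K : ℝ, 0 ≤ K ∧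
    ∀ F : MvPolynomial (Fin (m + 3)) ℤ,
    F.IsHomogeneous d → ∀ M e, QQ (Fin.natAdd m) F V M e ≠ 0 → ∀ B : ℝ, 1 ≤ B →
    ((({ξ : Fin (m + 3) → ℤ | Finset.univ.gcd ξ = 1 ∧ (∀ i, (|ξ i| : ℝ) ≤ B) ∧
            eval ξ F = 0}.ncard : ℝ) ≤ K * B ^ (((m + 1 : ℕ) : ℝ) + ε))) := by
  classical
  obtain ⟨K, hK0, hK⟩ := count_slice m d hd ε hε
  obtain ⟨c, hc⟩ : ∃ c : ℕ, c = 1 + ∑ i, ∑ j, (V.adjugate i j).natAbs := ⟨_, rfl⟩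
  refine ⟨K * (c : ℝ) ^ (1 + ε) * (3 * c) ^ m, by positivity, ?_⟩
  intro F hF M e hQ B hB
  have hB0 : 0 < B := by linarith
  obtain ⟨N, hNd⟩ : ∃ N, N = ⌊B⌋₊ := ⟨_, rfl⟩
  have hN1 : 1 ≤ N := by rw [hNd]; exact Nat.le_floor (by simpa using hB)
  have hNB : (N : ℝ) ≤ B := by rw [hNd]; exact Nat.floor_le hB0.le
  obtain ⟨A, hAd⟩ : ∃ A, A = (Fintype.piFinset fun _ : Fin (m + 3) =>
    Finset.Icc (-(N : ℤ)) N).filter (fun ξ => eval ξ F = 0) := ⟨_, rfl⟩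
  have hsub : {ξ : Fin (m + 3) → ℤ | Finset.univ.gcd ξ = 1 ∧ (∀ i, (|ξ i| : ℝ) ≤ B) ∧
      eval ξ F = 0} ⊆ (A : Set (Fin (m + 3) → ℤ)) := by
    rintro ξ ⟨-, h1, h2⟩
    rw [Finset.mem_coe, hAd, Finset.mem_filter, Fintype.mem_piFinset]
    refine ⟨fun i => ?_, h2⟩
    rw [Finset.mem_Icc]
    have h3 : (ξ i).natAbs ≤ N := by
      rw [hNd]
      apply Nat.le_floor
      rw [Nat.cast_natAbs]
      exact_mod_cast h1 i
    omega
  have hle := Set.ncard_le_ncard hsub A.finite_toSet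
  rw [Set.ncard_coe_finset] at hle
  have hadj : ∀ ξ, V.mulVec (V.adjugate.mulVec ξ) = fun i => V.det * ξ i := by
    intro ξ
    rw [Matrix.mulVec_mulVec, Matrix.mul_adjugate, Matrix.smul_mulVec, Matrix.one_mulVec]
    rfl
  have himg : (A.image V.adjugate.mulVec).card = A.card := by
    apply Finset.card_image_of_injective
    intro ξ ξ' h
    have h1 := hadj ξ
    have h : V.adjugate.mulVec ξ = V.adjugate.mulVec ξ' := h
    rw [h, hadj] at h1
    funext i
    exact (mul_left_cancel₀ hV (congrFun h1 i)).symm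
  have hcN : 1 ≤ c * N := Nat.mul_pos (by omega) hN1
  have hfin := hK V F hF M e hQ (c * N) hcN (A.image V.adjugate.mulVec) (by
    intro η hη
    obtain ⟨ξ, hξ, rfl⟩ := Finset.mem_image.1 hη
    rw [hAd, Finset.mem_filter, Fintype.mem_piFinset] at hξ
    refine ⟨fun i => ?_, ?_⟩
    · have hb : ∀ j, |ξ j| ≤ N := fun j => abs_le.2 (Finset.mem_Icc.1 (hξ.1 j))
      simp only [Matrix.mulVec, dotProduct]
      calc |∑ j, V.adjugate i j * ξ j| ≤ ∑ j, |V.adjugate i j * ξ j| :=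
            Finset.abs_sum_le_sum_abs _ _
        _ ≤ ∑ j, ((V.adjugate i j).natAbs : ℤ) * N := by
            refine Finset.sum_le_sum fun j _ => ?_
            rw [abs_mul, Int.natCast_natAbs]
            exact mul_le_mul_of_nonneg_left (hb j) (abs_nonneg _)
        _ = ((∑ j, (V.adjugate i j).natAbs : ℕ) : ℤ) * N := by
            rw [Nat.cast_sum, Finset.sum_mul]
        _ ≤ (c : ℤ) * N := by
            have h1 : ∑ j, (V.adjugate i j).natAbs ≤ c := by
              have := Finset.single_le_sum (f := fun i => ∑ j, (V.adjugate i j).natAbs)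
                (fun _ _ => Nat.zero_le _) (Finset.mem_univ i)
              omega
            gcongr
        _ = ((c * N : ℕ) : ℤ) := by push_cast; ring
    · rw [hadj, eval_scale d F hF, hξ.2, mul_zero])
  rw [himg] at hfin
  have hc0 : (0 : ℝ) ≤ c := Nat.cast_nonneg _
  calc ((_ : ℕ) : ℝ) ≤ (A.card : ℝ) := by exact_mod_cast hle
    _ ≤ _ := hfin
    _ ≤ K * ((c : ℝ) * B) ^ (1 + ε) * (3 * (c * B)) ^ m := by
        push_cast
        gcongr
    _ = K * (c : ℝ) ^ (1 + ε) * (3 * c) ^ m * B ^ (((m + 1 : ℕ) : ℝ) + ε) := by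
        have h1 : (((m + 1 : ℕ) : ℝ) + ε) = (1 + ε) + (m : ℕ) := by push_cast; ring
        rw [h1, Real.rpow_add_natCast hB0.ne', Real.mul_rpow hc0 hB0.le, mul_pow, mul_pow, mul_pow]
        ring

/-- Corollary 0.2 of Salberger: a geometrically integral hypersurface
`X = {F = 0} ⊂ P^{r+1}` of degree `d ≥ 4` whose singular locus has codimension at least
three in `X` satisfies `N(X;B) = O_{d,r,ε}(B^{r+ε})`.  The codimension condition is
expressed by requiring that the coordinate ring of the affine cone over the singular
locus (over `ℚ̄`) has Krull dimension at most `r - 2`, and rational points of height at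
most `B` are counted by their primitive integral representatives. -/
theorem stmt_3 (r d : ℕ) (hr : 1 ≤ r) (hd : 4 ≤ d) (ε : ℝ) (hε : 0 < ε) :
    ∃ C : ℝ, ∀ F : MvPolynomial (Fin (r + 2)) ℤ,
      F.IsHomogeneous d →
      Irreducible (MvPolynomial.map (Int.castRingHom (AlgebraicClosure ℚ)) F) →
      (ringKrullDim (MvPolynomial (Fin (r + 2)) (AlgebraicClosure ℚ) ⧸
          Ideal.span ({MvPolynomial.map (Int.castRingHom (AlgebraicClosure ℚ)) F} ∪
            Set.range (fun i =>
              pderiv i (MvPolynomial.map (Int.castRingHom (AlgebraicClosure ℚ)) F))))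
          + 2 ≤ (r : WithBot ℕ∞)) →
      ∀ B : ℝ, 1 ≤ B →
        (({ξ : Fin (r + 2) → ℤ | Finset.univ.gcd ξ = 1 ∧ (∀ i, (|ξ i| : ℝ) ≤ B) ∧
            eval ξ F = 0}.ncard : ℝ) ≤ C * B ^ ((r : ℝ) + ε)) := by
  classical
  obtain ⟨m, rfl⟩ : ∃ m, r = m + 1 := ⟨r - 1, by omega⟩
  obtain ⟨T, hT1, hT2⟩ := uniform_V (m + 3) d (by omega) (Fin.natAdd m)
    (Fin.natAdd_injective 3 m)
  have hch : ∀ V : T, ∃ K : ℝ, 0 ≤ K ∧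
    ∀ F : MvPolynomial (Fin (m + 3)) ℤ,
    F.IsHomogeneous d → ∀ M e, QQ (Fin.natAdd m) F V.1 M e ≠ 0 → ∀ B : ℝ, 1 ≤ B →
    ((({ξ : Fin (m + 3) → ℤ | Finset.univ.gcd ξ = 1 ∧ (∀ i, (|ξ i| : ℝ) ≤ B) ∧
            eval ξ F = 0}.ncard : ℝ) ≤ K * B ^ (((m + 1 : ℕ) : ℝ) + ε))) :=
    fun V => count_V m d hd ε hε V.1 (hT1 V.1 V.2)
  choose K hK0 hK using hch
  refine ⟨∑ V, K V, ?_⟩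
  intro F hF hirr hdim B hB
  obtain ⟨V, hVT, M, e, hQ⟩ := hT2 F hF hirr.ne_zero (by
    have h1 := add_le_add_left hdim 2
    rw [add_assoc] at h1
    calc _ = _ := ?_
      _ ≤ _ := h1
      _ = _ := ?_
    · norm_num
    · push_cast; rw [add_assoc]; norm_num)
  refine (hK ⟨V, hVT⟩ F hF M e hQ B hB).trans ?_
  have h2 : K ⟨V, hVT⟩ ≤ ∑ V, K V :=
    Finset.single_le_sum (fun V _ => hK0 V) (Finset.mem_univ _)
  exact mul_le_mul_of_nonneg_right h2 (by positivity)
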